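/- Let ω^T ∈ A^{[AB]}(T) and let u_0^* be the backward-forward datum associated to ω^T. Then u_0^* is an extremal point of I_T^{[AB]}(ω^T): if u_{0,1}, u_{0,2} ∈ I_T^{[AB]}(ω^T), λ ∈ (0,1) and u_0^* = λ u_{0,1} + (1−λ) u_{0,2} a.e., then u_{0,1} = u_{0,2} = u_0^* a.e. Moreover u_0^* is the unique extremal point of I_T^{[AB]}(ω^T). -/

import Mathlib

open MeasureTheory Set Filter

noncomputable section

/-- The discontinuous flux `f(x,u) = f_l(u)` for `x < 0`, `f_r(u)` for `x > 0`
(the value at the interface is taken to be `f_r(u)`). -/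
def dflux (fl fr : ℝ → ℝ) (x u : ℝ) : ℝ := if x < 0 then fl u else fr u

/-- The connection function `c^{AB}`. -/
def cAB (A B : ℝ) (x : ℝ) : ℝ := if x ≤ 0 then A else B

/-- An `AB`-entropy solution of `u_t + f(x,u)_x = 0` on `ℝ × [0,∞)` with
initial datum `u0`, for the flux `f(x,·) = fl` on `x<0` and `fr` on `x>0`,
relative to the connection `(A,B)`.  The structure bundles the solution `u`
(as a function of `(x,t)`), its one-sided spatial limits `um x t = u(x-,t)` and
`up x t = u(x+,t)` (for `t > 0`), the weak (distributional) formulation, the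
Kružkov entropy inequalities away from the interface, the `AB`-interface
entropy inequality, `L¹_loc`-continuity in time and the initial condition. -/
structure ABSol (fl fr : ℝ → ℝ) (A B : ℝ) (u0 : ℝ → ℝ) where
  u : ℝ → ℝ → ℝ
  meas : Measurable (Function.uncurry u)
  bdd : ∃ M : ℝ, ∀ x t, |u x t| ≤ M
  um : ℝ → ℝ → ℝ
  up : ℝ → ℝ → ℝ
  um_spec : ∀ x t, 0 < t →
    Tendsto (fun y => u y t) (nhdsWithin x (Iio x)) (nhds (um x t))
  up_spec : ∀ x t, 0 < t →
    Tendsto (fun y => u y t) (nhdsWithin x (Ioi x)) (nhds (up x t))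
  weak : ∀ φ : ℝ → ℝ → ℝ,
    ContDiff ℝ 1 (fun p : ℝ × ℝ => φ p.1 p.2) →
    HasCompactSupport (fun p : ℝ × ℝ => φ p.1 p.2) →
    (∀ x t, t ≤ 0 → φ x t = 0) →
    (∫ p : ℝ × ℝ, (u p.1 p.2 * deriv (fun s => φ p.1 s) p.2 +
        dflux fl fr p.1 (u p.1 p.2) * deriv (fun y => φ y p.2) p.1)) = 0
  kruzkov_l : ∀ (k : ℝ) (φ : ℝ → ℝ → ℝ),
    ContDiff ℝ 1 (fun p : ℝ × ℝ => φ p.1 p.2) →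
    HasCompactSupport (fun p : ℝ × ℝ => φ p.1 p.2) →
    (∀ x t, 0 ≤ φ x t) →
    (∀ x t, 0 ≤ x ∨ t ≤ 0 → φ x t = 0) →
    0 ≤ ∫ p : ℝ × ℝ, (|u p.1 p.2 - k| * deriv (fun s => φ p.1 s) p.2 +
        Real.sign (u p.1 p.2 - k) * (fl (u p.1 p.2) - fl k) *
          deriv (fun y => φ y p.2) p.1)
  kruzkov_r : ∀ (k : ℝ) (φ : ℝ → ℝ → ℝ),
    ContDiff ℝ 1 (fun p : ℝ × ℝ => φ p.1 p.2) →
    HasCompactSupport (fun p : ℝ × ℝ => φ p.1 p.2) →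
    (∀ x t, 0 ≤ φ x t) →
    (∀ x t, x ≤ 0 ∨ t ≤ 0 → φ x t = 0) →
    0 ≤ ∫ p : ℝ × ℝ, (|u p.1 p.2 - k| * deriv (fun s => φ p.1 s) p.2 +
        Real.sign (u p.1 p.2 - k) * (fr (u p.1 p.2) - fr k) *
          deriv (fun y => φ y p.2) p.1)
  interfaceEntropy : ∀ φ : ℝ → ℝ → ℝ,
    ContDiff ℝ 1 (fun p : ℝ × ℝ => φ p.1 p.2) →
    HasCompactSupport (fun p : ℝ × ℝ => φ p.1 p.2) →
    (∀ x t, 0 ≤ φ x t) →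
    (∀ x t, t ≤ 0 → φ x t = 0) →
    0 ≤ ∫ p : ℝ × ℝ, (|u p.1 p.2 - cAB A B p.1| * deriv (fun s => φ p.1 s) p.2 +
        Real.sign (u p.1 p.2 - cAB A B p.1) *
          (dflux fl fr p.1 (u p.1 p.2) - dflux fl fr p.1 (cAB A B p.1)) *
          deriv (fun y => φ y p.2) p.1)
  timeCont : ∀ (r t₀ : ℝ), 0 ≤ t₀ →
    Tendsto (fun t => ∫ x in Icc (-r) r, |u x t - u x t₀|)
      (nhdsWithin t₀ (Ici 0)) (nhds 0)
  init : ∀ᵐ x : ℝ ∂volume, u x 0 = u0 x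

/-- `AB`-genuine/interface characteristic for the `AB`-entropy solution `sol`,
on the time interval `[0,T]`, where `γ = f_l(A) = f_r(B)`. -/
def IsABgic (T : ℝ) (fl fr : ℝ → ℝ) (γ : ℝ) {A B : ℝ} {u0 : ℝ → ℝ}
    (sol : ABSol fl fr A B u0) (ζ : ℝ → ℝ) : Prop :=
  (∃ K : NNReal, LipschitzOnWith K ζ (Icc 0 T)) ∧
  (∀ᵐ t ∂(volume.restrict (Icc 0 T)),
    (ζ t < 0 → HasDerivAt ζ (deriv fl (sol.um (ζ t) t)) t ∧
      deriv fl (sol.um (ζ t) t) = deriv fl (sol.up (ζ t) t)) ∧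
    (0 < ζ t → HasDerivAt ζ (deriv fr (sol.um (ζ t) t)) t ∧
      deriv fr (sol.um (ζ t) t) = deriv fr (sol.up (ζ t) t)) ∧
    (ζ t = 0 → fl (sol.um 0 t) = γ ∧ fr (sol.up 0 t) = γ))

/-- `C(u,x)`: the set of `AB`-genuine/interface characteristics of `sol`
reaching `x` at time `T`. -/
def charSet (T : ℝ) (fl fr : ℝ → ℝ) (γ : ℝ) {A B : ℝ} {u0 : ℝ → ℝ}
    (sol : ABSol fl fr A B u0) (x : ℝ) : Set (ℝ → ℝ) :=
  {ζ | IsABgic T fl fr γ sol ζ ∧ ζ T = x}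

/-- `C₀(u,x)`: the set of initial positions `ζ(0)` of characteristics in `C(u,x)`. -/
def charSet0 (T : ℝ) (fl fr : ℝ → ℝ) (γ : ℝ) {A B : ℝ} {u0 : ℝ → ℝ}
    (sol : ABSol fl fr A B u0) (x : ℝ) : Set ℝ :=
  (fun ζ : ℝ → ℝ => ζ 0) '' charSet T fl fr γ sol x

/-- Membership in `L^∞(ℝ)`: measurable and (essentially) bounded. -/
def IsLinf (g : ℝ → ℝ) : Prop :=
  Measurable g ∧ ∃ M : ℝ, ∀ᵐ x : ℝ ∂volume, |g x| ≤ M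

/-- `ω ∈ A^{[AB]}(T)`: the profile `ω` is attainable at time `T`. -/
def Attainable (T : ℝ) (fl fr : ℝ → ℝ) (A B : ℝ) (ω : ℝ → ℝ) : Prop :=
  ∃ u0 : ℝ → ℝ, IsLinf u0 ∧
    ∃ sol : ABSol fl fr A B u0, ∀ᵐ x : ℝ ∂volume, sol.u x T = ω x

/-- `I_T^{[AB]}(ω)`: the set of (bounded) initial data whose `AB`-entropy
solution coincides a.e. with `ω` at time `T`. -/
def InitialSet (T : ℝ) (fl fr : ℝ → ℝ) (A B : ℝ) (ω : ℝ → ℝ) : Set (ℝ → ℝ) :=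
  {u0 | IsLinf u0 ∧
    ∃ sol : ABSol fl fr A B u0, ∀ᵐ x : ℝ ∂volume, sol.u x T = ω x}

/-- `x` is a point of continuity of `ω`: the one-sided limits exist and coincide. -/
def ContinuityPt (ω : ℝ → ℝ) (x : ℝ) : Prop :=
  ∃ l : ℝ, Tendsto ω (nhdsWithin x (Iio x)) (nhds l) ∧
    Tendsto ω (nhdsWithin x (Ioi x)) (nhds l)

/-- `w` is an extremal point of the set `S ⊆ L^∞(ℝ)` (with functions identified
a.e.): `w ∈ S` and whenever `w` is a nontrivial convex combination (a.e.) of two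
elements of `S`, both of them coincide a.e. with `w`. -/
def IsExtremalPt (S : Set (ℝ → ℝ)) (w : ℝ → ℝ) : Prop :=
  w ∈ S ∧ ∀ u1 ∈ S, ∀ u2 ∈ S, ∀ lam : ℝ, lam ∈ Ioo (0:ℝ) 1 →
    (∀ᵐ x : ℝ ∂volume, w x = lam * u1 x + (1 - lam) * u2 x) →
    ((∀ᵐ x : ℝ ∂volume, u1 x = w x) ∧ (∀ᵐ x : ℝ ∂volume, u2 x = w x))

local notation:max "ι" n:max => 1 / ((n:ℝ)+1)
local notation:max "Dx" W:max p:max => fderiv ℝ W p (1,0)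
local notation:max "Dt" W:max p:max => fderiv ℝ W p (0,1)
local notation "Pl" => ℝ × ℝ
local notation "exz" => ((1:ℝ),(0:ℝ))
local notation "et" => ((0:ℝ),(1:ℝ))
local notation "sf" => (0:ℝ)
local notation "so" => (1:ℝ)
local notation "ln" => (by linarith)
local notation "ps" => (by positivity)
local notation "nn" => (by norm_num)
local notation "Mxl" => le_max_left _ _
local notation "Mxr" => le_max_right _ _
local notation "Mnl" => min_le_left _ _
local notation "Mnr" => min_le_right _ _
local notation "An" => abs_nonneg _
local notation "Mll" => mul_le_mul_of_nonneg_left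
local notation "Mlr" => mul_le_mul_of_nonneg_right
local notation "Ef" => Eventually.of_forall
local notation "Hcs" => HasCompactSupport
local notation "Lwz" => LipschitzWith
local notation "snw" => self_mem_nhdsWithin
local notation "Pn" => mul_nonneg
local notation "Re" => Real.dist_eq
local notation "Ra" => Real.norm_eq_abs
local notation "Ai" => abs_of_nonneg
local notation "mci" => measurable_const
local notation "cst" => continuous_const
structure Adm (a : ℝ) (f : ℝ → ℝ) (E R : ℝ) : Prop where
  ha : 0 < a
  C2 : ContDiff ℝ 2 f
  h2 : ∀ w, a ≤ deriv (deriv f) w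
  hR : 0 < R
  hE : ∀ k, |k| ≤ R → f k ≤ E
def cc (f : ℝ → ℝ) (E s d : ℝ) : ℝ := sSup ((fun k => k * d - f k * s) '' {k | f k ≤ E})
lemma C2_diff {f : ℝ → ℝ} (C2 : ContDiff ℝ 2 f) : Differentiable ℝ f :=
  C2.differentiable nn
lemma C2_diff' {f : ℝ → ℝ} (C2 : ContDiff ℝ 2 f) : Differentiable ℝ (deriv f) := by
  have : ContDiff ℝ (1+1) f := by simpa [one_add_one_eq_two] using C2
  exact (contDiff_succ_iff_deriv.1 this).2.2.differentiable nn
lemma deriv_growth {a : ℝ} {f : ℝ → ℝ} (C2 : ContDiff ℝ 2 f) (h2 : ∀ w, a ≤ deriv (deriv f) w)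
    {x y : ℝ} (h : x ≤ y) : a * (y - x) ≤ deriv f y - deriv f x :=
  mul_sub_le_image_sub_of_le_deriv (C2_diff' C2) h2 h
lemma uconv {a : ℝ} {f : ℝ → ℝ} (C2 : ContDiff ℝ 2 f) (h2 : ∀ w, a ≤ deriv (deriv f) w)
    (x y : ℝ) : f x + deriv f x * (y - x) + a / 2 * (y - x)^2 ≤ f y := by
  have hd := C2_diff C2
  set g : ℝ → ℝ := fun z => f z - (f x + deriv f x * (z - x) + a / 2 * (z - x)^2) with hg
  have hgd : ∀ z, HasDerivAt g (deriv f z - deriv f x - a * (z - x)) z := by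
    intro z
    have sa := (hd z).hasDerivAt
    have h2 : HasDerivAt (fun z => z - x) 1 z := (hasDerivAt_id z).sub_const x
    have sd := ((h2.const_mul (deriv f x)).const_add (f x)).add ((h2.pow 2).const_mul (a/2))
    refine (sa.sub sd).congr_deriv ?_
    simp; ring
  have hgD : Differentiable ℝ g := fun z => (hgd z).differentiableAt
  have g0 : g x = 0 := by simp [hg]
  suffices 0 ≤ g y by simp only [hg] at this; linarith
  rcases le_total x y with h | h
  · have : MonotoneOn g (Ici x) := by
      apply monotoneOn_of_deriv_nonneg (convex_Ici x) hgD.continuous.continuousOn hgD.differentiableOn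
      intro z hz
      rw [interior_Ici] at hz
      rw [(hgd z).deriv]
      linarith [deriv_growth C2 h2 (le_of_lt hz)]
    rw [← g0]; exact this self_mem_Ici h h
  · have : AntitoneOn g (Iic x) := by
      apply antitoneOn_of_deriv_nonpos (convex_Iic x) hgD.continuous.continuousOn hgD.differentiableOn
      intro z hz
      rw [interior_Iic] at hz
      rw [(hgd z).deriv]
      linarith [deriv_growth C2 h2 (le_of_lt hz)]
    rw [← g0]; exact this h self_mem_Iic h
namespace Adm
variable {a E R : ℝ} {f : ℝ → ℝ}
local notation "AA" => Adm a f E R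
lemma neg (h : AA) : Adm a (fun k => f (-k)) E R where
  ha := h.ha
  C2 := h.C2.comp contDiff_neg
  h2 := by
    intro w
    have sa : deriv (fun k => f (-k)) = fun k => - deriv f (-k) := by
      funext k; exact deriv_comp_neg f k
    rw [sa]
    have : deriv (fun k => - deriv f (-k)) w = deriv (deriv f) (-w) := by
      rw [deriv.fun_neg, deriv_comp_neg (deriv f)]; ring
    rw [this]; exact h.h2 _
  hR := h.hR
  hE := fun k hk => h.hE _ (by simpa using hk)
lemma mono (h : AA) {ec} (hE : E ≤ ec) : Adm a f ec R :=
  ⟨h.ha, h.C2, h.h2, h.hR, fun k hk => (h.hE k hk).trans hE⟩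
lemma uc (h : AA) (x y : ℝ) : f x + deriv f x * (y - x) + a / 2 * (y - x)^2 ≤ f y :=
  uconv h.C2 h.h2 x y
lemma cont (h : AA) : Continuous f := h.C2.continuous
lemma hcv (h : AA) : ConvexOn ℝ univ f := by
  have hm : Monotone (deriv f) := by
    intro x y hxy
    have := deriv_growth h.C2 h.h2 hxy
    nlinarith [h.ha, sub_nonneg.2 hxy, Pn h.ha.le (sub_nonneg.2 hxy)]
  exact hm.convexOn_univ_of_deriv (C2_diff h.C2)
lemma cvx (h : AA) : Convex ℝ {k | f k ≤ E} := by
  simpa using h.hcv.convex_le E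
lemma bnd (h : AA) : ∃ L, 0 < L ∧ R ≤ L ∧ |E| ≤ L ∧ ∀ k, f k ≤ E → |k| ≤ L ∧ |f k| ≤ L := by
  set C := |f 0| + |deriv f 0| + |E| + R with hC
  have ha := h.ha
  have hR := h.hR
  have hCp : 0 ≤ |f 0| ∧ 0 ≤ |deriv f 0| ∧ 0 ≤ |E| := ⟨An, An, An⟩
  have key : ∀ k, f k ≤ E → |k| ≤ 1 + 2 * C / a := by
    intro k hk
    by_contra hlt
    push Not at hlt
    have sa := h.uc 0 k
    have hk1 : 1 < |k| := by
      have : 0 ≤ 2 * C / a := by positivity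
      linarith
    have hk2 : 2 * C < a * (|k| - 1) := by
      have : 2 * C / a < |k| - 1 := by linarith
      rwa [div_lt_iff₀' ha] at this
    have h2 : -(|deriv f 0| * |k|) ≤ deriv f 0 * k := by
      rw [← abs_mul]; exact neg_abs_le _
    have sd : (k:ℝ)^2 = |k|^2 := (sq_abs k).symm
    simp only [sub_zero] at sa
    rw [sd] at sa
    have si := neg_abs_le (f 0)
    have sm := le_abs_self E
    nlinarith [mul_pos ha (by linarith : 0 < |k|), Mll hk1.le hCp.1, Mll hk1.le hCp.2.2]
  obtain ⟨M, hM⟩ := (isCompact_Icc (a := -(1+2*C/a)) (b := 1+2*C/a)).exists_bound_of_continuousOn h.cont.continuousOn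
  have hpos : 0 ≤ 2 * C / a := by positivity
  refine ⟨1 + 2*C/a + |M| + |E| + R, by positivity, by linarith [abs_nonneg M], by linarith [abs_nonneg M], fun k hk => ?_⟩
  have hk1 := key k hk
  have := hM k (abs_le.1 hk1)
  rw [Real.norm_eq_abs] at this
  have := le_abs_self M
  constructor <;> linarith [abs_nonneg M]
lemma cpt (h : AA) : IsCompact {k | f k ≤ E} := by
  obtain ⟨L, _, _, _, hL⟩ := h.bnd
  refine (isCompact_Icc (a := -L) (b := L)).of_isClosed_subset (isClosed_le h.cont cst) ?_
  intro k hk; exact abs_le.1 (hL k hk).1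
lemma zero_mem (h : AA) : f 0 ≤ E := h.hE 0 (by simpa using h.hR.le)
lemma argmax (h : AA) (s d : ℝ) : ∃ k, f k ≤ E ∧ cc f E s d = k * d - f k * s ∧
    ∀ ka, f ka ≤ E → ka * d - f ka * s ≤ k * d - f k * s := by
  have hc : Continuous (fun k => k * d - f k * s) := by have := h.cont; fun_prop
  obtain ⟨k, hk, hmax⟩ := h.cpt.exists_isMaxOn ⟨0, h.zero_mem⟩ hc.continuousOn
  refine ⟨k, hk, ?_, fun ka sr => hmax sr⟩
  apply IsGreatest.csSup_eq
  refine ⟨⟨k, hk, rfl⟩, ?_⟩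
  rintro _ ⟨ka, sr, rfl⟩
  exact hmax sr
lemma ge (h : AA) (s d : ℝ) {k : ℝ} (hk : f k ≤ E) : k * d - f k * s ≤ cc f E s d := by
  obtain ⟨ka, _, h2, sd⟩ := h.argmax s d
  rw [h2]; exact sd k hk
lemma sub (h : AA) (s sl d da : ℝ) : cc f E (s+sl) (d+da) ≤ cc f E s d + cc f E sl da := by
  obtain ⟨k, sa, h2, _⟩ := h.argmax (s+sl) (d+da)
  have := h.ge s d sa
  have := h.ge sl da sa
  rw [h2]; linarith
lemma sub' (h : AA) {s sl s'' d da d'' : ℝ} (hs : s'' = s + sl) (hd : d'' = d + da) :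
    cc f E s'' d'' ≤ cc f E s d + cc f E sl da := by
  subst hs hd; exact h.sub ..
lemma zero (h : AA) : cc f E 0 0 = 0 := by
  obtain ⟨k, sa, h2, _⟩ := h.argmax 0 0
  rw [h2]; ring
lemma hom (h : AA) (s d : ℝ) {l : ℝ} (hl : 0 ≤ l) : cc f E (l*s) (l*d) = l * cc f E s d := by
  obtain ⟨k, sa, h2, sd⟩ := h.argmax s d
  obtain ⟨ka, h1', h2', h3'⟩ := h.argmax (l*s) (l*d)
  have eb := h3' k sa
  have ea := Mll (sd ka h1') hl
  rw [h2, h2']; linarith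
lemma coer (h : AA) (s d : ℝ) (hs : 0 ≤ s) : R * |d| - E * s ≤ cc f E s d := by
  rcases abs_cases d with ⟨sa, _⟩ | ⟨sa, _⟩
  · have sd := h.hE R (by rw [abs_of_pos h.hR])
    have h2 := h.ge s d sd
    rw [sa]; nlinarith
  · have sd := h.hE (-R) (by rw [abs_neg, abs_of_pos h.hR])
    have h2 := h.ge s d sd
    rw [sa]; nlinarith
lemma endp (h : AA) : (∃ β, R ≤ β ∧ f β = E) ∧ ∃ α, α ≤ -R ∧ f α = E := by
  obtain ⟨L, tp, hRL, hEL, hL⟩ := h.bnd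
  constructor
  · have hb : E ≤ f (L+1) := by
      by_contra hc; push Not at hc
      have := (hL _ hc.le).1
      rw [abs_of_pos ln] at this; linarith
    have := intermediate_value_Icc (a := R) (b := L+1) ln h.cont.continuousOn
    obtain ⟨β, hβ, e⟩ := this ⟨h.hE R (by rw [abs_of_pos h.hR]), hb⟩
    exact ⟨β, hβ.1, e⟩
  · have hb : E ≤ f (-(L+1)) := by
      by_contra hc; push Not at hc
      have := (hL _ hc.le).1
      rw [abs_neg, abs_of_pos ln] at this; linarith
    have := intermediate_value_Icc' (a := -(L+1)) (b := -R) ln h.cont.continuousOn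
    obtain ⟨β, hβ, e⟩ := this ⟨h.hE (-R) (by rw [abs_neg, abs_of_pos h.hR]), hb⟩
    exact ⟨β, hβ.2, e⟩
lemma coer' (h : AA) (s d : ℝ) : R * |d| - E * s ≤ cc f E s d := by
  obtain ⟨⟨β, hβ, e⟩, ⟨α, hα, ei⟩⟩ := h.endp
  rcases abs_cases d with ⟨sa, _⟩ | ⟨sa, _⟩
  · have h2 := h.ge s d e.le
    rw [e] at h2; rw [sa]; nlinarith
  · have h2 := h.ge s d ei.le
    rw [ei] at h2; rw [sa]; nlinarith
lemma lip (h : AA) {L : ℝ} (hL : ∀ k, f k ≤ E → |k| ≤ L ∧ |f k| ≤ L) (s d sl da : ℝ) :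
    cc f E s d ≤ cc f E sl da + L * (|s - sl| + |d - da|) := by
  obtain ⟨k, sa, h2, _⟩ := h.argmax s d
  have sd := h.ge sl da sa
  have eb : k * (d - da) ≤ L * |d - da| := by
    refine (le_abs_self _).trans ?_
    rw [abs_mul]; gcongr; exact (hL k sa).1
  have ea : -(f k * (s - sl)) ≤ L * |s - sl| := by
    refine (neg_le_abs _).trans ?_
    rw [abs_mul]; gcongr; exact (hL k sa).2
  rw [h2]; nlinarith
lemma continuous (h : AA) : Continuous (fun p : Pl => cc f E p.1 p.2) := by
  obtain ⟨L, tp, -, -, hL⟩ := h.bnd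
  have : Lwz (Real.toNNReal (2*L)) (fun p : Pl => cc f E p.1 p.2) := by
    apply LipschitzWith.of_le_add_mul
    intro p q
    refine (h.lip hL p.1 p.2 q.1 q.2).trans ?_
    rw [Real.coe_toNNReal _ ps]
    have sa : |p.1 - q.1| ≤ dist p q := by rw [← Real.dist_eq]; exact Mxl
    have h2 : |p.2 - q.2| ≤ dist p q := by rw [← Real.dist_eq]; exact Mxr
    nlinarith
  exact this.continuous
lemma vari (h : AA) {s d k ka : ℝ} (hk : f k ≤ E) (sr : f ka ≤ E)
    (hm : ∀ ka, f ka ≤ E → ka * d - f ka * s ≤ k * d - f k * s) :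
    (d - deriv f k * s) * (ka - k) ≤ 0 := by
  set g : ℝ → ℝ := fun r => (k + r * (ka - k)) * d - f (k + r * (ka - k)) * s with hg
  have hgd : HasDerivAt g ((d - deriv f k * s) * (ka - k)) 0 := by
    have eb : HasDerivAt (fun r : ℝ => k + r * (ka - k)) (ka - k) 0 := by
      simpa using ((hasDerivAt_id sf).mul_const (ka - k)).const_add k
    have ea : HasDerivAt f (deriv f k) ((fun r : ℝ => k + r * (ka - k)) 0) := by
      simpa using (C2_diff h.C2 k).hasDerivAt
    have ed := ea.comp sf eb
    refine ((eb.mul_const d).sub (ed.mul_const s)).congr_deriv ?_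
    ring
  by_contra hpos
  push Not at hpos
  have hmin : ∀ r ∈ Icc sf 1, g r ≤ g 0 := by
    intro r hr
    have hmem : f (k + r * (ka - k)) ≤ E := by
      have := h.cvx (show k ∈ {k | f k ≤ E} from hk) (show ka ∈ {k | f k ≤ E} from sr)
        (by linarith [hr.2] : sf ≤ 1 - r) hr.1 (by ring)
      have e : (1 - r) • k + r • ka = k + r * (ka - k) := by simp; ring
      rwa [e] at this
    have := hm _ hmem
    simp [hg]; linarith
  have ht := hgd.tendsto_slope_zero_right
  have : ∀ᶠ r in nhdsWithin sf (Ioi 0), r⁻¹ • (g (0 + r) - g 0) ≤ 0 := by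
    filter_upwards [Ioo_mem_nhdsGT (show sf < 1 by norm_num)] with r hr
    have := hmin r ⟨hr.1.le, hr.2.le⟩
    rw [zero_add, smul_eq_mul]
    exact mul_nonpos_of_nonneg_of_nonpos (inv_nonneg.2 hr.1.le) ln
  have := le_of_tendsto ht this
  linarith
lemma strong (h : AA) {s d k ka : ℝ} (hs : 0 ≤ s) (hk : f k ≤ E) (sr : f ka ≤ E)
    (hm : ∀ ka, f ka ≤ E → ka * d - f ka * s ≤ k * d - f k * s) :
    ka * d - f ka * s + a / 2 * s * (ka - k)^2 ≤ k * d - f k * s := by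
  have sa := h.vari hk sr hm
  have h2 := Mlr (h.uc k ka) hs
  nlinarith
lemma lipf (h : AA) : ∃ Λ, 0 < Λ ∧ (∀ k, f k ≤ E → |deriv f k| ≤ Λ) ∧
    ∀ k ka, f k ≤ E → f ka ≤ E → |f ka - f k| ≤ Λ * |ka - k| := by
  have hc : Continuous (deriv f) := (C2_diff' h.C2).continuous
  obtain ⟨M, hM⟩ := h.cpt.exists_bound_of_continuousOn hc.continuousOn
  have hM' : ∀ k, f k ≤ E → |deriv f k| ≤ |M| + 1 := by
    intro k hk
    have := hM k hk
    rw [Real.norm_eq_abs] at this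
    linarith [le_abs_self M]
  refine ⟨|M| + 1, by positivity, hM', ?_⟩
  intro k ka hk sr
  have := h.cvx.norm_image_sub_le_of_norm_deriv_le (f := f) (C := |M|+1) (fun x _ => C2_diff h.C2 x)
    (fun x hx => by rw [Real.norm_eq_abs]; exact hM' x hx) hk sr
  simpa [Real.norm_eq_abs] using this
lemma quad (h : AA) {Λ s d k sl da : ℝ} (hs : 0 < s) (hk : f k ≤ E)
    (hm : ∀ ka, f ka ≤ E → ka * d - f ka * s ≤ k * d - f k * s)
    (hΛ : ∀ k ka, f k ≤ E → f ka ≤ E → |f ka - f k| ≤ Λ * |ka - k|) :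
    cc f E sl da ≤ k * da - f k * sl + (|da - d| + Λ * |sl - s|)^2 / (2 * a * s) := by
  obtain ⟨ka, sa, h2, -⟩ := h.argmax sl da
  have sd := h.strong hs.le hk sa hm
  have eb : (ka - k) * (da - d) ≤ |ka - k| * |da - d| := by rw [← abs_mul]; exact le_abs_self _
  have ea : -((f ka - f k) * (sl - s)) ≤ Λ * |ka - k| * |sl - s| := by
    refine (neg_le_abs _).trans ?_
    rw [abs_mul]; gcongr; exact hΛ _ _ hk sa
  have ha := h.ha
  set X := |da - d| + Λ * |sl - s|
  have ed : |ka - k| * X - a / 2 * s * (ka - k)^2 ≤ X^2 / (2 * a * s) := by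
    rw [le_div_iff₀ ps, ← sq_abs (ka - k)]
    nlinarith [sq_nonneg (X - a * s * |ka - k|)]
  rw [h2]
  simp only [X] at ed ⊢
  nlinarith
lemma neg_cc (h : AA) (s d : ℝ) : cc (fun k => f (-k)) E s d = cc f E s (-d) := by
  obtain ⟨k, sa, h2, sd⟩ := h.argmax s (-d)
  obtain ⟨ka, h1', h2', h3'⟩ := h.neg.argmax s d
  have eb := sd (-ka) h1'
  have ea := h3' (-k) (by simpa using sa)
  simp only [neg_neg] at ea
  rw [h2, h2']; linarith
lemma theta_min (h : AA) {θ : ℝ} (hθ : deriv f θ = 0) (k : ℝ) :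
    f θ + a/2*(k-θ)^2 ≤ f k := by
  have := h.uc θ k; rw [hθ] at this; linarith
lemma theta_le (h : AA) {θ : ℝ} (hθ : deriv f θ = 0) (k : ℝ) : f θ ≤ f k := by
  have := h.theta_min hθ k; nlinarith [h.ha, Pn h.ha.le (sq_nonneg (k-θ))]
lemma theta_mem (h : AA) {θ : ℝ} (hθ : deriv f θ = 0) : f θ ≤ E :=
  (h.theta_le hθ 0).trans h.zero_mem
lemma cc_zero (h : AA) {θ : ℝ} (hθ : deriv f θ = 0) {s : ℝ} (hs : 0 ≤ s) :
    cc f E s 0 = - f θ * s := by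
  obtain ⟨k, sa, h2, sd⟩ := h.argmax s 0
  have := sd θ (h.theta_mem hθ)
  have := Mlr (h.theta_le hθ k) hs
  rw [h2]; linarith
lemma arg_ge (h : AA) {θ : ℝ} (hθ : deriv f θ = 0) {s d k : ℝ} (hs : 0 < s) (hd : 0 ≤ d)
    (hk : f k ≤ E) (hm : ∀ ka, f ka ≤ E → ka * d - f ka * s ≤ k * d - f k * s) : θ ≤ k := by
  by_contra hlt
  push Not at hlt
  have sa := h.strong hs.le hk (h.theta_mem hθ) hm
  have h2 := Mlr (h.theta_le hθ k) hs.le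
  have sd : 0 < (θ - k)^2 := by have : 0 < θ - k := by linarith
                                positivity
  nlinarith [Pn hd (sub_nonneg.2 hlt.le), mul_pos (mul_pos h.ha hs) sd]
lemma arg_le (h : AA) {θ : ℝ} (hθ : deriv f θ = 0) {s d k : ℝ} (hs : 0 < s) (hd : d ≤ 0)
    (hk : f k ≤ E) (hm : ∀ ka, f ka ≤ E → ka * d - f ka * s ≤ k * d - f k * s) : k ≤ θ := by
  by_contra hlt
  push Not at hlt
  have sa := h.strong hs.le hk (h.theta_mem hθ) hm
  have h2 := Mlr (h.theta_le hθ k) hs.le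
  have sd : 0 < (θ - k)^2 := by have : 0 < k - θ := by linarith
                                nlinarith
  nlinarith [Pn (neg_nonneg.2 hd) (sub_nonneg.2 hlt.le), mul_pos (mul_pos h.ha hs) sd]
end Adm
def bmp (j : ℕ) : ContDiffBump (0 : Pl) where
  rIn := 1 / (2 * ((j:ℝ) + 1))
  rOut := ι j
  rIn_pos := by positivity
  rIn_lt_rOut := by
    apply one_div_lt_one_div_of_lt ps; linarith [(Nat.cast_nonneg j : sf ≤ j)]
def mker (j : ℕ) : Pl → ℝ := (bmp j).normed volume
def moll (j : ℕ) (g : Pl → ℝ) : Pl → ℝ :=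
  MeasureTheory.convolution (mker j) g (ContinuousLinearMap.lsmul ℝ ℝ) volume
lemma moll_def (j : ℕ) (g : Pl → ℝ) (p : Pl) : moll j g p = ∫ q, mker j q * g (p - q) := rfl
lemma mker_nonneg (j q) : 0 ≤ mker j q := (bmp j).nonneg_normed q
lemma mker_int (j) : ∫ q, mker j q = 1 := (bmp j).integral_normed
lemma mker_integrable (j) : Integrable (mker j) := (bmp j).integrable_normed
lemma mker_supp (j) {q} (h : mker j q ≠ 0) : ‖q‖ < ι j := by
  have : q ∈ Function.support ((bmp j).normed volume) := h
  rw [(bmp j).support_normed_eq] at this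
  simpa [bmp] using this
lemma moll_contDiff (j : ℕ) {g : Pl → ℝ} (hg : Continuous g) (n : ℕ) : ContDiff ℝ n (moll j g) :=
  HasCompactSupport.contDiff_convolution_left _ (bmp j).hasCompactSupport_normed
    (bmp j).contDiff_normed hg.locallyIntegrable
lemma mker_le {j : ℕ} {F : Pl → ℝ} {c : ℝ} (hF : Measurable F) {M : ℝ} (hM : ∀ q, |F q| ≤ M)
    (h : ∀ᵐ q, ‖q‖ < ι j → F q ≤ c) : ∫ q, mker j q * F q ≤ c := by
  have : c = ∫ q, mker j q * c := by rw [integral_mul_const, mker_int, one_mul]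
  rw [this]
  apply integral_mono_ae
  · exact (mker_integrable j).mul_bdd (c := M) hF.aestronglyMeasurable (Ef hM)
  · exact (mker_integrable j).mul_const c
  · filter_upwards [h] with q hq
    by_cases se : mker j q = 0
    · simp [se]
    · exact Mll (hq (mker_supp j se)) (mker_nonneg j q)
lemma moll_close {K : NNReal} {g : Pl → ℝ} (hg : Lwz K g) (j : ℕ) (p : Pl) :
    |moll j g p - g p| ≤ K * ι j := by
  have := ContDiffBump.dist_normed_convolution_le (φ := bmp j) (μ := (volume : Measure (ℝ×ℝ))) (g := g) (x₀ := p)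
    (ε := K * ι j) hg.continuous.aestronglyMeasurable (by
      intro x hx
      refine (hg.dist_le_mul x p).trans ?_
      gcongr
      exact (Metric.mem_ball.1 hx).le)
  rw [Real.dist_eq] at this
  exact this
lemma lineDeriv_bdd {K : NNReal} {g : Pl → ℝ} (hg : Lwz K g) (p v : Pl) :
    |lineDeriv ℝ g p v| ≤ K * ‖v‖ := by
  simpa using norm_lineDeriv_le_of_lipschitz ℝ hg (x₀ := p) (v := v)
lemma moll_fderiv {K : NNReal} {g : Pl → ℝ} (hg : Lwz K g) (j : ℕ) (p v : Pl) :
    fderiv ℝ (moll j g) p v = ∫ q, mker j q * lineDeriv ℝ g (p - q) v := by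
  have hd : DifferentiableAt ℝ (moll j g) p :=
    (moll_contDiff j hg.continuous 1).differentiable nn p
  rw [← hd.lineDeriv_eq_fderiv]
  have hae : ∀ᵐ q : Pl, DifferentiableAt ℝ g (p - q) := by
    have sa := hg.ae_differentiableAt (μ := (volume : Measure (Pl)))
    exact (Measure.measurePreserving_sub_left volume p).quasiMeasurePreserving.ae sa
  have hmain := hasDerivAt_integral_of_dominated_loc_of_lip (μ := (volume : Measure (Pl)))
    (F := fun (s : ℝ) q => mker j q * g (p + s • v - q)) (x₀ := 0) (s := univ)
    (F' := fun q => mker j q * lineDeriv ℝ g (p - q) v)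
    (bound := fun q => mker j q * (K * ‖v‖)) Filter.univ_mem ?_ ?_ ?_ ?_ ?_ ?_
  · have := hmain.2
    exact (this.deriv :)
  · filter_upwards with s
    have hc : Continuous (fun q => mker j q * g (p + s • v - q)) :=
      (bmp j).continuous_normed.mul (hg.continuous.comp (by fun_prop))
    exact hc.aestronglyMeasurable
  · have hc : Continuous (fun q => mker j q * g (p + sf • v - q)) :=
      (bmp j).continuous_normed.mul (hg.continuous.comp (by fun_prop))
    exact hc.integrable_of_hasCompactSupport ((bmp j).hasCompactSupport_normed.mul_right)
  · have : Measurable (fun q => lineDeriv ℝ g (p - q) v) :=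
      (measurable_lineDeriv hg.continuous).comp (measurable_const.sub measurable_id)
    exact ((bmp j).continuous_normed.measurable.mul this).aestronglyMeasurable
  · filter_upwards with q
    apply LipschitzWith.lipschitzOnWith
    apply LipschitzWith.of_dist_le_mul
    intro s sl
    rw [Re, ← mul_sub, abs_mul, Ai (mker_nonneg j q)]
    have sa : |g (p + s • v - q) - g (p + sl • v - q)| ≤ K * (dist s sl * ‖v‖) := by
      rw [← Real.dist_eq]
      refine (hg.dist_le_mul _ _).trans ?_
      gcongr
      rw [dist_eq_norm, Re, ← Ra, ← norm_smul]
      apply le_of_eq; congr 1; module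
    have h2 : ((Real.nnabs (mker j q * (K * ‖v‖)) : NNReal) : ℝ) = mker j q * (K * ‖v‖) := by
      rw [Real.coe_nnabs, abs_of_nonneg]; exact Pn (mker_nonneg j q) ps
    rw [h2]
    calc _ ≤ mker j q * (K * (dist s sl * ‖v‖)) := Mll sa (mker_nonneg j q)
      _ = _ := by ring
  · exact (mker_integrable j).mul_const _
  · filter_upwards [hae] with q hq
    have sa := hq.lineDifferentiableAt (v := v) |>.hasLineDerivAt
    have h2 : HasDerivAt (fun s : ℝ => g (p - q + s • v)) (lineDeriv ℝ g (p - q) v) 0 := sa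
    have sd : (fun s : ℝ => mker j q * g (p + s • v - q)) = fun s => mker j q * g (p - q + s • v) := by
      funext s; congr 2; module
    rw [sd]
    exact h2.const_mul _
lemma moll_fderiv_le {K : NNReal} {g : Pl → ℝ} (hg : Lwz K g) (j : ℕ) (p v : Pl) {c : ℝ}
    (h : ∀ᵐ q : Pl, ‖q - p‖ < ι j → fderiv ℝ g q v ≤ c) : fderiv ℝ (moll j g) p v ≤ c := by
  rw [moll_fderiv hg]
  refine mker_le (M := K * ‖v‖) ?_ (fun q => lineDeriv_bdd hg _ _) ?_
  · exact (measurable_lineDeriv hg.continuous).comp (measurable_const.sub measurable_id)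
  · have sa := hg.ae_differentiableAt (μ := (volume : Measure (Pl)))
    filter_upwards [(Measure.measurePreserving_sub_left volume p).quasiMeasurePreserving.ae sa,
      (Measure.measurePreserving_sub_left volume p).quasiMeasurePreserving.ae h] with q hq hq2 hlt
    rw [hq.lineDeriv_eq_fderiv]
    apply hq2; simpa using hlt
lemma fderiv_bdd {K : NNReal} {g : Pl → ℝ} (hg : Lwz K g) (p v : Pl) :
    |fderiv ℝ g p v| ≤ K * ‖v‖ := by
  rw [← Real.norm_eq_abs]
  refine ((fderiv ℝ g p).le_opNorm v).trans ?_
  gcongr; exact norm_fderiv_le_of_lipschitz ℝ hg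
lemma moll_fderiv_bdd {K : NNReal} {g : Pl → ℝ} (hg : Lwz K g) (j : ℕ) (p v : Pl) :
    |fderiv ℝ (moll j g) p v| ≤ K * ‖v‖ := by
  rw [abs_le']; constructor
  · exact moll_fderiv_le hg j p v (Ef fun q _ => (abs_le.1 (fderiv_bdd hg q v)).2)
  · rw [← map_neg]
    refine moll_fderiv_le hg j p (-v) (Ef fun q _ => ?_)
    have := (abs_le.1 (fderiv_bdd hg q (-v))).2; simpa using this
lemma meas_fd {g : Pl → ℝ} (v : Pl) : Measurable (fun p => fderiv ℝ g p v) :=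
  measurable_fderiv_apply_const ℝ g v
lemma moll_fderiv_tendsto {K : NNReal} {g : Pl → ℝ} (hg : Lwz K g) (v : Pl) :
    ∀ᵐ p : Pl, Tendsto (fun j => fderiv ℝ (moll j g) p v) atTop (nhds (fderiv ℝ g p v)) := by
  have hli : LocallyIntegrable (fun p => lineDeriv ℝ g p v) (volume : Measure (Pl)) := by
    intro p
    refine ⟨Metric.ball p 1, Metric.ball_mem_nhds _ one_pos, ?_⟩
    refine Measure.integrableOn_of_bounded (M := K * ‖v‖) (measure_ball_lt_top.ne) ?_ ?_
    · exact (measurable_lineDeriv hg.continuous).aestronglyMeasurable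
    · exact Ef fun q => lineDeriv_bdd hg q v
  have sa := ContDiffBump.ae_convolution_tendsto_right_of_locallyIntegrable (φ := bmp) (l := atTop) (K := 2)
    (by simpa [bmp] using tendsto_one_div_add_atTop_nhds_zero_nat (𝕜 := ℝ))
    (Ef fun j => by
      simp only [bmp]; apply le_of_eq; field_simp) hli
  filter_upwards [sa, hg.ae_differentiableAt (μ := (volume : Measure (Pl)))] with p hp hd
  rw [← hd.lineDeriv_eq_fderiv]
  refine hp.congr fun j => ?_
  rw [moll_fderiv hg]; rfl
lemma moll_zero {g : Pl → ℝ} (j : ℕ) (p : Pl) (h : ∀ q, ‖q - p‖ < ι j → g q = 0) :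
    moll j g p = 0 := by
  rw [moll_def]
  have : (fun q => mker j q * g (p - q)) = fun _ => 0 := by
    funext q
    by_cases se : mker j q = 0
    · simp [se]
    · rw [h (p - q) (by simpa using mker_supp j se), mul_zero]
  rw [this]; simp
lemma moll_nonneg {g : Pl → ℝ} (j : ℕ) (p : Pl) (h : ∀ q, 0 ≤ g q) : 0 ≤ moll j g p :=
  integral_nonneg fun q => Pn (mker_nonneg j q) (h _)
lemma fd_x {φ : ℝ → ℝ → ℝ} {p : Pl} (h : DifferentiableAt ℝ (fun p : Pl => φ p.1 p.2) p) :
    deriv (fun y => φ y p.2) p.1 = Dx (fun p : Pl => φ p.1 p.2) p := by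
  have sa : HasDerivAt (fun y : ℝ => (y, p.2)) exz p.1 :=
    (hasDerivAt_id p.1).prodMk (hasDerivAt_const _ _)
  have h2 : HasFDerivAt (fun p : Pl => φ p.1 p.2) (fderiv ℝ (fun p : Pl => φ p.1 p.2) p) (p.1, p.2) := h.hasFDerivAt
  exact (h2.comp_hasDerivAt p.1 sa).deriv
lemma fd_t {φ : ℝ → ℝ → ℝ} {p : Pl} (h : DifferentiableAt ℝ (fun p : Pl => φ p.1 p.2) p) :
    deriv (fun s => φ p.1 s) p.2 = Dt (fun p : Pl => φ p.1 p.2) p := by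
  have sa : HasDerivAt (fun y : ℝ => (p.1, y)) et p.2 :=
    (hasDerivAt_const _ _).prodMk (hasDerivAt_id p.2)
  have h2 : HasFDerivAt (fun p : Pl => φ p.1 p.2) (fderiv ℝ (fun p : Pl => φ p.1 p.2) p) (p.1, p.2) := h.hasFDerivAt
  exact (h2.comp_hasDerivAt p.2 sa).deriv
lemma moll_lim {K : NNReal} {g : Pl → ℝ} (hg : Lwz K g) (hc : Hcs g)
    {P Q : Pl → ℝ} (hP : Measurable P) (hQ : Measurable Q) {M : ℝ} (hPM : ∀ p, |P p| ≤ M) (hQM : ∀ p, |Q p| ≤ M) :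
    Tendsto (fun j => ∫ p, (P p * Dt (moll j g) p + Q p * Dx (moll j g) p)) atTop
      (nhds (∫ p, (P p * Dt g p + Q p * Dx g p))) := by
  obtain ⟨ρ, hρ⟩ := hc.isCompact.isBounded.subset_closedBall (0 : Pl)
  have hM : 0 ≤ M := (An).trans (hPM 0)
  have hz : ∀ (j : ℕ) p, p ∉ Metric.closedBall (0:ℝ×ℝ) (ρ + 1) → ∀ v, fderiv ℝ (moll j g) p v = 0 := by
    intro j p hp v
    have hev : moll j g =ᶠ[nhds p] fun _ => 0 := by
      have : (Metric.closedBall (0:ℝ×ℝ) (ρ + 1))ᶜ ∈ nhds p := Metric.isClosed_closedBall.isOpen_compl.mem_nhds hp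
      filter_upwards [this] with z hz
      apply moll_zero
      intro q hq
      by_contra hne
      have sa := hρ (subset_tsupport g hne)
      apply hz
      rw [mem_closedBall_zero_iff] at sa ⊢
      have h2 : ι j ≤ 1 := by
        rw [div_le_one ps]; linarith [(Nat.cast_nonneg j : sf ≤ j)]
      have sd : ‖z‖ ≤ ‖q‖ + ‖q - z‖ := by
        have := norm_sub_le q (q - z); simpa using this
      linarith
    rw [hev.fderiv_eq]; simp
  apply tendsto_integral_of_dominated_convergence ((Metric.closedBall (0:ℝ×ℝ) (ρ + 1)).indicator (fun _ => M * K + M * K))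
  · intro j
    exact ((hP.mul (meas_fd _)).add (hQ.mul (meas_fd _))).aestronglyMeasurable
  · exact (integrable_indicator_iff measurableSet_closedBall).2
      (integrableOn_const (isCompact_closedBall _ _).measure_lt_top.ne)
  · intro j
    filter_upwards with p
    by_cases hp : p ∈ Metric.closedBall (0:ℝ×ℝ) (ρ + 1)
    · rw [indicator_of_mem hp, Real.norm_eq_abs]
      refine (abs_add_le _ _).trans ?_
      rw [abs_mul, abs_mul]
      have nb : ‖et‖ = 1 := by simp [Prod.norm_def]
      have nd : ‖exz‖ = 1 := by simp [Prod.norm_def]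
      have bb := moll_fderiv_bdd hg j p (0,1)
      have bd := moll_fderiv_bdd hg j p (1,0)
      rw [nb, mul_one] at bb
      rw [nd, mul_one] at bd
      gcongr
      · exact hPM p
      · exact hQM p
    · rw [indicator_of_notMem hp, hz j p hp, hz j p hp]; simp
  · filter_upwards [moll_fderiv_tendsto hg (0,1), moll_fderiv_tendsto hg (1,0)] with p sa h2
    exact (sa.const_mul _).add (h2.const_mul _)
lemma symm_parts {K : NNReal} {g : Pl → ℝ} (hg : Lwz K g)
    {φ : Pl → ℝ} (sa : ContDiff ℝ 1 φ) (hc : Hcs φ) :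
    ∫ p, (Dx g p * Dt φ p + (- Dt g p) * Dx φ p) = 0 := by
  have hcv : ∀ v, Continuous (fun p => fderiv ℝ φ p v) := fun v => (sa.continuous_fderiv nn).clm_apply cst
  have hcs : ∀ v, Hcs (fun p => fderiv ℝ φ p v) := fun v => hc.fderiv_apply (𝕜 := ℝ) v
  have e0 : ∀ j, ∫ p, (Dx (moll j g) p * Dt φ p + (- Dt (moll j g) p) * Dx φ p) = 0 := by
    intro j
    set G := moll j g
    have hG : ContDiff ℝ 2 G := moll_contDiff j hg.continuous 2
    have tu : ∀ v, ContDiff ℝ 1 (fun p => fderiv ℝ G p v) := fun v =>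
      (hG.fderiv_right (m := 1) nn).clm_apply contDiff_const
    have parts : ∀ v w : Pl, ∫ p, fderiv ℝ G p v * fderiv ℝ φ p w =
        - ∫ p, fderiv ℝ (fun p => fderiv ℝ G p v) p w * φ p := by
      intro v w
      apply integral_mul_fderiv_eq_neg_fderiv_mul_of_integrable
      · exact (((tu v).continuous_fderiv nn).clm_apply cst |>.mul sa.continuous).integrable_of_hasCompactSupport
          (hc.mul_left)
      · exact ((tu v).continuous.mul (hcv w)).integrable_of_hasCompactSupport ((hcs w).mul_left)
      · exact ((tu v).continuous.mul sa.continuous).integrable_of_hasCompactSupport (hc.mul_left)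
      · exact fun x _ => (tu v).differentiable nn x
      · exact fun x _ => sa.differentiable nn x
    have sy : ∀ p (v w : Pl), fderiv ℝ (fun p => fderiv ℝ G p v) p w = fderiv ℝ (fun p => fderiv ℝ G p w) p v := by
      intro p v w
      have hD : DifferentiableAt ℝ (fderiv ℝ G) p := (hG.fderiv_right (m := 1) nn).differentiable nn p
      have hs := (hG.contDiffAt (x := p)).isSymmSndFDerivAt (by simp)
      rw [fderiv_clm_apply hD (differentiableAt_const _), fderiv_clm_apply hD (differentiableAt_const _)]
      simpa using hs w v
    have ic : ∀ v w, Integrable (fun p => fderiv ℝ G p v * fderiv ℝ φ p w) := fun v w =>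
      ((tu v).continuous.mul (hcv w)).integrable_of_hasCompactSupport ((hcs w).mul_left)
    simp only [neg_mul, ← sub_eq_add_neg]
    rw [integral_sub (ic _ _) (ic _ _), parts, parts]
    simp_rw [sy _ (1,0) (0,1)]
    ring
  have hlim : Tendsto (fun j => ∫ p, (Dx (moll j g) p * Dt φ p + (- Dt (moll j g) p) * Dx φ p)) atTop
      (nhds (∫ p, (Dx g p * Dt φ p + (- Dt g p) * Dx φ p))) := by
    have nb : ‖et‖ = 1 := by simp [Prod.norm_def]
    have nd : ‖exz‖ = 1 := by simp [Prod.norm_def]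
    apply tendsto_integral_of_dominated_convergence (fun p => K * |Dt φ p| + K * |Dx φ p|)
    · intro j
      exact (((meas_fd _).mul (meas_fd _)).add ((meas_fd _).neg.mul (meas_fd _))).aestronglyMeasurable
    · have ia : ∀ v, Integrable (fun p => fderiv ℝ φ p v) := fun v => (hcv v).integrable_of_hasCompactSupport (hcs v)
      exact ((ia _).abs.const_mul _).add ((ia _).abs.const_mul _)
    · intro j
      filter_upwards with p
      rw [Real.norm_eq_abs]
      refine (abs_add_le _ _).trans ?_
      rw [abs_mul, abs_mul, abs_neg]
      have bb := moll_fderiv_bdd hg j p (0,1)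
      have bd := moll_fderiv_bdd hg j p (1,0)
      rw [nb, mul_one] at bb
      rw [nd, mul_one] at bd
      gcongr
    · filter_upwards [moll_fderiv_tendsto hg (0,1), moll_fderiv_tendsto hg (1,0)] with p sa h2
      exact (h2.mul_const _).add (sa.neg.mul_const _)
  simp_rw [e0] at hlim
  exact tendsto_nhds_unique hlim tendsto_const_nhds
def stp (n : ℕ) (z : ℝ) : ℝ := Real.smoothTransition (((n:ℝ)+1) * z)
def rho (n : ℕ) (z : ℝ) : ℝ := deriv (stp n) z
lemma stp_cd (n : ℕ) : ContDiff ℝ 1 (stp n) :=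
  Real.smoothTransition.contDiff.comp (contDiff_const.mul contDiff_id)
lemma stp_zero (n : ℕ) {z : ℝ} (h : z ≤ 0) : stp n z = 0 :=
  Real.smoothTransition.zero_of_nonpos (mul_nonpos_of_nonneg_of_nonpos ps h)
lemma stp_one (n : ℕ) {z : ℝ} (h : ι n ≤ z) : stp n z = 1 := by
  apply Real.smoothTransition.one_of_one_le
  rwa [div_le_iff₀' ps] at h
lemma stp_nonneg (n z) : 0 ≤ stp n z := Real.smoothTransition.nonneg _
lemma stp_le_one (n z) : stp n z ≤ 1 := Real.smoothTransition.le_one _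
lemma stp_mono (n) : Monotone (stp n) := fun x y h =>
  Real.smoothTransition.monotone (by gcongr)
lemma rho_nonneg (n z) : 0 ≤ rho n z := (stp_mono n).deriv_nonneg
lemma rho_cont (n) : Continuous (rho n) := (stp_cd n).continuous_deriv nn
lemma stp_hd (n z) : HasDerivAt (stp n) (rho n z) z :=
  ((stp_cd n).differentiable nn z).hasDerivAt
lemma rho_supp {n z} (h : rho n z ≠ 0) : 0 < z ∧ z < ι n := by
  constructor
  · by_contra hz; push Not at hz
    apply h
    exact IsLocalMin.deriv_eq_zero (Ef fun y => by
      rw [stp_zero n hz]; exact stp_nonneg n y)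
  · by_contra hz; push Not at hz
    apply h
    exact IsLocalMax.deriv_eq_zero (Ef fun y => by
      rw [stp_one n hz]; exact stp_le_one n y)
lemma rho_hcs (n) : Hcs (rho n) := by
  apply HasCompactSupport.intro (isCompact_Icc (a := sf) (b := ι n))
  intro x hx
  by_contra h
  exact hx ⟨(rho_supp h).1.le, (rho_supp h).2.le⟩
lemma rho_integrable (n) : Integrable (rho n) := (rho_cont n).integrable_of_hasCompactSupport (rho_hcs n)
lemma rho_int (n) : ∫ z, rho n z = 1 := by
  have := integral_of_hasDerivAt_of_tendsto (f := stp n) (f' := rho n) (m := 0) (n := 1) (stp_hd n) (rho_integrable n)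
    (tendsto_const_nhds.congr' (by
      filter_upwards [Iic_mem_atBot sf] with z hz using (stp_zero n hz).symm))
    (tendsto_const_nhds.congr' (by
      filter_upwards [Ici_mem_atTop ι n] with z hz using (stp_one n hz).symm))
  simpa using this
structure AKer (k : ℕ → ℝ → ℝ) (l : Filter ℝ) : Prop where
  nonneg : ∀ n x, 0 ≤ k n x
  integ : ∀ n, Integrable (k n)
  int1 : ∀ n, ∫ x, k n x = 1
  supp : ∀ s ∈ l, ∀ᶠ n in atTop, ∀ x, k n x ≠ 0 → x ∈ s
lemma inv_lt_ev {δ : ℝ} (h : 0 < δ) : ∀ᶠ n : ℕ in atTop, ι n < δ :=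
  (tendsto_one_div_add_atTop_nhds_zero_nat (𝕜 := ℝ)).eventually (gt_mem_nhds h)
lemma aker_right (xa : ℝ) : AKer (fun n x => rho n (x - xa)) (nhdsWithin xa (Ioi xa)) where
  nonneg := fun n x => rho_nonneg _ _
  integ := fun n => (rho_integrable n).comp_sub_right xa
  int1 := fun n => by rw [integral_sub_right_eq_self (rho n) xa, rho_int]
  supp := by
    intro s hs
    obtain ⟨b, hb, hbs⟩ := mem_nhdsGT_iff_exists_Ioo_subset.1 hs
    filter_upwards [inv_lt_ev (sub_pos.2 hb)] with n hn x hx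
    have := rho_supp hx
    exact hbs ⟨by linarith [this.1], by linarith [this.2]⟩
lemma aker_left (xa : ℝ) : AKer (fun n x => rho n (x - xa + ι n)) (nhdsWithin xa (Iio xa)) where
  nonneg := fun n x => rho_nonneg _ _
  integ := fun n => ((rho_integrable n).comp_sub_right (xa - ι n)).congr
    (Ef fun x => by simp only; congr 1; ring)
  int1 := fun n => by
    have := integral_sub_right_eq_self (rho n) (xa - ι n) (μ := volume)
    rw [rho_int] at this
    refine Eq.trans ?_ this; congr 1; funext x; congr 1; ring
  supp := by
    intro s hs
    obtain ⟨b, hb, hbs⟩ := mem_nhdsLT_iff_exists_Ioo_subset.1 hs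
    filter_upwards [inv_lt_ev (sub_pos.2 hb)] with n hn x hx
    have := rho_supp hx
    exact hbs ⟨by linarith [this.1], by linarith [this.2]⟩
lemma box_conc {k : ℕ → ℝ → ℝ} {l : Filter ℝ} (hk : AKer k l) {b : ℕ → ℝ → ℝ} {ba : ℝ → ℝ} {c d : ℝ}
    (hbm : ∀ n, Measurable (b n)) (tv : ∀ n t, |b n t| ≤ 1) (hbs : ∀ n t, t ∉ Icc c d → b n t = 0)
    (hbl : ∀ t, Tendsto (fun n => b n t) atTop (nhds (ba t)))
    {P : ℝ → ℝ → ℝ} (hP : Measurable (Function.uncurry P)) {M : ℝ} (hM : ∀ x t, |P x t| ≤ M)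
    {pb : ℝ → ℝ} (hP0 : AEStronglyMeasurable pb (volume.restrict (Icc c d))) (sw : ∀ᵐ t ∂(volume.restrict (Icc c d)), |pb t| ≤ M)
    (hlim : Tendsto (fun x => ∫ t in Icc c d, |P x t - pb t|) l (nhds 0)) :
    Tendsto (fun n => ∫ x, k n x * ∫ t, P x t * b n t) atTop (nhds (∫ t in Icc c d, pb t * ba t)) := by
  have hPx : ∀ x, Measurable (P x) := fun x => hP.of_uncurry_left
  have red : ∀ (Q : ℝ → ℝ) n, ∫ t, Q t * b n t = ∫ t in Icc c d, Q t * b n t := by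
    intro Q n
    rw [setIntegral_eq_integral_of_forall_compl_eq_zero]
    intro t ht; rw [hbs n t ht, mul_zero]
  have iP : ∀ x, IntegrableOn (P x) (Icc c d) := fun x =>
    Measure.integrableOn_of_bounded (M := M) (by simp) (hPx x).aestronglyMeasurable (Ef (hM x))
  have iP0 : IntegrableOn pb (Icc c d) :=
    Integrable.of_bound hP0 M sw
  have ib : ∀ (Q : ℝ → ℝ) n, IntegrableOn Q (Icc c d) → IntegrableOn (fun t => Q t * b n t) (Icc c d) := fun Q n hQ =>
    hQ.mul_bdd (c := 1) (hbm n).aestronglyMeasurable (Ef (tv n))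
  have la : Tendsto (fun n => ∫ t in Icc c d, pb t * b n t) atTop (nhds (∫ t in Icc c d, pb t * ba t)) := by
    apply tendsto_integral_of_dominated_convergence (fun t => |pb t|)
    · exact fun n => (ib pb n iP0).aestronglyMeasurable
    · exact iP0.abs
    · intro n; filter_upwards with t
      rw [Ra, abs_mul]
      exact mul_le_of_le_one_right An (tv n t)
    · filter_upwards with t using (hbl t).const_mul _
  have hmeasG : ∀ n, StronglyMeasurable (fun x => ∫ t, P x t * b n t) := by
    intro n
    have : StronglyMeasurable (Function.uncurry (fun x t => P x t * b n t)) :=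
      (hP.mul ((hbm n).comp measurable_snd)).stronglyMeasurable
    exact this.integral_prod_right
  have hdiff : ∀ n x, |(∫ t, P x t * b n t) - ∫ t in Icc c d, pb t * b n t| ≤ ∫ t in Icc c d, |P x t - pb t| := by
    intro n x
    rw [red, ← integral_sub (ib _ n (iP x)) (ib _ n iP0)]
    refine (abs_integral_le_integral_abs).trans ?_
    apply integral_mono_of_nonneg (Ef fun t => An) ((iP x).sub iP0).abs
    filter_upwards with t
    simp only [Pi.sub_apply]
    rw [← sub_mul, abs_mul]
    exact mul_le_of_le_one_right An (tv n t)
  have hbd : ∀ n x, |∫ t, P x t * b n t| ≤ M * (volume (Icc c d)).toReal := by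
    intro n x
    rw [red]
    have := norm_setIntegral_le_of_norm_le_const (μ := volume) (s := Icc c d) (C := M) (f := fun t => P x t * b n t)
      (by simp) (fun t _ => by
        rw [norm_mul]
        exact (mul_le_of_le_one_right (norm_nonneg _) (tv n t)).trans (hM x t))
    simpa [Measure.real] using this
  have ikG : ∀ n, Integrable (fun x => k n x * ∫ t, P x t * b n t) := fun n =>
    (hk.integ n).mul_bdd (hmeasG n).aestronglyMeasurable (Ef (hbd n))
  rw [Metric.tendsto_atTop'] at la ⊢
  intro ε hε
  obtain ⟨na, tk⟩ := la (ε/2) ps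
  have hs : {x | ∫ t in Icc c d, |P x t - pb t| < ε/2} ∈ l := hlim.eventually (gt_mem_nhds ps)
  obtain ⟨N2, hN2⟩ := eventually_atTop.1 (hk.supp _ hs)
  refine ⟨max na N2, fun n hn => ?_⟩
  have hn1 := tk n (lt_of_le_of_lt Mxl hn)
  have hn2 := hN2 n ((le_max_right na N2).trans hn.le)
  set J := ∫ t in Icc c d, pb t * b n t
  have eb : |(∫ x, k n x * ∫ t, P x t * b n t) - J| ≤ ε/2 := by
    have : J = ∫ x, k n x * J := by rw [integral_mul_const, hk.int1, one_mul]
    rw [this, ← integral_sub (ikG n) ((hk.integ n).mul_const J)]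
    refine (abs_integral_le_integral_abs).trans ?_
    have ea : ε/2 = ∫ x, k n x * (ε/2) := by rw [integral_mul_const, hk.int1, one_mul]
    rw [ea]
    apply integral_mono_of_nonneg (Ef fun t => An) ((hk.integ n).mul_const _)
    filter_upwards with x
    rw [← mul_sub, abs_mul, Ai (hk.nonneg n x)]
    by_cases se : k n x = 0
    · simp [se]
    · exact Mll ((hdiff n x).trans (hn2 x se).le) (hk.nonneg n x)
  rw [Real.dist_eq] at hn1 ⊢
  calc _ = |((∫ x, k n x * ∫ t, P x t * b n t) - J) + (J - ∫ t in Icc c d, pb t * ba t)| := by ring_nf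
    _ ≤ _ := abs_add_le _ _
    _ < ε := by linarith
lemma split_test {α β : ℝ → ℝ} (hα : ContDiff ℝ 1 α) (hβ : ContDiff ℝ 1 β) (hαc : Hcs α) (hβc : Hcs β)
    {P Q : ℝ → ℝ → ℝ} (hP : Measurable (Function.uncurry P)) (hQ : Measurable (Function.uncurry Q)) {M : ℝ}
    (hPM : ∀ x t, |P x t| ≤ M) (hQM : ∀ x t, |Q x t| ≤ M) :
    ∫ p : Pl, (P p.1 p.2 * deriv (fun s => α p.1 * β s) p.2 + Q p.1 p.2 * deriv (fun y => α y * β p.2) p.1) =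
      (∫ t, deriv β t * ∫ x, P x t * α x) + ∫ x, deriv α x * ∫ t, Q x t * β t := by
  have hα' : Continuous (deriv α) := hα.continuous_deriv nn
  have hβ' : Continuous (deriv β) := hβ.continuous_deriv nn
  have iα : Integrable α := hα.continuous.integrable_of_hasCompactSupport hαc
  have iβ : Integrable β := hβ.continuous.integrable_of_hasCompactSupport hβc
  have iα' : Integrable (deriv α) := hα'.integrable_of_hasCompactSupport hαc.deriv
  have iβ' : Integrable (deriv β) := hβ'.integrable_of_hasCompactSupport hβc.deriv
  have db : ∀ p : Pl, deriv (fun s => α p.1 * β s) p.2 = α p.1 * deriv β p.2 := fun p => by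
    rw [deriv_const_mul]; exact hβ.differentiable nn _
  have dc : ∀ p : Pl, deriv (fun y => α y * β p.2) p.1 = deriv α p.1 * β p.2 := fun p => by
    rw [deriv_mul_const]; exact hα.differentiable nn _
  simp_rw [db, dc]
  have ic : Integrable (fun p : Pl => P p.1 p.2 * (α p.1 * deriv β p.2)) :=
    (iα.mul_prod iβ').bdd_mul (c := M) hP.aestronglyMeasurable (Ef fun p => hPM _ _)
  have ia : Integrable (fun p : Pl => Q p.1 p.2 * (deriv α p.1 * β p.2)) :=
    (iα'.mul_prod iβ).bdd_mul (c := M) hQ.aestronglyMeasurable (Ef fun p => hQM _ _)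
  rw [integral_add ic ia]
  congr 1
  · rw [Measure.volume_eq_prod] at ic ⊢
    rw [integral_prod_symm _ ic]
    congr 1; funext t
    rw [← integral_const_mul]
    congr 1; funext x; ring
  · rw [Measure.volume_eq_prod] at ia ⊢
    rw [integral_prod _ ia]
    congr 1; funext x
    rw [← integral_const_mul]
    congr 1; funext t; ring
def wnd (c d : ℝ) (n : ℕ) (x : ℝ) : ℝ := stp n (x - c) - stp n (x - d)
lemma wnd_cd (c d n) : ContDiff ℝ 1 (wnd c d n) :=
  ((stp_cd n).comp (contDiff_id.sub contDiff_const)).sub ((stp_cd n).comp (contDiff_id.sub contDiff_const))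
lemma wnd_nonneg {c d : ℝ} (h : c ≤ d) (n x) : 0 ≤ wnd c d n x :=
  sub_nonneg.2 (stp_mono n ln)
lemma wnd_abs {c d : ℝ} (h : c ≤ d) (n x) : |wnd c d n x| ≤ 1 := by
  rw [Ai (wnd_nonneg h n x)]
  have := stp_le_one n (x - c); have := stp_nonneg n (x - d); simp only [wnd]; linarith
lemma wnd_le {c d : ℝ} (h : c ≤ d) {n x} (hx : x ≤ c) : wnd c d n x = 0 := by
  simp [wnd, stp_zero n (show x - c ≤ 0 by linarith), stp_zero n (show x - d ≤ 0 by linarith)]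
lemma wnd_ge {c d : ℝ} (h : c ≤ d) {n : ℕ} {x : ℝ} (hx : d + ι n ≤ x) : wnd c d n x = 0 := by
  simp only [wnd]; rw [stp_one n (show _ ≤ x - c by linarith), stp_one n (show _ ≤ x - d by linarith)]; ring
lemma wnd_supp {c d : ℝ} (h : c ≤ d) (n x) (hx : x ∉ Icc c (d+1)) : wnd c d n x = 0 := by
  by_cases sa : x ≤ c
  · exact wnd_le h sa
  · apply wnd_ge h
    push Not at sa
    have : d + 1 < x := by by_contra hc; push Not at hc; exact hx ⟨sa.le, hc⟩
    have h2 : ι n ≤ 1 := by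
      rw [div_le_one ps]; linarith [(Nat.cast_nonneg n : sf ≤ n)]
    linarith
lemma wnd_hcs {c d : ℝ} (h : c ≤ d) (n) : Hcs (wnd c d n) :=
  HasCompactSupport.intro isCompact_Icc (fun x hx => wnd_supp h n x hx)
lemma wnd_deriv (c d n x) : deriv (wnd c d n) x = rho n (x - c) - rho n (x - d) := by
  have sa := (stp_hd n (x - c)).comp x ((hasDerivAt_id x).sub_const c)
  have h2 := (stp_hd n (x - d)).comp x ((hasDerivAt_id x).sub_const d)
  have sd : HasDerivAt (wnd c d n) (rho n (x-c) * 1 - rho n (x-d) * 1) x := sa.sub h2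
  simpa using sd.deriv
lemma stp_lim (z : ℝ) : Tendsto (fun n => stp n z) atTop (nhds ((Ioi sf).indicator (fun _ => so) z)) := by
  by_cases h : 0 < z
  · rw [indicator_of_mem (show z ∈ Ioi sf from h)]
    apply tendsto_const_nhds.congr'
    filter_upwards [inv_lt_ev h] with n hn using (stp_one n hn.le).symm
  · rw [indicator_of_notMem (show z ∉ Ioi sf from h)]
    push Not at h
    apply tendsto_const_nhds.congr
    intro n; exact (stp_zero n h).symm
lemma wnd_lim {c d : ℝ} (h : c ≤ d) (x : ℝ) :
    Tendsto (fun n => wnd c d n x) atTop (nhds ((Ioc c d).indicator (fun _ => so) x)) := by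
  have := (stp_lim (x - c)).sub (stp_lim (x - d))
  have e : (Ioc c d).indicator (fun _ => so) x = (Ioi sf).indicator (fun _ => so) (x - c) - (Ioi sf).indicator (fun _ => so) (x - d) := by
    simp only [indicator, mem_Ioc, mem_Ioi]
    split_ifs <;> grind
  rw [e]; exact this
lemma wnd_int (Q : ℝ → ℝ) {c d : ℝ} (h : c ≤ d) :
    ∫ t in Icc c (d+1), Q t * (Ioc c d).indicator (fun _ => so) t = ∫ t in c..d, Q t := by
  have : (fun t => Q t * (Ioc c d).indicator (fun _ => so) t) = (Ioc c d).indicator Q := by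
    funext t; by_cases ht : t ∈ Ioc c d <;> simp [ht]
  rw [this, setIntegral_indicator measurableSet_Ioc, intervalIntegral.integral_of_le h]
  congr 2
  ext x; simp only [mem_inter_iff, mem_Icc, mem_Ioc]; constructor
  · exact fun h => h.2
  · exact fun h => ⟨⟨h.1.le, by linarith [h.2]⟩, h⟩
lemma bdd_on {f : ℝ → ℝ} (hf : Continuous f) (M : ℝ) : ∃ C, 0 ≤ C ∧ ∀ z, |z| ≤ M → |f z| ≤ C := by
  obtain ⟨C, hC⟩ := (isCompact_Icc (a := -M) (b := M)).exists_bound_of_continuousOn hf.continuousOn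
  exact ⟨|C|, An, fun z hz => (hC z (abs_le.1 hz)).trans (le_abs_self _)⟩
lemma dflux_meas {fl fr : ℝ → ℝ} (hfl : Continuous fl) (hfr : Continuous fr) {v : ℝ → ℝ → ℝ} (hv : Measurable (Function.uncurry v)) :
    Measurable (Function.uncurry fun x t => dflux fl fr x (v x t)) := by
  have : (Function.uncurry fun x t => dflux fl fr x (v x t)) =
    fun p : Pl => if p.1 < 0 then fl (Function.uncurry v p) else fr (Function.uncurry v p) := by
    funext p; rfl
  rw [this]
  exact Measurable.ite (measurableSet_lt measurable_fst mci) (hfl.measurable.comp hv) (hfr.measurable.comp hv)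
lemma ae_pos_Icc {c d : ℝ} (hc : 0 ≤ c) : ∀ᵐ t ∂(volume.restrict (Icc c d)), sf < t := by
  rw [ae_restrict_iff' measurableSet_Icc]
  filter_upwards [Measure.ae_ne volume sf] with t se ht
  exact lt_of_le_of_ne (hc.trans ht.1) (Ne.symm se)
lemma trace_L1 {Q : ℝ → ℝ → ℝ} (hQ : Measurable (Function.uncurry Q)) {M : ℝ} (hM : ∀ x t, |Q x t| ≤ M) {l : Filter ℝ} [l.IsCountablyGenerated]
    [l.NeBot] {ss : ℝ → ℝ} {c d : ℝ} (hc : 0 ≤ c) (hl : ∀ t, 0 < t → Tendsto (fun x => Q x t) l (nhds (ss t))) :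
    AEStronglyMeasurable ss (volume.restrict (Icc c d)) ∧ (∀ᵐ t ∂(volume.restrict (Icc c d)), |ss t| ≤ M) ∧
    Tendsto (fun x => ∫ t in Icc c d, |Q x t - ss t|) l (nhds 0) := by
  have hx : ∀ x, Measurable (Q x) := fun x => hQ.of_uncurry_left
  have sa : AEStronglyMeasurable ss (volume.restrict (Icc c d)) := by
    apply aestronglyMeasurable_of_tendsto_ae l (f := Q) (fun x => (hx x).aestronglyMeasurable)
    filter_upwards [ae_pos_Icc hc] with t ht using hl t ht
  have h2 : ∀ᵐ t ∂(volume.restrict (Icc c d)), |ss t| ≤ M := by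
    filter_upwards [ae_pos_Icc hc] with t ht
    exact le_of_tendsto (hl t ht).abs (Ef fun x => hM x t)
  refine ⟨sa, h2, ?_⟩
  have := tendsto_integral_filter_of_dominated_convergence (l := l) (μ := volume.restrict (Icc c d))
    (F := fun x t => |Q x t - ss t|) (f := fun _ => sf) (fun _ => 2 * M) ?_ ?_ ?_ ?_
  · simpa using this
  · exact Ef fun x => (((hx x).aestronglyMeasurable.sub sa)).norm
  · apply Ef; intro x
    filter_upwards [h2] with t ht
    rw [Ra, abs_abs]
    refine (abs_sub _ _).trans ?_
    linarith [hM x t]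
  · exact integrable_const _
  · filter_upwards [ae_pos_Icc hc] with t ht
    have := ((hl t ht).sub_const (ss t)).abs
    simpa using this
namespace ABSol
variable {fl fr : ℝ → ℝ} {A B : ℝ} {ua : ℝ → ℝ} (sol : ABSol fl fr A B ua)
def F (x s : ℝ) : ℝ := if 0 < s then dflux fl fr x (sol.up x s) else 0
lemma up_bdd {M : ℝ} (hM : ∀ x t, |sol.u x t| ≤ M) {x t : ℝ} (ht : 0 < t) : |sol.up x t| ≤ M :=
  le_of_tendsto (sol.up_spec x t ht).abs (Ef fun y => hM y t)
lemma F_tend (hfl : Continuous fl) (hfr : Continuous fr) (x : ℝ) {t : ℝ} (ht : 0 < t) :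
    Tendsto (fun y => dflux fl fr y (sol.u y t)) (nhdsWithin x (Ioi x)) (nhds (sol.F x t)) := by
  unfold F
  rw [if_pos ht]
  by_cases hx : x < 0
  · have sa : Tendsto (fun y => fl (sol.u y t)) (nhdsWithin x (Ioi x)) (nhds (fl (sol.up x t))) :=
      (hfl.tendsto _).comp (sol.up_spec x t ht)
    simp only [dflux, if_pos hx]
    refine sa.congr' ?_
    filter_upwards [nhdsWithin_le_nhds (Iio_mem_nhds hx)] with y hy
    rw [if_pos (show y < 0 from hy)]
  · have sa : Tendsto (fun y => fr (sol.u y t)) (nhdsWithin x (Ioi x)) (nhds (fr (sol.up x t))) :=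
      (hfr.tendsto _).comp (sol.up_spec x t ht)
    simp only [dflux, if_neg hx]
    refine sa.congr' ?_
    filter_upwards [self_mem_nhdsWithin] with y hy
    rw [if_neg]; push Not at hx ⊢; exact hx.trans (le_of_lt hy)
lemma flux_bdd (hfl : Continuous fl) (hfr : Continuous fr) (M : ℝ) :
    ∃ C, 0 ≤ C ∧ (∀ x z, |z| ≤ M → |dflux fl fr x z| ≤ C) ∧ (∀ z, |z| ≤ M → |fl z| ≤ C) ∧ (∀ z, |z| ≤ M → |fr z| ≤ C) := by
  obtain ⟨C1, sa, h2⟩ := bdd_on hfl M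
  obtain ⟨C2, sd, si⟩ := bdd_on hfr M
  refine ⟨C1 + C2, by positivity, fun x z hz => ?_, fun z hz => by linarith [h2 z hz], fun z hz => by linarith [si z hz]⟩
  unfold dflux; split_ifs
  · linarith [h2 z hz]
  · linarith [si z hz]
lemma umeas_x (t : ℝ) : Measurable (fun x => sol.u x t) := sol.meas.of_uncurry_right
lemma time_trace {c d ta : ℝ} (sv : 0 ≤ ta) :
    Tendsto (fun t => ∫ x in Icc c d, |sol.u x t - sol.u x ta|) (nhdsWithin ta (Ioi ta)) (nhds 0) := by
  obtain ⟨M, hM⟩ := sol.bdd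
  have sa := sol.timeCont (max |c| |d|) ta sv
  have h2 := sa.mono_left (nhdsWithin_mono ta (show Ioi ta ⊆ Ici 0 from fun z hz => sv.trans (le_of_lt hz)))
  refine squeeze_zero (fun t => integral_nonneg fun x => An) (fun t => ?_) h2
  apply setIntegral_mono_set
  · refine Measure.integrableOn_of_bounded (M := 2*M) (by simp) ?_ ?_
    · exact ((sol.umeas_x t).sub (sol.umeas_x ta)).abs.aestronglyMeasurable
    · apply Ef; intro x
      rw [Ra, abs_abs]
      refine (abs_sub _ _).trans ?_
      linarith [hM x t, hM x ta]
  · exact Ef fun x => An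
  · apply LE.le.eventuallyLE
    intro x hx
    have sa := neg_abs_le c
    have h2 := le_abs_self d
    have sd := le_max_left |c| |d|
    have si := le_max_right |c| |d|
    exact ⟨by linarith [hx.1], by linarith [hx.2]⟩
lemma tens_cd {α β : ℝ → ℝ} (hα : ContDiff ℝ 1 α) (hβ : ContDiff ℝ 1 β) :
    ContDiff ℝ 1 (fun p : Pl => α p.1 * β p.2) :=
  (hα.comp contDiff_fst).mul (hβ.comp contDiff_snd)
lemma tens_hcs {α β : ℝ → ℝ} {c d c' da : ℝ} (hα : ∀ x, x ∉ Icc c d → α x = 0) (hβ : ∀ x, x ∉ Icc c' da → β x = 0) :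
    Hcs (fun p : Pl => α p.1 * β p.2) := by
  apply HasCompactSupport.intro ((isCompact_Icc (a := c) (b := d)).prod (isCompact_Icc (a := c') (b := da)))
  intro p hp
  by_cases sa : p.1 ∈ Icc c d
  · rw [hβ p.2 (fun h2 => hp ⟨sa, h2⟩), mul_zero]
  · rw [hα p.1 sa, zero_mul]
lemma intg_wnd {k : ℝ → ℝ} (hk : Integrable k) {G : ℝ → ℝ} (hG : Measurable G) {C : ℝ} (h : ∀ x, |G x| ≤ C) : Integrable (fun x => k x * G x) :=
  hk.mul_bdd hG.aestronglyMeasurable (Ef h)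
lemma inner_meas {P : ℝ → ℝ → ℝ} (hP : Measurable (Function.uncurry P)) {b : ℝ → ℝ} (hb : Measurable b) :
    Measurable (fun x => ∫ t, P x t * b t) := by
  have : StronglyMeasurable (Function.uncurry (fun x t => P x t * b t)) :=
    (hP.mul (hb.comp measurable_snd)).stronglyMeasurable
  exact this.integral_prod_right.measurable
lemma inner_bdd {P : ℝ → ℝ} {M : ℝ} (hM : ∀ t, |P t| ≤ M) {b : ℝ → ℝ} {c d : ℝ} (hcd : c ≤ d)
    (tv : ∀ t, |b t| ≤ 1) (hbs : ∀ t, t ∉ Icc c d → b t = 0) : |∫ t, P t * b t| ≤ M * (d - c) := by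
  rw [← setIntegral_eq_integral_of_forall_compl_eq_zero (s := Icc c d) (fun t ht => by rw [hbs t ht, mul_zero])]
  have := norm_setIntegral_le_of_norm_le_const (μ := volume) (s := Icc c d) (C := M) (f := fun t => P t * b t)
    (by simp) (fun t _ => by
      rw [norm_mul]
      exact (mul_le_of_le_one_right (norm_nonneg _) (tv t)).trans (hM t))
  simpa [Measure.real, Real.volume_Icc, ENNReal.toReal_ofReal (sub_nonneg.2 hcd)] using this
lemma swap_meas {P : ℝ → ℝ → ℝ} (hP : Measurable (Function.uncurry P)) : Measurable (Function.uncurry fun t x => P x t) :=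
  hP.comp measurable_swap
lemma box (hfl : Continuous fl) (hfr : Continuous fr) {xa x2 ta t2 : ℝ} (hx : xa ≤ x2) (sv : 0 ≤ ta) (ht : ta ≤ t2) :
    (∫ x in xa..x2, sol.u x t2) - (∫ x in xa..x2, sol.u x ta) =
      (∫ s in ta..t2, sol.F xa s) - ∫ s in ta..t2, sol.F x2 s := by
  obtain ⟨M, hM⟩ := sol.bdd
  obtain ⟨C, sp, hC, -, -⟩ := flux_bdd hfl hfr M
  have hdm := dflux_meas hfl hfr sol.meas
  set Q : ℝ → ℝ → ℝ := fun x t => dflux fl fr x (sol.u x t) with hQ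
  have hQC : ∀ x t, |Q x t| ≤ C := fun x t => hC x _ (hM x t)
  have key : ∀ n, (∫ t, deriv (wnd ta t2 n) t * ∫ x, sol.u x t * wnd xa x2 n x) +
      ∫ x, deriv (wnd xa x2 n) x * ∫ t, Q x t * wnd ta t2 n t = 0 := by
    intro n
    rw [← split_test (wnd_cd xa x2 n) (wnd_cd ta t2 n) (wnd_hcs hx n) (wnd_hcs ht n) sol.meas hdm (M := max M C)
      (fun x t => (hM x t).trans Mxl) (fun x t => (hQC x t).trans Mxr)]
    exact sol.weak (fun x t => wnd xa x2 n x * wnd ta t2 n t) (tens_cd (wnd_cd _ _ _) (wnd_cd _ _ _))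
      (tens_hcs (wnd_supp hx n) (wnd_supp ht n)) (fun x t h => by rw [wnd_le ht (h.trans sv), mul_zero])
  have sA : ∀ n, ∫ t, deriv (wnd ta t2 n) t * ∫ x, sol.u x t * wnd xa x2 n x =
      (∫ t, rho n (t - ta) * ∫ x, sol.u x t * wnd xa x2 n x) - ∫ t, rho n (t - t2) * ∫ x, sol.u x t * wnd xa x2 n x := by
    intro n
    have hm := inner_meas (swap_meas sol.meas) (wnd_cd xa x2 n).continuous.measurable
    have hb : ∀ t, |∫ x, sol.u x t * wnd xa x2 n x| ≤ M * (x2 + 1 - xa) := fun t =>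
      inner_bdd (fun x => hM x t) ln (wnd_abs hx n) (wnd_supp hx n)
    rw [← integral_sub (intg_wnd ((aker_right ta).integ n) hm hb) (intg_wnd ((aker_right t2).integ n) hm hb)]
    congr 1; funext t; rw [wnd_deriv]; ring
  have sB : ∀ n, ∫ x, deriv (wnd xa x2 n) x * ∫ t, Q x t * wnd ta t2 n t =
      (∫ x, rho n (x - xa) * ∫ t, Q x t * wnd ta t2 n t) - ∫ x, rho n (x - x2) * ∫ t, Q x t * wnd ta t2 n t := by
    intro n
    have hm := inner_meas hdm (wnd_cd ta t2 n).continuous.measurable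
    have hb : ∀ x, |∫ t, Q x t * wnd ta t2 n t| ≤ C * (t2 + 1 - ta) := fun x =>
      inner_bdd (fun t => hQC x t) ln (wnd_abs ht n) (wnd_supp ht n)
    rw [← integral_sub (intg_wnd ((aker_right xa).integ n) hm hb) (intg_wnd ((aker_right x2).integ n) hm hb)]
    congr 1; funext t; rw [wnd_deriv]; ring
  have lT : ∀ τ, 0 ≤ τ → Tendsto (fun n => ∫ t, rho n (t - τ) * ∫ x, sol.u x t * wnd xa x2 n x) atTop (nhds (∫ x in xa..x2, sol.u x τ)) := by
    intro τ hτ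
    have := box_conc (aker_right τ) (fun n => (wnd_cd xa x2 n).continuous.measurable) (wnd_abs hx) (wnd_supp hx) (wnd_lim hx)
      (swap_meas sol.meas) (fun t x => hM x t) (pb := fun x => sol.u x τ) (sol.umeas_x τ).aestronglyMeasurable (Ef fun x => hM x τ) (sol.time_trace hτ)
    rwa [wnd_int _ hx] at this
  have lX : ∀ y, Tendsto (fun n => ∫ x, rho n (x - y) * ∫ t, Q x t * wnd ta t2 n t) atTop (nhds (∫ s in ta..t2, sol.F y s)) := by
    intro y
    obtain ⟨eb, ea, ed⟩ := trace_L1 hdm hQC (l := nhdsWithin y (Ioi y)) (ss := sol.F y) (c := ta) (d := t2+1) sv (fun t ht => sol.F_tend hfl hfr y ht)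
    have := box_conc (aker_right y) (fun n => (wnd_cd ta t2 n).continuous.measurable) (wnd_abs ht) (wnd_supp ht) (wnd_lim ht)
      hdm hQC eb ea ed
    rwa [wnd_int _ ht] at this
  have hl := ((lT ta sv).sub (lT t2 (sv.trans ht))).add ((lX xa).sub (lX x2))
  simp_rw [← sA, ← sB, key] at hl
  have := tendsto_nhds_unique hl tendsto_const_nhds
  linarith
end ABSol
lemma ii_bdd {g : ℝ → ℝ} (hg : Measurable g) {C : ℝ} (hC : ∀ x, |g x| ≤ C) (a b : ℝ) : IntervalIntegrable g volume a b := by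
  rw [intervalIntegrable_iff]
  exact Measure.integrableOn_of_bounded (M := C) (by simp) hg.aestronglyMeasurable (Ef hC)
lemma ii_le {g : ℝ → ℝ} {C : ℝ} (hC : ∀ x, |g x| ≤ C) (a b : ℝ) : |∫ x in a..b, g x| ≤ C * |b - a| :=
  intervalIntegral.norm_integral_le_of_norm_le_const (f := g) (fun x _ => hC x)
lemma lip2 {W : Pl → ℝ} {M C : ℝ} (hM : 0 ≤ M) (hC : 0 ≤ C) (sa : ∀ x y t, |W (x,t) - W (y,t)| ≤ M * |x - y|)
    (h2 : ∀ x s t, |W (x,s) - W (x,t)| ≤ C * |s - t|) : Lwz (M + C).toNNReal W := by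
  apply LipschitzWith.of_dist_le_mul
  intro p q
  rw [Real.coe_toNNReal _ ps, Real.dist_eq]
  have eb := sa p.1 q.1 p.2
  have ea := h2 q.1 p.2 q.2
  have ed : |p.1 - q.1| ≤ dist p q := by rw [← Real.dist_eq]; exact Mxl
  have ef : |p.2 - q.2| ≤ dist p q := by rw [← Real.dist_eq]; exact Mxr
  have ej := abs_add_le (W (p.1,p.2) - W (q.1,p.2)) (W (q.1,p.2) - W (q.1,q.2))
  rw [sub_add_sub_cancel] at ej
  nlinarith [Mll ed hM, Mll ef hC]
lemma fd_of_slice_x {W : Pl → ℝ} {p : Pl} (h : DifferentiableAt ℝ W p) :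
    HasDerivAt (fun x => W (x, p.2)) Dx W p p.1 := by
  have sa : HasDerivAt (fun x : ℝ => (x, p.2)) exz p.1 := (hasDerivAt_id _).prodMk (hasDerivAt_const _ _)
  exact (h.hasFDerivAt.comp_hasDerivAt p.1 sa)
lemma fd_of_slice_t {W : Pl → ℝ} {p : Pl} (h : DifferentiableAt ℝ W p) :
    HasDerivAt (fun t => W (p.1, t)) Dt W p p.2 := by
  have sa : HasDerivAt (fun t : ℝ => (p.1, t)) et p.2 := (hasDerivAt_const _ _).prodMk (hasDerivAt_id _)
  exact (h.hasFDerivAt.comp_hasDerivAt p.2 sa)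
namespace ABSol
variable {fl fr : ℝ → ℝ} {A B : ℝ} {ua : ℝ → ℝ} (sol : ABSol fl fr A B ua)
lemma tend_seq (x : ℝ) : Tendsto (fun n : ℕ => x + ι n) atTop (nhdsWithin x (Ioi x)) := by
  apply tendsto_nhdsWithin_iff.2 ⟨?_, Ef fun n => ?_⟩
  · simpa using tendsto_const_nhds.add (tendsto_one_div_add_atTop_nhds_zero_nat (𝕜 := ℝ))
  · have : sf < ι n := by positivity
    simp only [mem_Ioi]; linarith
lemma F_meas (hfl : Continuous fl) (hfr : Continuous fr) : Measurable (Function.uncurry sol.F) := by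
  have hdm := dflux_meas hfl hfr sol.meas
  apply measurable_of_tendsto_metrizable (f := fun (n:ℕ) (p : Pl) => if 0 < p.2 then dflux fl fr (p.1 + ι n) (sol.u (p.1 + ι n) p.2) else 0)
  · intro n
    refine Measurable.ite (measurableSet_lt mci measurable_snd) ?_ mci
    exact hdm.comp ((measurable_fst.add_const ι n).prodMk measurable_snd)
  · rw [tendsto_pi_nhds]; intro p
    by_cases h : 0 < p.2
    · simp only [if_pos h]
      exact (sol.F_tend hfl hfr p.1 h).comp (tend_seq p.1)
    · simp only [if_neg h, Function.uncurry, F]; exact tendsto_const_nhds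
lemma F_bdd {M C : ℝ} (hM : ∀ x t, |sol.u x t| ≤ M) (sp : 0 ≤ C) (hC : ∀ x z, |z| ≤ M → |dflux fl fr x z| ≤ C) (x s : ℝ) : |sol.F x s| ≤ C := by
  unfold F; split_ifs with h
  · exact hC _ _ (sol.up_bdd hM h)
  · simpa using sp
def pot (p : Pl) : ℝ := (∫ y in (0:ℝ)..p.1, sol.u y (max p.2 0)) - ∫ s in (0:ℝ)..(max p.2 0), sol.F 0 s
lemma ui (t a b : ℝ) : IntervalIntegrable (fun y => sol.u y t) volume a b := by
  obtain ⟨M, hM⟩ := sol.bdd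
  exact ii_bdd (sol.umeas_x t) (fun x => hM x t) _ _
lemma Fi (hfl : Continuous fl) (hfr : Continuous fr) (x a b : ℝ) : IntervalIntegrable (sol.F x) volume a b := by
  obtain ⟨M, hM⟩ := sol.bdd
  obtain ⟨C, sp, hC, -, -⟩ := flux_bdd hfl hfr M
  exact ii_bdd (sol.F_meas hfl hfr).of_uncurry_left (sol.F_bdd hM sp hC x) _ _
lemma pot_x (x y t : ℝ) : sol.pot (x,t) - sol.pot (y,t) = ∫ z in y..x, sol.u z (max t 0) := by
  unfold pot; simp only
  have := intervalIntegral.integral_interval_sub_left (sol.ui (max t 0) 0 x) (sol.ui (max t 0) 0 y)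
  linarith
lemma pot_t (hfl : Continuous fl) (hfr : Continuous fr) (x : ℝ) {ta t2 : ℝ} (sa : 0 ≤ ta) (h2 : ta ≤ t2) :
    sol.pot (x,t2) - sol.pot (x,ta) = - ∫ s in ta..t2, sol.F x s := by
  unfold pot; simp only [max_eq_left sa, max_eq_left (sa.trans h2)]
  have eb := intervalIntegral.integral_interval_sub_left (sol.Fi hfl hfr 0 0 t2) (sol.Fi hfl hfr 0 0 ta)
  rcases le_total 0 x with hx | hx
  · have := sol.box hfl hfr hx sa h2
    linarith
  · have := sol.box hfl hfr hx sa h2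
    rw [intervalIntegral.integral_symm, intervalIntegral.integral_symm (f := fun y => sol.u y ta)] 
    linarith
lemma pot_lip (hfl : Continuous fl) (hfr : Continuous fr) : ∃ K, Lwz K sol.pot := by
  obtain ⟨M, hM⟩ := sol.bdd
  obtain ⟨C, sp, hC, -, -⟩ := flux_bdd hfl hfr M
  have sw : 0 ≤ M := (An).trans (hM 0 0)
  have key : ∀ x s t, 0 ≤ t → t ≤ s → |sol.pot (x,s) - sol.pot (x,t)| ≤ C * |s - t| := by
    intro x s t sa h2
    rw [sol.pot_t hfl hfr x sa h2, abs_neg]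
    exact ii_le (sol.F_bdd hM sp hC x) _ _
  have kmax : ∀ x t, sol.pot (x,t) = sol.pot (x, max t 0) := by intro x t; simp [pot]
  refine ⟨_, lip2 sw sp (fun x y t => ?_) fun x s t => ?_⟩
  · rw [pot_x]; exact ii_le (fun z => hM z _) _ _
  · rw [kmax x s, kmax x t]
    have sd : |max s 0 - max t 0| ≤ |s - t| := abs_max_sub_max_le_abs s t 0
    refine le_trans ?_ (Mll sd sp)
    rcases le_total (max t 0) (max s 0) with h | h
    · exact key x _ _ Mxr h
    · rw [abs_sub_comm, abs_sub_comm (max s 0)]; exact key x _ _ Mxr h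
lemma pot_right (x : ℝ) {t : ℝ} (ht : 0 < t) : HasDerivWithinAt (fun y => sol.pot (y,t)) (sol.up x t) (Ici x) x := by
  have h := intervalIntegral.integral_hasDerivWithinAt_of_tendsto_ae_right (f := fun y => sol.u y t) (a := x) (b := x) (c := sol.up x t) (s := Ici x) (t := Ioi x)
    (sol.ui t x x) ((sol.umeas_x t).stronglyMeasurable.stronglyMeasurableAtFilter) ((sol.up_spec x t ht).mono_left inf_le_left)
  refine (h.add_const (sol.pot (x,t))).congr_of_mem (fun y _ => ?_) self_mem_Ici
  have := sol.pot_x y x t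
  rw [max_eq_left ht.le] at this; linarith
lemma pot_left (x : ℝ) {t : ℝ} (ht : 0 < t) : HasDerivWithinAt (fun y => sol.pot (y,t)) (sol.um x t) (Iic x) x := by
  have h := intervalIntegral.integral_hasDerivWithinAt_of_tendsto_ae_right (f := fun y => sol.u y t) (a := x) (b := x) (c := sol.um x t) (s := Iic x) (t := Iic x)
    (sol.ui t x x) ((sol.umeas_x t).stronglyMeasurable.stronglyMeasurableAtFilter) ?_
  · refine (h.add_const (sol.pot (x,t))).congr_of_mem (fun y _ => ?_) self_mem_Iic
    have := sol.pot_x y x t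
    rw [max_eq_left ht.le] at this; linarith
  · refine (sol.um_spec x t ht).mono_left ?_
    have : nhdsWithin x (Iic x) ⊓ ae volume ≤ nhdsWithin x (Iic x) ⊓ Filter.principal {x}ᶜ :=
      inf_le_inf le_rfl (by rw [le_principal_iff]; exact Measure.ae_ne volume x)
    refine this.trans ?_
    rw [nhdsWithin, nhdsWithin, inf_assoc, inf_principal]
    apply inf_le_inf le_rfl
    rw [principal_mono]; intro y hy; exact lt_of_le_of_ne hy.1 hy.2
lemma pot_ae (hfl : Continuous fl) (hfr : Continuous fr) : ∀ᵐ p : Pl, 0 < p.2 →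
    DifferentiableAt ℝ sol.pot p ∧ fderiv ℝ sol.pot p (1,0) = sol.u p.1 p.2 ∧ fderiv ℝ sol.pot p (0,1) = - dflux fl fr p.1 (sol.u p.1 p.2) := by
  obtain ⟨K, hK⟩ := sol.pot_lip hfl hfr
  obtain ⟨M, hM⟩ := sol.bdd
  obtain ⟨C, sp, hC, -, -⟩ := flux_bdd hfl hfr M
  have hdm := dflux_meas hfl hfr sol.meas
  have hd : ∀ᵐ p : Pl, DifferentiableAt ℝ sol.pot p := hK.ae_differentiableAt
  have mdx := measurable_fderiv_apply_const ℝ sol.pot exz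
  have mdt := measurable_fderiv_apply_const ℝ sol.pot et
  have hup : ∀ t, 0 < t → ∀ᵐ x : ℝ, HasDerivAt (fun y => sol.pot (y,t)) (sol.u x t) x ∧ sol.F x t = dflux fl fr x (sol.u x t) := by
    intro t ht
    have hli : LocallyIntegrable (fun y => sol.u y t) volume := by
      rw [locallyIntegrable_iff]; intro k hk
      exact Measure.integrableOn_of_bounded (M := M) hk.measure_lt_top.ne (sol.umeas_x t).aestronglyMeasurable (Ef fun x => hM x t)
    filter_upwards [LocallyIntegrable.ae_hasDerivAt_integral hli] with x hx
    have sa : HasDerivAt (fun y => sol.pot (y,t)) (sol.u x t) x := by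
      have := (hx 0).add_const (sol.pot (0,t))
      refine this.congr_of_eventuallyEq (Ef fun y => ?_)
      have := sol.pot_x y 0 t
      rw [max_eq_left ht.le] at this; simp only; linarith
    refine ⟨sa, ?_⟩
    have h2 := (uniqueDiffWithinAt_Ici x).eq_deriv _ sa.hasDerivWithinAt (sol.pot_right x ht)
    unfold F; rw [if_pos ht, h2]
  have hF : ∀ᵐ p : Pl, 0 < p.2 → sol.F p.1 p.2 = dflux fl fr p.1 (sol.u p.1 p.2) := by
    have : ∀ᵐ q : Pl, 0 < q.1 → sol.F q.2 q.1 = dflux fl fr q.2 (sol.u q.2 q.1) := by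
      rw [Measure.volume_eq_prod, Measure.ae_prod_iff_ae_ae]
      · filter_upwards with t
        by_cases ht : 0 < t
        · filter_upwards [hup t ht] with x hx _ using hx.2
        · filter_upwards with x h using absurd h ht
      · simp only [imp_iff_not_or]
        exact (measurableSet_lt mci measurable_fst).compl.union
          (measurableSet_eq_fun ((sol.F_meas hfl hfr).comp measurable_swap) (hdm.comp measurable_swap))
    have h2 := (Measure.measurePreserving_swap (μ := (volume : Measure ℝ)) (ν := (volume : Measure ℝ))).quasiMeasurePreserving.ae this
    exact h2
  have hx : ∀ᵐ p : Pl, DifferentiableAt ℝ sol.pot p → 0 < p.2 → fderiv ℝ sol.pot p (1,0) = sol.u p.1 p.2 := by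
    have : ∀ᵐ q : Pl, DifferentiableAt ℝ sol.pot q.swap → 0 < q.1 → fderiv ℝ sol.pot q.swap (1,0) = sol.u q.2 q.1 := by
      rw [Measure.volume_eq_prod, Measure.ae_prod_iff_ae_ae]
      · filter_upwards with t
        by_cases ht : 0 < t
        · filter_upwards [hup t ht] with x hx hdd _
          exact (fd_of_slice_x hdd).unique hx.1
        · filter_upwards with x _ h using absurd h ht
      · simp only [imp_iff_not_or]
        exact (measurable_swap (measurableSet_of_differentiableAt ℝ sol.pot)).compl.union ((measurableSet_lt mci measurable_fst).compl.union
          (measurableSet_eq_fun (mdx.comp measurable_swap) (sol.meas.comp measurable_swap)))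
    have h2 := (Measure.measurePreserving_swap (μ := (volume : Measure ℝ)) (ν := (volume : Measure ℝ))).quasiMeasurePreserving.ae this
    exact h2
  have ht : ∀ᵐ p : Pl, DifferentiableAt ℝ sol.pot p → 0 < p.2 → fderiv ℝ sol.pot p (0,1) = - sol.F p.1 p.2 := by
    rw [Measure.volume_eq_prod, Measure.ae_prod_iff_ae_ae]
    · filter_upwards with x
      have hm : Measurable (sol.F x) := (sol.F_meas hfl hfr).of_uncurry_left
      have hli : LocallyIntegrable (sol.F x) volume := by
        rw [locallyIntegrable_iff]; intro k hk
        exact Measure.integrableOn_of_bounded (M := C) hk.measure_lt_top.ne hm.aestronglyMeasurable (Ef fun s => sol.F_bdd hM sp hC x s)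
      filter_upwards [LocallyIntegrable.ae_hasDerivAt_integral hli] with t ht hdd tq
      refine (fd_of_slice_t hdd).unique ?_
      have sd := ((ht 0).neg.add_const (sol.pot (x,0)))
      refine sd.congr_of_eventuallyEq ?_
      filter_upwards [lt_mem_nhds tq] with s hs
      have := sol.pot_t hfl hfr x le_rfl (le_of_lt hs)
      simp only [Pi.neg_apply] at this ⊢; linarith
    · simp only [imp_iff_not_or]
      exact (measurableSet_of_differentiableAt ℝ sol.pot).compl.union ((measurableSet_lt mci measurable_snd).compl.union
        (measurableSet_eq_fun mdt (sol.F_meas hfl hfr).neg))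
  filter_upwards [hd, hF, hx, ht] with p sa h2 sd si se
  exact ⟨sa, sd sa se, by rw [si sa se, h2 se]⟩
end ABSol
def kint (f : ℝ → ℝ) (W : Pl → ℝ) (k : ℝ) (φ : Pl → ℝ) (p : Pl) : ℝ :=
  |Dx W p - k| * Dt φ p +
    Real.sign (Dx W p - k) * (f Dx W p - f k) * Dx φ p
structure HalfSol (f : ℝ → ℝ) (W : Pl → ℝ) : Prop where
  lip : ∃ K, Lwz K W
  hj : ∀ᵐ p : Pl, p.1 < 0 → 0 < p.2 → Dt W p = - f Dx W p
  kru : ∀ (k : ℝ) (φ : Pl → ℝ), ContDiff ℝ 1 φ → Hcs φ → (∀ p, 0 ≤ φ p) →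
    (∀ p, 0 ≤ p.1 ∨ p.2 ≤ 0 → φ p = 0) → 0 ≤ ∫ p, kint f W k φ p
def sj : (Pl) ≃L[ℝ] (Pl) := (ContinuousLinearEquiv.neg ℝ (M := ℝ)).prodCongr (ContinuousLinearEquiv.refl ℝ ℝ)
lemma rfl2_ap (p : Pl) : sj p = (-p.1, p.2) := rfl
lemma rfl2_rfl2 (p : Pl) : sj (sj p) = p := by simp [rfl2_ap]
lemma fd_rfl (W : Pl → ℝ) (p v : Pl) : fderiv ℝ (W ∘ sj) p v = fderiv ℝ W (sj p) (sj v) := by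
  rw [sj.comp_right_fderiv]; rfl
lemma fd_rfl_x (W : Pl → ℝ) (p : Pl) : Dx (W ∘ sj) p = - Dx W (sj p) := by
  rw [fd_rfl, ← map_neg]; congr 1; ext <;> simp [rfl2_ap]
lemma fd_rfl_t (W : Pl → ℝ) (p : Pl) : Dt (W ∘ sj) p = Dt W (sj p) := by
  rw [fd_rfl]; congr 1; ext <;> simp [rfl2_ap]
lemma mp_rfl : MeasurePreserving (sj : Pl → Pl) := 
  (Measure.measurePreserving_neg (volume : Measure ℝ)).prod (MeasurePreserving.id volume)
lemma int_rfl (G : Pl → ℝ) : ∫ p, G (sj p) = ∫ p, G p :=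
  mp_rfl.integral_comp (sj.toHomeomorph.measurableEmbedding) G
lemma kint_rfl (f : ℝ → ℝ) (W : Pl → ℝ) (k : ℝ) (φ : Pl → ℝ) (p : Pl) :
    kint (fun k => f (-k)) (W ∘ sj) k φ p = kint f W (-k) (φ ∘ sj) (sj p) := by
  unfold kint
  rw [fd_rfl_x, fd_rfl_x, fd_rfl_t, rfl2_rfl2]
  set w := Dx W (sj p)
  have sa : -w - k = -(w - -k) := by ring
  simp only [sa, abs_neg, Real.sign_neg, neg_neg]; ring
lemma sign_mul_self' (z : ℝ) : Real.sign z * z = |z| := by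
  rcases lt_trichotomy z 0 with h | h | h
  · rw [Real.sign_of_neg h, abs_of_neg h]; ring
  · simp [h]
  · rw [Real.sign_of_pos h, abs_of_pos h]; ring
lemma rfl_cd {φ : Pl → ℝ} (h : ContDiff ℝ 1 φ) : ContDiff ℝ 1 (φ ∘ sj) := h.comp sj.contDiff
lemma rfl_hcs {φ : Pl → ℝ} (h : Hcs φ) : Hcs (φ ∘ sj) :=
  h.comp_homeomorph sj.toHomeomorph
lemma fd_min {φ : Pl → ℝ} (h : ∀ p, 0 ≤ φ p) {p : Pl} (hp : φ p = 0) : fderiv ℝ φ p = 0 :=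
  IsLocalMin.fderiv_eq_zero (Ef fun q => by rw [hp]; exact h q)
namespace ABSol
variable {fl fr : ℝ → ℝ} {A B : ℝ} {ua : ℝ → ℝ} (sol : ABSol fl fr A B ua)
lemma half_l (hfl : Continuous fl) (hfr : Continuous fr) : HalfSol fl sol.pot := by
  refine ⟨sol.pot_lip hfl hfr, ?_, ?_⟩
  · filter_upwards [sol.pot_ae hfl hfr] with p hp sa h2
    rw [(hp h2).2.2, (hp h2).2.1, dflux, if_pos sa]
  · intro k φ sa h2 sd si
    have := sol.kruzkov_l k (fun x t => φ (x,t)) sa h2 (fun x t => sd _) (fun x t h => si _ h)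
    refine this.trans_eq (integral_congr_ae ?_)
    filter_upwards [sol.pot_ae hfl hfr] with p hp
    rw [kint]
    rw [fd_x (p := p) (φ := fun x t => φ (x,t)) (sa.differentiable one_ne_zero p), fd_t (p := p) (φ := fun x t => φ (x,t)) (sa.differentiable one_ne_zero p)]
    by_cases tz : 0 < p.2
    · rw [(hp tz).2.1]
    · rw [fd_min sd (si p (Or.inr (not_lt.1 tz)))]; simp
lemma half_r (hfl : Continuous fl) (hfr : Continuous fr) : HalfSol (fun k => fr (-k)) (sol.pot ∘ sj) := by
  have hae := mp_rfl.quasiMeasurePreserving.ae (sol.pot_ae hfl hfr)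
  refine ⟨?_, ?_, ?_⟩
  · obtain ⟨K, hK⟩ := sol.pot_lip hfl hfr
    exact ⟨_, hK.comp sj.lipschitz⟩
  · filter_upwards [hae] with p hp sa h2
    rw [fd_rfl_t, fd_rfl_x, (hp h2).2.2, (hp h2).2.1, dflux, if_neg, neg_neg]
    rw [rfl2_ap]; simp only; linarith
  · intro k φ sa h2 sd si
    simp_rw [kint_rfl]
    rw [int_rfl (kint fr sol.pot (-k) (φ ∘ sj))]
    have h1' := rfl_cd sa
    have h4' : ∀ p : Pl, p.1 ≤ 0 ∨ p.2 ≤ 0 → (φ ∘ sj) p = 0 := fun p hp => si _ (by simpa [rfl2_ap] using hp)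
    have := sol.kruzkov_r (-k) (fun x t => (φ ∘ sj) (x,t)) h1' (rfl_hcs h2) (fun x t => sd _) (fun x t h => h4' (x,t) h)
    refine this.trans_eq (integral_congr_ae ?_)
    filter_upwards [sol.pot_ae hfl hfr] with p hp
    rw [kint]
    rw [fd_x (p := p) (φ := fun x t => (φ ∘ sj) (x,t)) (h1'.differentiable one_ne_zero p), fd_t (p := p) (φ := fun x t => (φ ∘ sj) (x,t)) (h1'.differentiable one_ne_zero p)]
    by_cases tz : 0 < p.2
    · rw [(hp tz).2.1]
    · rw [fd_min (φ := φ ∘ sj) (fun p => sd _) (h4' p (Or.inr (not_lt.1 tz)))]; simp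
end ABSol
lemma ae_nn {g : ℝ → ℝ} (hg : Measurable g) {M : ℝ} (hM : ∀ t, |g t| ≤ M) (h : ∀ ta t2, 0 ≤ ta → ta ≤ t2 → 0 ≤ ∫ t in ta..t2, g t) :
    ∀ᵐ t : ℝ, 0 < t → 0 ≤ g t := by
  have hli : LocallyIntegrable g volume := by
    rw [locallyIntegrable_iff]; intro k hk
    exact Measure.integrableOn_of_bounded (M := M) hk.measure_lt_top.ne hg.aestronglyMeasurable (Ef hM)
  filter_upwards [LocallyIntegrable.ae_hasDerivAt_integral hli] with t ht se
  have sa := (ht t).hasDerivWithinAt (s := Ici t)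
  rw [hasDerivWithinAt_iff_tendsto_slope] at sa
  have hne : (nhdsWithin t (Ici t \ {t})).NeBot := by
    rw [Ici_sdiff_left]; infer_instance
  refine ge_of_tendsto sa ?_
  filter_upwards [self_mem_nhdsWithin] with s hs
  have tw : t ≤ s := hs.1
  rw [slope_def_field, intervalIntegral.integral_same, sub_zero]
  exact div_nonneg (h t s se.le tw) ln
lemma trace_ineq {P Q : ℝ → ℝ → ℝ} (hP : Measurable (Function.uncurry P)) (hQ : Measurable (Function.uncurry Q)) {M : ℝ}
    (hPM : ∀ x t, |P x t| ≤ M) (hQM : ∀ x t, |Q x t| ≤ M) {Qm Qp : ℝ → ℝ}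
    (hl : ∀ t, 0 < t → Tendsto (fun x => Q x t) (nhdsWithin 0 (Iio 0)) (nhds (Qm t)))
    (hr : ∀ t, 0 < t → Tendsto (fun x => Q x t) (nhdsWithin 0 (Ioi 0)) (nhds (Qp t)))
    (H : ∀ φ : ℝ → ℝ → ℝ, ContDiff ℝ 1 (fun p : Pl => φ p.1 p.2) → Hcs (fun p : Pl => φ p.1 p.2) →
      (∀ x t, 0 ≤ φ x t) → (∀ x t, t ≤ 0 → φ x t = 0) →
      0 ≤ ∫ p : Pl, (P p.1 p.2 * deriv (fun s => φ p.1 s) p.2 + Q p.1 p.2 * deriv (fun y => φ y p.2) p.1)) :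
    ∀ᵐ t : ℝ, 0 < t → Qp t ≤ Qm t := by
  have sw : 0 ≤ M := (An).trans (hPM 0 0)
  have key : ∀ ta t2, 0 ≤ ta → ta ≤ t2 → 0 ≤ (∫ t in ta..t2, Qm t) - ∫ t in ta..t2, Qp t := by
    intro ta t2 sa h2
    have hc : ∀ n : ℕ, (-ι n) ≤ 0 := fun n => by rw [neg_nonpos]; positivity
    set G : ℕ → ℝ → ℝ := fun n t => ∫ x, P x t * wnd (-ι n) 0 n x
    have hGm : ∀ n, Measurable (G n) := fun n => ABSol.inner_meas (ABSol.swap_meas hP) (wnd_cd _ _ n).continuous.measurable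
    have hGb : ∀ n t, |G n t| ≤ M * (2 * ι n) := by
      intro n t
      have := ABSol.inner_bdd (P := fun x => P x t) (fun x => hPM x t) (c := -ι n) (d := ι n) (by linarith [hc n])
        (wnd_abs (hc n) n) (fun x hx => by
          by_cases h : x ≤ -ι n
          · exact wnd_le (hc n) h
          · apply wnd_ge (hc n); push Not at h
            by_contra sk; push Not at sk; exact hx ⟨h.le, by linarith⟩)
      refine this.trans_eq (by ring)
    have kb : ∀ n τ, |∫ t, rho n (t - τ) * G n t| ≤ M * (2 * ι n) := by
      intro n τ
      have hi := (aker_right τ).integ n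
      calc |∫ t, rho n (t - τ) * G n t| ≤ ∫ t, |rho n (t - τ) * G n t| := abs_integral_le_integral_abs
        _ ≤ ∫ t, rho n (t - τ) * (M * (2 * ι n)) := by
          apply integral_mono_of_nonneg (Ef fun t => An) (hi.mul_const _)
          refine Ef fun t => ?_
          simp only [abs_mul, Ai (rho_nonneg n (t - τ))]
          exact Mll (hGb n t) (rho_nonneg _ _)
        _ = M * (2 * ι n) := by rw [integral_mul_const, (aker_right τ).int1 n, one_mul]
    have ineq : ∀ n : ℕ, 0 ≤ 2 * (M * (2 * ι n)) + ((∫ x, rho n (x - 0 + ι n) * ∫ t, Q x t * wnd ta t2 n t) -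
        ∫ x, rho n (x - 0) * ∫ t, Q x t * wnd ta t2 n t) := by
      intro n
      have h := H (fun x t => wnd (-ι n) 0 n x * wnd ta t2 n t) (ABSol.tens_cd (wnd_cd _ _ _) (wnd_cd _ _ _))
        (ABSol.tens_hcs (wnd_supp (hc n) n) (wnd_supp h2 n)) (fun x t => Pn (wnd_nonneg (hc n) _ _) (wnd_nonneg h2 _ _))
        (fun x t h => by rw [wnd_le h2 (h.trans sa), mul_zero])
      rw [split_test (wnd_cd _ _ n) (wnd_cd _ _ n) (wnd_hcs (hc n) n) (wnd_hcs h2 n) hP hQ hPM hQM] at h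
      have eb : ∫ t, deriv (wnd ta t2 n) t * G n t = (∫ t, rho n (t - ta) * G n t) - ∫ t, rho n (t - t2) * G n t := by
        rw [← integral_sub (ABSol.intg_wnd ((aker_right ta).integ n) (hGm n) (hGb n)) (ABSol.intg_wnd ((aker_right t2).integ n) (hGm n) (hGb n))]
        congr 1; funext t; rw [wnd_deriv]; ring
      have ea : ∫ x, deriv (wnd (-ι n) 0 n) x * ∫ t, Q x t * wnd ta t2 n t = (∫ x, rho n (x - 0 + ι n) * ∫ t, Q x t * wnd ta t2 n t) -
        ∫ x, rho n (x - 0) * ∫ t, Q x t * wnd ta t2 n t := by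
        have hm := ABSol.inner_meas hQ (wnd_cd ta t2 n).continuous.measurable
        have hb : ∀ x, |∫ t, Q x t * wnd ta t2 n t| ≤ M * (t2 + 1 - ta) := fun x =>
          ABSol.inner_bdd (fun t => hQM x t) ln (wnd_abs h2 n) (wnd_supp h2 n)
        rw [← integral_sub (ABSol.intg_wnd ((aker_left 0).integ n) hm hb) (ABSol.intg_wnd ((aker_right 0).integ n) hm hb)]
        congr 1; funext t; rw [wnd_deriv, sub_neg_eq_add, sub_zero]; ring
      rw [eb, ea] at h
      have bb := (abs_le.1 (kb n ta)).2
      have bd := (abs_le.1 (kb n t2)).1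
      linarith
    obtain ⟨aa, ab, ac⟩ := trace_L1 hQ hQM (l := nhdsWithin 0 (Iio 0)) (ss := Qm) (c := ta) (d := t2+1) sa hl
    obtain ⟨bb, bd, b3⟩ := trace_L1 hQ hQM (l := nhdsWithin 0 (Ioi 0)) (ss := Qp) (c := ta) (d := t2+1) sa hr
    have la := box_conc (aker_left 0) (fun n => (wnd_cd ta t2 n).continuous.measurable) (wnd_abs h2) (wnd_supp h2) (wnd_lim h2) hQ hQM aa ab ac
    have l2 := box_conc (aker_right 0) (fun n => (wnd_cd ta t2 n).continuous.measurable) (wnd_abs h2) (wnd_supp h2) (wnd_lim h2) hQ hQM bb bd b3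
    rw [wnd_int _ h2] at la l2
    have lb : Tendsto (fun n : ℕ => 2 * (M * (2 * ι n))) atTop (nhds (2 * (M * (2 * 0)))) :=
      ((tendsto_one_div_add_atTop_nhds_zero_nat (𝕜 := ℝ)).const_mul 2 |>.const_mul M |>.const_mul 2)
    have := ge_of_tendsto (lb.add (la.sub l2)) (Ef ineq)
    simpa using this
  set qm : ℝ → ℝ := fun t => if 0 < t then Qm t else 0
  set qp : ℝ → ℝ := fun t => if 0 < t then Qp t else 0
  have gen : ∀ (l : Filter ℝ) [l.IsCountablyGenerated] [l.NeBot] (ss : ℝ → ℝ), (∀ t, 0 < t → Tendsto (fun x => Q x t) l (nhds (ss t))) →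
      Measurable (fun t => if 0 < t then ss t else 0) ∧ ∀ t, |(fun t => if 0 < t then ss t else 0) t| ≤ M := by
    intro l _ _ ss h
    constructor
    · apply measurable_of_tendsto_metrizable' l (f := fun x t => if 0 < t then Q x t else 0)
      · intro x; exact Measurable.ite measurableSet_Ioi hQ.of_uncurry_left mci
      · rw [tendsto_pi_nhds]; intro t
        by_cases ht : 0 < t
        · simpa only [if_pos ht] using h t ht
        · simpa only [if_neg ht] using tendsto_const_nhds
    · intro t; simp only; split_ifs with ht
      · exact le_of_tendsto (h t ht).abs (Ef fun x => hQM x t)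
      · simpa
  obtain ⟨ma, mb⟩ := gen _ Qm hl
  obtain ⟨p1, p2⟩ := gen _ Qp hr
  have fin := ae_nn (ma.sub p1) (M := 2*M) (fun t => (abs_sub _ _).trans (by linarith [mb t, p2 t])) (fun ta t2 sa h2 => by
    have e : ∀ q : ℝ → ℝ, ∫ t in ta..t2, q t = ∫ t in ta..t2, if 0 < t then q t else 0 := fun q =>
      intervalIntegral.integral_congr_ae (Ef fun t ht => by
        rw [uIoc_of_le h2] at ht; rw [if_pos (sa.trans_lt ht.1)])
    have := key ta t2 sa h2
    rw [e Qm, e Qp, ← intervalIntegral.integral_sub (ii_bdd ma mb _ _) (ii_bdd p1 p2 _ _)] at this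
    exact this)
  filter_upwards [fin] with t ht se
  have := ht se
  simp only [Pi.sub_apply, if_pos se] at this
  linarith
lemma sgn_eq (f : ℝ → ℝ) (z k : ℝ) : Real.sign (z - k) * (f z - f k) = f (max z k) - f (min z k) := by
  rcases lt_trichotomy z k with h | h | h
  · rw [Real.sign_of_neg ln, max_eq_right h.le, min_eq_left h.le]; ring
  · simp [h]
  · rw [Real.sign_of_pos ln, max_eq_left h.le, min_eq_right h.le]; ring
lemma sgn_cont {f : ℝ → ℝ} (hf : Continuous f) (k : ℝ) : Continuous (fun z => Real.sign (z - k) * (f z - f k)) := by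
  simp_rw [sgn_eq]
  exact (hf.comp (continuous_id.max cst)).sub (hf.comp (continuous_id.min cst))
lemma sgn_meas : Measurable Real.sign := by
  unfold Real.sign
  exact Measurable.ite measurableSet_Iio mci (Measurable.ite measurableSet_Ioi mci mci)
lemma sgn_abs (z : ℝ) : |Real.sign z| ≤ 1 := by
  rcases Real.sign_apply_eq z with h | h | h <;> rw [h] <;> norm_num
namespace ABSol
variable {fl fr : ℝ → ℝ} {A B : ℝ} {ua : ℝ → ℝ} (sol : ABSol fl fr A B ua)
lemma F_tend_l (hfl : Continuous fl) {t : ℝ} (ht : 0 < t) :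
    Tendsto (fun y => dflux fl fr y (sol.u y t)) (nhdsWithin 0 (Iio 0)) (nhds (fl (sol.um 0 t))) := by
  refine ((hfl.tendsto _).comp (sol.um_spec 0 t ht)).congr' ?_
  filter_upwards [self_mem_nhdsWithin] with y hy
  rw [dflux, if_pos (show y < 0 from hy)]; rfl
lemma F0 {t : ℝ} (ht : 0 < t) : sol.F 0 t = fr (sol.up 0 t) := by
  simp [F, ht, dflux]
lemma RH (hfl : Continuous fl) (hfr : Continuous fr) : ∀ᵐ t : ℝ, 0 < t → fl (sol.um 0 t) = fr (sol.up 0 t) := by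
  obtain ⟨M, hM⟩ := sol.bdd
  obtain ⟨C, sp, hC, -, -⟩ := flux_bdd hfl hfr M
  have sw : 0 ≤ M := (An).trans (hM 0 0)
  have hdm := dflux_meas hfl hfr sol.meas
  have sa := trace_ineq sol.meas hdm (M := M + C) (fun x t => (hM x t).trans ln) (fun x t => (hC _ _ (hM x t)).trans ln)
    (Qm := fun t => fl (sol.um 0 t)) (Qp := fun t => fr (sol.up 0 t)) (fun t ht => sol.F_tend_l hfl ht)
    (fun t ht => by rw [← sol.F0 ht]; exact sol.F_tend hfl hfr 0 ht) (fun φ aa ab _ ac => (sol.weak φ aa ab ac).ge)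
  have h2 := trace_ineq (P := fun x t => - sol.u x t) (Q := fun x t => - dflux fl fr x (sol.u x t)) sol.meas.neg hdm.neg (M := M + C) (fun x t => by rw [abs_neg]; exact (hM x t).trans ln)
    (fun x t => by rw [abs_neg]; exact (hC _ _ (hM x t)).trans ln)
    (Qm := fun t => - fl (sol.um 0 t)) (Qp := fun t => - fr (sol.up 0 t)) (fun t ht => (sol.F_tend_l hfl ht).neg)
    (fun t ht => by rw [← sol.F0 ht]; exact (sol.F_tend hfl hfr 0 ht).neg) (fun φ aa ab _ ac => by
      have := sol.weak φ aa ab ac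
      have e : (∫ p : Pl, (-sol.u p.1 p.2 * deriv (fun s => φ p.1 s) p.2 + -dflux fl fr p.1 (sol.u p.1 p.2) * deriv (fun y => φ y p.2) p.1)) =
        - ∫ p : Pl, (sol.u p.1 p.2 * deriv (fun s => φ p.1 s) p.2 + dflux fl fr p.1 (sol.u p.1 p.2) * deriv (fun y => φ y p.2) p.1) := by
        rw [← integral_neg]; congr 1; funext p; ring
      rw [e, this]; simp)
  filter_upwards [sa, h2] with t a b se
  have := a se; have := b se; linarith
lemma ient (hfl : Continuous fl) (hfr : Continuous fr) : ∀ᵐ t : ℝ, 0 < t →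
    Real.sign (sol.up 0 t - B) * (fr (sol.up 0 t) - fr B) ≤ Real.sign (sol.um 0 t - A) * (fl (sol.um 0 t) - fl A) := by
  obtain ⟨M, hM⟩ := sol.bdd
  obtain ⟨C, sp, hC, -, -⟩ := flux_bdd hfl hfr (M + |A| + |B|)
  have sw : 0 ≤ M := (An).trans (hM 0 0)
  have hcm : Measurable (fun p : Pl => cAB A B p.1) :=
    Measurable.ite (measurableSet_le measurable_fst mci) mci mci
  have hcb : ∀ x, |cAB A B x| ≤ M + |A| + |B| := by
    intro x; unfold cAB; split_ifs
    · linarith [abs_nonneg B]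
    · linarith [abs_nonneg A]
  have hdm := dflux_meas hfl hfr sol.meas
  have hdm2 := dflux_meas hfl hfr (v := fun x _ => cAB A B x) hcm
  have hub : ∀ x t, |sol.u x t| ≤ M + |A| + |B| := fun x t => (hM x t).trans (by linarith [abs_nonneg A, abs_nonneg B])
  refine trace_ineq (P := fun x t => |sol.u x t - cAB A B x|) (Q := fun x t => Real.sign (sol.u x t - cAB A B x) *
      (dflux fl fr x (sol.u x t) - dflux fl fr x (cAB A B x))) (M := 2 * (M + |A| + |B|) + 2 * C) (sol.meas.sub hcm).abs ((sgn_meas.comp (sol.meas.sub hcm)).mul (hdm.sub hdm2)) ?_ ?_ ?_ ?_ ?_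
  · intro x t; rw [abs_abs]; refine (abs_sub _ _).trans ?_; linarith [hub x t, hcb x]
  · intro x t; rw [abs_mul]
    have := (abs_sub (dflux fl fr x (sol.u x t)) (dflux fl fr x (cAB A B x)))
    have h2 := mul_le_mul (sgn_abs (sol.u x t - cAB A B x)) this An zero_le_one
    linarith [hC x _ (hub x t), hC x _ (hcb x), abs_nonneg A, abs_nonneg B]
  · intro t ht
    refine (((sgn_cont hfl A).tendsto _).comp (sol.um_spec 0 t ht)).congr' ?_
    filter_upwards [self_mem_nhdsWithin] with y hy
    have hy' : y < 0 := hy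
    simp [dflux, cAB, if_pos hy', if_pos hy'.le]
  · intro t ht
    refine (((sgn_cont hfr B).tendsto _).comp (sol.up_spec 0 t ht)).congr' ?_
    filter_upwards [self_mem_nhdsWithin] with y hy
    have hy' : 0 < y := hy
    simp [dflux, cAB, if_neg hy'.not_gt, if_neg hy'.not_ge]
  · intro φ aa ab ac a4
    exact sol.interfaceEntropy φ aa ab ac a4
end ABSol
structure Conn (a : ℝ) (fl fr : ℝ → ℝ) (A B γ θl θr : ℝ) : Prop where
  ha : 0 < a
  Cl : ContDiff ℝ 2 fl
  Cr : ContDiff ℝ 2 fr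
  l2 : ∀ w, a ≤ deriv (deriv fl) w
  r2 : ∀ w, a ≤ deriv (deriv fr) w
  hl : deriv fl θl = 0
  hr : deriv fr θr = 0
  fA : fl A = γ
  fB : fr B = γ
  hA : A ≤ θl
  hB : θr ≤ B
lemma cv_anti {a : ℝ} {f : ℝ → ℝ} (ha : 0 < a) (C2 : ContDiff ℝ 2 f) (h2 : ∀ w, a ≤ deriv (deriv f) w) {θ : ℝ} (hθ : deriv f θ = 0)
    {x y : ℝ} (h : x ≤ y) (hy : y ≤ θ) : f y ≤ f x := by
  have sa := deriv_growth C2 h2 hy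
  have sd := uconv C2 h2 y x
  nlinarith [Pn ha.le (sub_nonneg.2 hy), Pn ha.le (sq_nonneg (x - y))]
lemma cv_mono {a : ℝ} {f : ℝ → ℝ} (ha : 0 < a) (C2 : ContDiff ℝ 2 f) (h2 : ∀ w, a ≤ deriv (deriv f) w) {θ : ℝ} (hθ : deriv f θ = 0)
    {x y : ℝ} (h : x ≤ y) (hy : θ ≤ x) : f x ≤ f y := by
  have sa := deriv_growth C2 h2 hy
  have sd := uconv C2 h2 x y
  nlinarith [Pn ha.le (sub_nonneg.2 hy), Pn ha.le (sq_nonneg (y - x))]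
lemma ABSol.icond {a A B γ θl θr : ℝ} {fl fr ua : ℝ → ℝ} (hc : Conn a fl fr A B γ θl θr) (sol : ABSol fl fr A B ua) : ∀ᵐ t : ℝ, 0 < t →
    γ ≤ sol.F 0 t ∧ (sol.um 0 t ≤ θl → θr ≤ sol.up 0 t → sol.F 0 t = γ) := by
  filter_upwards [sol.RH hc.Cl.continuous hc.Cr.continuous, sol.ient hc.Cl.continuous hc.Cr.continuous] with t sa h2 ht
  have eb := sa ht
  have ea := h2 ht
  rw [sol.F0 ht]
  rw [hc.fA, hc.fB, eb] at ea
  set g := fr (sol.up 0 t)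
  have hge : γ ≤ g := by
    by_contra hlt; push Not at hlt
    have ic : A < sol.um 0 t := by
      by_contra h; push Not at h
      have := cv_anti hc.ha hc.Cl hc.l2 hc.hl h hc.hA
      rw [hc.fA, eb] at this; linarith
    have ia : sol.up 0 t < B := by
      by_contra h; push Not at h
      have : fr B ≤ g := cv_mono hc.ha hc.Cr hc.r2 hc.hr h hc.hB
      rw [hc.fB] at this; linarith
    rw [Real.sign_of_pos (sub_pos.2 ic), Real.sign_of_neg (sub_neg.2 ia)] at ea
    linarith
  refine ⟨hge, fun ud ue => ?_⟩
  by_contra hne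
  have hlt : γ < g := lt_of_le_of_ne hge (Ne.symm hne)
  have ic : sol.um 0 t < A := by
    by_contra h; push Not at h
    have := cv_anti hc.ha hc.Cl hc.l2 hc.hl h ud
    rw [hc.fA, eb] at this; linarith
  have ia : B < sol.up 0 t := by
    by_contra h; push Not at h
    have : g ≤ fr B := cv_mono hc.ha hc.Cr hc.r2 hc.hr h ue
    rw [hc.fB] at this; linarith
  rw [Real.sign_of_neg (sub_neg.2 ic), Real.sign_of_pos (sub_pos.2 ia)] at ea
  linarith
lemma int_cs {g : Pl → ℝ} (hg : Measurable g) {M : ℝ} (hM : ∀ p, |g p| ≤ M) {K : Set (Pl)} (hK : IsCompact K) (h : ∀ p, p ∉ K → g p = 0) : Integrable g := by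
  rw [← integrableOn_iff_integrable_of_support_subset (s := K) (fun p hp => by by_contra sk; exact hp (h p sk))]
  exact Measure.integrableOn_of_bounded (M := M) hK.measure_lt_top.ne hg.aestronglyMeasurable (Ef hM)
lemma kint_PQ {f : ℝ → ℝ} (hf : Continuous f) {W : Pl → ℝ} {K : NNReal} (hW : Lwz K W) (k : ℝ) :
    Measurable (fun p => |Dx W p - k|) ∧ Measurable (fun p => Real.sign (Dx W p - k) * (f Dx W p - f k)) ∧
    ∃ M, (∀ p, |(|Dx W p - k|)| ≤ M) ∧ (∀ p, |Real.sign (Dx W p - k) * (f Dx W p - f k)| ≤ M) := by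
  have mw : Measurable (fun p => Dx W p) := meas_fd _
  have hb : ∀ p, |Dx W p| ≤ K * ‖exz‖ := fun p => fderiv_bdd hW p _
  set L := K * ‖exz‖
  obtain ⟨C, sp, hC⟩ := bdd_on hf L
  refine ⟨(mw.sub_const k).abs, (sgn_meas.comp (mw.sub_const k)).mul ((hf.measurable.comp mw).sub_const _), L + |k| + (C + |f k|), fun p => ?_, fun p => ?_⟩
  · rw [abs_abs]; refine (abs_sub _ _).trans ?_; linarith [hb p, abs_nonneg (f k)]
  · rw [abs_mul]
    have h2 := mul_le_mul (sgn_abs (Dx W p - k)) (abs_sub (f Dx W p) (f k)) An zero_le_one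
    linarith [hC _ (hb p), abs_nonneg k, (An).trans (hb p)]
lemma kru_lip {f : ℝ → ℝ} {W : Pl → ℝ} (h : HalfSol f W) (hf : Continuous f) (k : ℝ) {φ : Pl → ℝ} {K : NNReal} (hφ : Lwz K φ)
    (hc : Hcs φ) (se : ∀ p, 0 ≤ φ p) {δ : ℝ} (hδ : 0 < δ) (hs : ∀ p, -δ ≤ p.1 ∨ p.2 ≤ δ → φ p = 0) : 0 ≤ ∫ p, kint f W k φ p := by
  obtain ⟨KW, hW⟩ := h.lip
  obtain ⟨ma, mb, M, bb, bd⟩ := kint_PQ hf hW k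
  have hl := moll_lim hφ hc ma mb bb bd
  refine ge_of_tendsto hl ?_
  filter_upwards [inv_lt_ev hδ] with j hj
  refine h.kru k (moll j φ) (moll_contDiff j hφ.continuous 1) ?_ (fun p => moll_nonneg j p se) ?_
  · obtain ⟨ρ, hρ⟩ := hc.isCompact.isBounded.subset_closedBall (0 : Pl)
    apply HasCompactSupport.intro (isCompact_closedBall (0:ℝ×ℝ) (ρ + δ))
    intro p hp
    apply moll_zero
    intro q hq
    by_contra hne
    have := hρ (subset_tsupport _ hne)
    rw [mem_closedBall_zero_iff] at this hp
    apply hp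
    have := norm_sub_norm_le p q
    rw [norm_sub_rev] at this
    linarith
  · intro p hp
    apply moll_zero
    intro q hq
    apply hs
    have eb := (norm_fst_le (q - p)).trans_lt (hq.trans hj)
    have ea := (norm_snd_le (q - p)).trans_lt (hq.trans hj)
    rw [Ra, abs_lt] at eb ea
    simp only [Prod.fst_sub, Prod.snd_sub] at eb ea
    rcases hp with hp | hp
    · left; linarith
    · right; linarith
def sg (d : ℝ) : ℝ := √(1 + d^2)
lemma sq1_sq (d : ℝ) : sg d ^ 2 = 1 + d^2 := Real.sq_sqrt ps
lemma sq1_ge (d : ℝ) : 1 ≤ sg d := by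
  rw [sg, Real.one_le_sqrt]; nlinarith
lemma sq1_abs (d : ℝ) : |d| ≤ sg d := by
  rw [sg]; apply Real.abs_le_sqrt; linarith
lemma sq1_lip (x y : ℝ) : |sg x - sg y| ≤ |x - y| := by
  have key : ∀ x y, sg x ≤ sg y + |x - y| := by
    intro x y
    rw [sg, Real.sqrt_le_iff]
    refine ⟨by have := sq1_ge y; positivity, ?_⟩
    have sa := sq1_sq y
    have h2 := sq1_abs y
    have sd := Mlr h2 (abs_nonneg (x - y))
    have si := le_abs_self (y * (x - y))
    rw [abs_mul] at si
    nlinarith [sq_abs (x - y)]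
  rw [abs_le]; have := key x y; have := key y x; rw [abs_sub_comm y x] at this
  constructor <;> linarith
lemma sq1_hd (d : ℝ) : HasDerivAt sg (d / sg d) d := by
  have se : HasDerivAt (fun y : ℝ => 1 + y^2) (2*d) d := by simpa using (hasDerivAt_pow 2 d).const_add 1
  have h := se.sqrt ps
  have e : d / sg d = 2 * d / (2 * √(1 + d^2)) := (mul_div_mul_left _ _ two_ne_zero).symm
  rw [e]; exact h
lemma sq1_d (d : ℝ) : |d / sg d| ≤ |d| := by
  have := sq1_ge d
  rw [abs_div, abs_of_pos (by linarith : 0 < sg d)]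
  exact div_le_self An this
lemma sq1_lo1 {d : ℝ} (h : |d| ≤ 1) : d^2 / 3 ≤ sg d - 1 := by
  have : 1 + d^2/3 ≤ sg d := by
    apply Real.le_sqrt_of_sq_le
    have sa : d^2 ≤ 1 := by rw [← sq_abs]; nlinarith [abs_nonneg d]
    nlinarith [sq_nonneg d]
  linarith
lemma sq1_lo2 {d r : ℝ} (hr1 : r ≤ 1) (h : r ≤ |d|) : r * |d| / 3 ≤ sg d - 1 := by
  rcases le_total |d| 1 with sa | sa
  · refine le_trans ?_ (sq1_lo1 sa)
    rw [← sq_abs d]; nlinarith [abs_nonneg d]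
  · have : 1 + |d|/3 ≤ sg d := by
      apply Real.le_sqrt_of_sq_le
      rw [← sq_abs d]; nlinarith
    nlinarith [abs_nonneg d]
set_option maxHeartbeats 1000000 in
lemma SUP {f : ℝ → ℝ} {W : Pl → ℝ} (h : HalfSol f W) (hf : ContDiff ℝ 2 f) {xa ta k q N r : ℝ} (hx1 : xa < 0) (sv : 0 < ta)
    (hr : 0 < r) (hN : 0 ≤ N) (hq : q + f k < 0)
    (H : ∀ x t, |x - xa| ≤ r → |t - ta| ≤ r → W (xa,ta) + k * (x - xa) + q * (t - ta) - N * ((x-xa)^2 + (t-ta)^2) ≤ W (x,t)) : False := by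
  obtain ⟨K, hW⟩ := h.lip
  obtain ⟨N0, hN0, HG⟩ : ∃ N0, 0 ≤ N0 ∧ ∀ x t, W (xa,ta) + k * (x - xa) + q * (t - ta) - N0 * ((sg (x-xa) - 1) + (sg (t-ta) - 1)) ≤ W (x,t) := by
    set st := min r 1
    have hr0 : 0 < st := lt_min hr one_pos
    have hr01 : st ≤ 1 := Mnr
    set S := |k| + |q| + 2 * (K:ℝ)
    have hS : 0 ≤ S := by positivity
    refine ⟨3 * N + 6 * S / st, by positivity, fun x t => ?_⟩
    have eb := sub_nonneg.2 (sq1_ge (x - xa))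
    have ea := sub_nonneg.2 (sq1_ge (t - ta))
    have ed : 0 ≤ 6 * S / st := by positivity
    by_cases hin : |x - xa| ≤ st ∧ |t - ta| ≤ st
    · have ic := H x t (hin.1.trans Mnl) (hin.2.trans Mnl)
      have ia := sq1_lo1 (hin.1.trans hr01)
      have ie := sq1_lo1 (hin.2.trans hr01)
      nlinarith [Pn ed (add_nonneg eb ea), Mll (add_le_add ia ie) hN]
    · have hlip := hW.dist_le_mul (x,t) (xa,ta)
      rw [Real.dist_eq] at hlip
      set m := dist (x,t) (xa,ta)
      have hm1 : |x - xa| ≤ m := by rw [← Real.dist_eq]; exact Mxl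
      have hm2 : |t - ta| ≤ m := by rw [← Real.dist_eq]; exact Mxr
      have hm : st * m / 3 ≤ (sg (x-xa) - 1) + (sg (t-ta) - 1) := by
        have hmm : m = max |x - xa| |t - ta| := by simp [m, Prod.dist_eq, Real.dist_eq]
        rw [hmm]
        have hr' : st < max |x - xa| |t - ta| := by
          by_contra hc; push Not at hc
          exact hin ⟨(Mxl).trans hc, (Mxr).trans hc⟩
        rcases max_choice |x - xa| |t - ta| with hh | hh <;> rw [hh] at hr' ⊢
        · have := sq1_lo2 hr01 hr'.le; linarith
        · have := sq1_lo2 hr01 hr'.le; linarith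
      have hm0 : 0 ≤ m := dist_nonneg
      have ic : 2 * (S * m) ≤ (6 * S / st) * ((sg (x-xa) - 1) + (sg (t-ta) - 1)) := by
        calc 2 * (S * m) = (6 * S / st) * (st * m / 3) := by field_simp; ring
          _ ≤ _ := Mll hm ed
      have ia : k * (x - xa) ≤ |k| * m := (le_abs_self _).trans (by rw [abs_mul]; gcongr)
      have ie : q * (t - ta) ≤ |q| * m := (le_abs_self _).trans (by rw [abs_mul]; gcongr)
      have i4 := (abs_le.1 hlip).1
      have i5 : 0 ≤ N * ((sg (x-xa) - 1) + (sg (t-ta) - 1)) := Pn hN (add_nonneg eb ea)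
      have i6 : 0 ≤ S * m := Pn hS hm0
      have i7 : S * m = |k| * m + |q| * m + 2 * (K * m) := by simp only [S]; ring
      have i8 : 0 ≤ K * m := by positivity
      have i9 : 0 ≤ |k| * m := by positivity
      have i10 : 0 ≤ |q| * m := by positivity
      nlinarith
  set na := N0 + 1
  set Φ : Pl → ℝ := fun p => W (xa,ta) + k * (p.1 - xa) + q * (p.2 - ta) - na * ((sg (p.1-xa) - 1) + (sg (p.2-ta) - 1)) with hΦ
  have tk : 0 ≤ na := by positivity
  have hΦlip : Lwz ((|k| + na) + (|q| + na)).toNNReal Φ := by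
    apply lip2 ps ps
    · intro x y t
      have e : Φ (x,t) - Φ (y,t) = k * (x - y) - na * (sg (x - xa) - sg (y - xa)) := by simp only [hΦ]; ring
      have ea := sq1_lip (x - xa) (y - xa)
      rw [sub_sub_sub_cancel_right] at ea
      rw [e]; refine (abs_sub _ _).trans ?_
      rw [abs_mul, abs_mul, Ai tk]; nlinarith [Mll ea tk]
    · intro x s t
      have e : Φ (x,s) - Φ (x,t) = q * (s - t) - na * (sg (s - ta) - sg (t - ta)) := by simp only [hΦ]; ring
      have ea := sq1_lip (s - ta) (t - ta)
      rw [sub_sub_sub_cancel_right] at ea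
      rw [e]; refine (abs_sub _ _).trans ?_
      rw [abs_mul, abs_mul, Ai tk]; nlinarith [Mll ea tk]
  have hsd : Differentiable ℝ sg := fun d => (sq1_hd d).differentiableAt
  have hΦd : Differentiable ℝ Φ := by
    have db : Differentiable ℝ (fun p : Pl => p.1 - xa) := differentiable_fst.sub_const _
    have dc : Differentiable ℝ (fun p : Pl => p.2 - ta) := differentiable_snd.sub_const _
    exact ((((db.const_mul k).const_add _).add (dc.const_mul q)).sub
      ((((hsd.comp db).sub_const 1).add ((hsd.comp dc).sub_const 1)).const_mul na))
  have hΦx : ∀ p : Pl, Dx Φ p = k - na * ((p.1 - xa) / sg (p.1 - xa)) := by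
    intro p
    refine (fd_of_slice_x (hΦd p)).unique ?_
    have db : HasDerivAt (fun x : ℝ => x - xa) 1 p.1 := (hasDerivAt_id _).sub_const _
    have := (((db.const_mul k).const_add (W (xa,ta))).add_const (q * (p.2 - ta))).sub (((((sq1_hd (p.1 - xa)).comp p.1 db).sub_const 1).add_const (sg (p.2 - ta) - 1)).const_mul na)
    simp only [mul_one] at this; exact this
  have hΦt : ∀ p : Pl, Dt Φ p = q - na * ((p.2 - ta) / sg (p.2 - ta)) := by
    intro p
    refine (fd_of_slice_t (hΦd p)).unique ?_
    have db : HasDerivAt (fun x : ℝ => x - ta) 1 p.2 := (hasDerivAt_id _).sub_const _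
    have := ((db.const_mul q).const_add (W (xa,ta) + k * (p.1 - xa))).sub (((((sq1_hd (p.2 - ta)).comp p.2 db).sub_const 1).const_add (sg (p.1 - xa) - 1)).const_mul na)
    simp only [mul_one] at this; exact this
  have hwb : ∀ p, |Dx W p| ≤ K * ‖exz‖ := fun p => fderiv_bdd hW p _
  set Lw := K * ‖exz‖
  obtain ⟨Λ, hΛ0, hΛ⟩ : ∃ Λ, 0 ≤ Λ ∧ ∀ w, |w| ≤ Lw → |f w - f k| ≤ Λ * |w - k| := by
    obtain ⟨C, sp, hC⟩ := bdd_on (hf.continuous_deriv nn) (Lw + |k|)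
    refine ⟨C, sp, fun w hw => ?_⟩
    have := (convex_Icc (-(Lw+|k|)) (Lw+|k|)).norm_image_sub_le_of_norm_deriv_le (f := f) (C := C) (fun z _ => C2_diff hf z)
      (fun z hz => hC z (abs_le.2 hz)) (x := k) (y := w) ?_ ?_
    · exact this
    · have hLw := (An).trans hw
      exact ⟨by linarith [neg_abs_le k], by linarith [le_abs_self k]⟩
    · exact abs_le.1 (by linarith [abs_nonneg k])
  set δ := -(q + f k) with hδ
  have hδ0 : 0 < δ := by simp only [hδ]; linarith
  obtain ⟨ρ, hρ0, hρ1, hρx, hρt, hρδ⟩ : ∃ ρ, 0 < ρ ∧ ρ ≤ 1 ∧ ρ < -xa/2 ∧ ρ < ta/2 ∧ na * ρ * (1 + Λ) ≤ δ / 2 := by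
    refine ⟨min (min 1 (-xa/4)) (min (ta/4) (δ / (2 * ((na+1) * (1 + Λ))))), ?_, ?_, ?_, ?_, ?_⟩
    · refine lt_min (lt_min one_pos ln) (lt_min ln ps)
    · exact (Mnl).trans Mnl
    · exact ((Mnl).trans Mnr).trans_lt ln
    · exact ((Mnr).trans Mnl).trans_lt ln
    · set ρ := min (min 1 (-xa/4)) (min (ta/4) (δ / (2 * ((na+1) * (1 + Λ))))) with hρ
      have sa : ρ ≤ δ / (2 * ((na+1) * (1 + Λ))) := (Mnr).trans Mnr
      have se : 0 < ρ := lt_min (lt_min one_pos ln) (lt_min ln ps)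
      rw [le_div_iff₀ ps] at sa
      nlinarith [Pn se.le hΛ0]
  set ε := ρ^2/3 with hε
  have hε0 : 0 < ε := by positivity
  set ψ : Pl → ℝ := fun p => max (Φ p + ε - W p) 0 with hψ
  have hψ0 : ∀ p, 0 ≤ ψ p := fun p => Mxr
  have hψs : ∀ p, ψ p ≠ 0 → |p.1 - xa| < ρ ∧ |p.2 - ta| < ρ := by
    intro p hp
    have hpos : 0 < Φ p + ε - W p := by
      by_contra hc; push Not at hc; exact hp (max_eq_right hc)
    have hg := HG p.1 p.2
    simp only [hΦ, na] at hpos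
    have eb := sub_nonneg.2 (sq1_ge (p.1 - xa))
    have ea := sub_nonneg.2 (sq1_ge (p.2 - ta))
    have ed : (sg (p.1-xa) - 1) + (sg (p.2-ta) - 1) < ε := by
      have : W (p.1,p.2) = W p := rfl
      linarith
    constructor
    · by_contra hc; push Not at hc
      have := sq1_lo2 hρ1 hc; nlinarith
    · by_contra hc; push Not at hc
      have := sq1_lo2 hρ1 hc; nlinarith
  have hψlip : ∃ K', Lwz K' ψ := ⟨_, ((hΦlip.add (LipschitzWith.const ε)).sub hW).max_const 0⟩
  obtain ⟨Kψ, hψl⟩ := hψlip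
  have hψK : ∀ p, p ∉ Metric.closedBall (xa,ta) ρ → ψ p = 0 := by
    intro p hp; by_contra hne
    apply hp
    have := hψs p hne
    rw [Metric.mem_closedBall, Prod.dist_eq, Re, Real.dist_eq]
    exact max_le this.1.le this.2.le
  have hψc : Hcs ψ := HasCompactSupport.intro (isCompact_closedBall _ _) hψK
  have hk := kru_lip h hf.continuous k hψl hψc hψ0 (δ := min (-xa/2) (ta/2)) (lt_min ln ln) (by
    intro p hp; by_contra hne
    obtain ⟨aa, ab⟩ := hψs p hne
    rw [abs_lt] at aa ab
    have := min_le_left (-xa/2) (ta/2); have := min_le_right (-xa/2) (ta/2)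
    rcases hp with hp | hp <;> linarith)
  have hpt : ∀ᵐ p : Pl, ψ p ≠ 0 → kint f W k ψ p ≤ -(δ/2) * |Dx W p - k| ∧
      (Dx W p = k → Dt ψ p ≤ -(δ/2)) := by
    filter_upwards [h.hj, hW.ae_differentiableAt] with p sa h2 hp
    obtain ⟨aa, ab⟩ := hψs p hp
    have a1' := abs_lt.1 aa; have a2' := abs_lt.1 ab
    have hwt := sa ln ln
    have hpos : 0 < Φ p + ε - W p := by
      by_contra hc; push Not at hc; exact hp (max_eq_right hc)
    have hev : ψ =ᶠ[nhds p] fun z => Φ z + ε - W z := by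
      have hcn : Continuous (fun z => Φ z + ε - W z) := (hΦd.continuous.add cst).sub hW.continuous
      filter_upwards [hcn.continuousAt.eventually (lt_mem_nhds hpos)] with z hz
      exact max_eq_left (le_of_lt hz)
    have hfd : ∀ v, fderiv ℝ ψ p v = fderiv ℝ Φ p v - fderiv ℝ W p v := by
      intro v
      rw [hev.fderiv_eq, fderiv_fun_sub ((hΦd p).add_const _) h2, fderiv_add_const]; rfl
    set w := Dx W p with hw
    have bb : |na * ((p.1 - xa) / sg (p.1 - xa))| ≤ na * ρ := by
      rw [abs_mul, Ai tk]; exact Mll ((sq1_d _).trans aa.le) tk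
    have bd : |na * ((p.2 - ta) / sg (p.2 - ta))| ≤ na * ρ := by
      rw [abs_mul, Ai tk]; exact Mll ((sq1_d _).trans ab.le) tk
    constructor
    · unfold kint
      rw [hfd, hfd, hΦx, hΦt, hwt, ← hw]
      set X := na * ((p.1 - xa) / sg (p.1 - xa))
      set Y := na * ((p.2 - ta) / sg (p.2 - ta))
      have ca : |w - k| * (q - Y - -f w) + Real.sign (w-k) * (f w - f k) * (k - X - w) =
          |w - k| * (-δ - Y) - Real.sign (w-k) * (f w - f k) * X := by
        rw [← sign_mul_self' (w - k), hδ]; ring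
      rw [ca]
      have c2 : -(Real.sign (w-k) * (f w - f k) * X) ≤ Λ * |w - k| * (na * ρ) := by
        refine (neg_le_abs _).trans ?_
        rw [abs_mul, abs_mul]
        have := mul_le_mul (mul_le_mul (sgn_abs (w - k)) (hΛ w (hwb p)) An zero_le_one) bb An ps
        linarith
      have cb : |w - k| * (-Y) ≤ |w - k| * (na * ρ) := Mll ((neg_le_abs _).trans bd) An
      nlinarith [Mll hρδ (abs_nonneg (w - k))]
    · intro hwk
      rw [hfd, hΦt, hwt, hwk]
      have := (abs_le.1 bd).1
      have : 0 ≤ na * ρ * Λ := by positivity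
      linarith
  obtain ⟨ma, mb, M, bb, bd⟩ := kint_PQ hf.continuous hW k
  have hfz : ∀ p, ψ p = 0 → fderiv ℝ ψ p = 0 := fun p hp => fd_min hψ0 hp
  have hkint : Integrable (kint f W k ψ) := by
    refine int_cs ((ma.mul (meas_fd _)).add (mb.mul (meas_fd _))) (M := M * (Kψ * ‖et‖) + M * (Kψ * ‖exz‖)) ?_ (isCompact_closedBall (xa,ta) ρ) ?_
    · intro p
      have sw : 0 ≤ M := (An).trans (bb p)
      refine (abs_add_le _ _).trans (add_le_add ?_ ?_) <;> rw [abs_mul]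
      · exact mul_le_mul (bb p) (fderiv_bdd hψl p _) An sw
      · exact mul_le_mul (bd p) (fderiv_bdd hψl p _) An sw
    · intro p hp; simp [kint, hfz p (hψK p hp)]
  have hz : kint f W k ψ =ᵐ[volume] 0 := by
    have hle : ∀ᵐ p : Pl, 0 ≤ (-kint f W k ψ) p := by
      filter_upwards [hpt] with p hp
      by_cases se : ψ p = 0
      · simp [kint, hfz p se]
      · have := (hp se).1
        have sd : 0 ≤ (δ/2) * |Dx W p - k| := by positivity
        simp only [Pi.neg_apply]; linarith
    have hi : ∫ p, (-kint f W k ψ) p = 0 := by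
      apply le_antisymm
      · simp only [Pi.neg_apply]; rw [integral_neg]; linarith
      · exact integral_nonneg_of_ae hle
    have := (integral_eq_zero_iff_of_nonneg_ae hle hkint.neg).1 hi
    filter_upwards [this] with p hp
    simpa using hp
  have hneg : ∀ᵐ p : Pl, ψ p ≠ 0 → Dt ψ p ≤ -(δ/2) := by
    filter_upwards [hpt, hz] with p sa h2 hp
    apply (sa hp).2
    have sd := (sa hp).1
    rw [h2] at sd
    simp only [Pi.zero_apply] at sd
    have : |Dx W p - k| ≤ 0 := by
      by_contra hc; push Not at hc; nlinarith
    exact sub_eq_zero.1 (abs_nonpos_iff.1 this)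
  have hint0 : ∫ p, Dt ψ p = 0 := by
    have := LipschitzWith.integral_lineDeriv_mul_eq (μ := (volume : Measure (Pl))) (LipschitzWith.const so) hψl hψc (0,-1)
    simp only [mul_one] at this
    have se : (fun x : Pl => lineDeriv ℝ (fun _ : Pl => so) x (0,-1) * ψ x) = fun _ => 0 := by
      funext x; simp [lineDeriv]
    rw [se, integral_zero] at this
    refine Eq.trans ?_ this.symm
    apply integral_congr_ae
    filter_upwards [hψl.ae_differentiableAt] with p hp
    have e : (-(0,-1) : Pl) = (0,1) := by ext <;> simp
    rw [hp.lineDeriv_eq_fderiv, e]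
  have hdi : Integrable (fun p => Dt ψ p) :=
    int_cs (meas_fd _) (fun p => fderiv_bdd hψl p _) (isCompact_closedBall (xa,ta) ρ) (fun p hp => by simp [hfz p (hψK p hp)])
  have hle : ∀ᵐ p : Pl, 0 ≤ (fun p => -Dt ψ p) p := by
    filter_upwards [hneg] with p hp
    by_cases se : ψ p = 0
    · simp [hfz p se]
    · exact neg_nonneg.2 ((hp se).trans ln)
  have hz2 := (integral_eq_zero_iff_of_nonneg_ae hle hdi.neg).1 ((integral_neg _).trans (by rw [hint0, neg_zero]))
  have hz3 : ∀ᵐ p : Pl, p ∉ {p | ψ p ≠ 0} := by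
    filter_upwards [hz2, hneg] with p sa h2 sd
    have := h2 sd
    have h1' : -Dt ψ p = 0 := sa
    linarith
  have hopen : IsOpen {p | ψ p ≠ 0} := isOpen_ne_fun hψl.continuous cst
  have hmem : (xa,ta) ∈ {p | ψ p ≠ 0} := by
    have : ψ (xa,ta) = ε := by
      have tt : sg 0 = 1 := by simp [sg]
      have e : Φ (xa,ta) = W (xa,ta) := by
        show W (xa,ta) + k * (xa - xa) + q * (ta - ta) - na * ((sg (xa-xa) - 1) + (sg (ta-ta) - 1)) = _
        rw [sub_self, sub_self, tt]; ring
      show max (Φ (xa,ta) + ε - W (xa,ta)) 0 = ε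
      rw [e, add_sub_cancel_left, max_eq_left hε0.le]
    show ψ (xa,ta) ≠ 0
    rw [this]; exact hε0.ne'
  exact (hopen.measure_pos volume ⟨_, hmem⟩).ne' (measure_eq_zero_iff_ae_notMem.2 hz3)
lemma HalfSol.upx {a E R : ℝ} {f : ℝ → ℝ} {W : Pl → ℝ} (h : HalfSol f W) {K : NNReal} (hK : Lwz K W)
    (ad : Adm a f E R) (hKR : K ≤ R) {xa ta x2 t2 : ℝ} (hx1 : xa < 0) (hx2 : x2 < 0) (sv : 0 < ta) (ht2 : 0 < t2) :
    W (x2,t2) ≤ W (xa,ta) + cc f E (t2-ta) (x2-xa) := by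
  set m := min (min (-xa) (-x2)) (min ta t2)
  have hm : 0 < m := lt_min (lt_min ln ln) (lt_min sv ht2)
  refine le_of_forall_pos_le_add fun ε hε => ?_
  obtain ⟨j, hj⟩ := exists_nat_one_div_lt (lt_min hm (show 0 < ε / (2 * (K + 1)) by positivity))
  have hj1 := hj.trans_le Mnl
  have hj2 := (hj.trans_le Mnr).le
  rw [le_div_iff₀ ps] at hj2
  have hj0 : 0 < ι j := by positivity
  have ca := abs_le.1 (moll_close hK j (xa,ta))
  have c2 := abs_le.1 (moll_close hK j (x2,t2))
  set v : Pl := (x2-xa,t2-ta)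
  have hd : Differentiable ℝ (moll j W) := (moll_contDiff j hK.continuous 1).differentiable nn
  set g : ℝ → ℝ := fun s => moll j W ((xa,ta) + s • v)
  have hg : ∀ s, HasDerivAt g (fderiv ℝ (moll j W) ((xa,ta) + s • v) v) s := by
    intro s
    have sa : HasDerivAt (fun s : ℝ => (xa,ta) + s • v) v s := by
      simpa using ((hasDerivAt_id s).smul_const v).const_add (xa,ta)
    exact (hd _).hasFDerivAt.comp_hasDerivAt s sa
  have hb : ∀ s ∈ Icc sf 1, fderiv ℝ (moll j W) ((xa,ta) + s • v) v ≤ cc f E (t2-ta) (x2-xa) := by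
    intro s hs
    apply moll_fderiv_le hK
    filter_upwards [h.hj] with q hq hn
    have nb := (norm_fst_le (q - ((xa,ta) + s • v))).trans_lt hn
    have nd := (norm_snd_le (q - ((xa,ta) + s • v))).trans_lt hn
    simp only [Prod.fst_sub, Prod.snd_sub, Prod.fst_add, Prod.snd_add, Prod.smul_fst, Prod.smul_snd, smul_eq_mul, Ra, v] at nb nd
    have ma : m ≤ -xa := (Mnl).trans Mnl
    have mb : m ≤ -x2 := (Mnl).trans Mnr
    have m3 : m ≤ ta := (Mnr).trans Mnl
    have m4 : m ≤ t2 := (Mnr).trans Mnr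
    have q1 : q.1 < 0 := by
      have := (abs_lt.1 nb).2
      nlinarith [hs.1, hs.2, Pn hs.1 (sub_nonneg.2 mb), Pn (sub_nonneg.2 hs.2) (sub_nonneg.2 ma)]
    have q2 : 0 < q.2 := by
      have := (abs_lt.1 nd).1
      nlinarith [hs.1, hs.2, Pn hs.1 (sub_nonneg.2 m4), Pn (sub_nonneg.2 hs.2) (sub_nonneg.2 m3)]
    have e : v = (x2-xa) • exz + (t2-ta) • et := by ext <;> simp [v]
    rw [e, map_add, map_smul, map_smul, hq q1 q2, smul_eq_mul, smul_eq_mul]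
    have hw : f Dx W q ≤ E := ad.hE _ ((fderiv_bdd hK q _).trans (by simpa [Prod.norm_def] using hKR))
    have := ad.ge (t2-ta) (x2-xa) hw
    linarith
  have hmv := (convex_Icc sf 1).image_sub_le_mul_sub_of_deriv_le (f := g) (fun s _ => (hg s).continuousAt.continuousWithinAt)
    (fun s _ => (hg s).differentiableAt.differentiableWithinAt) (C := cc f E (t2-ta) (x2-xa))
    (fun s hs => by rw [(hg s).deriv]; exact hb s (interior_subset hs)) 0 (by simp) 1 (by simp) zero_le_one
  have g0 : g 0 = moll j W (xa,ta) := by simp [g]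
  have ga : g 1 = moll j W (x2,t2) := by simp [g, v]
  rw [g0, ga] at hmv
  nlinarith [ca.1, ca.2, c2.1, c2.2]
lemma HalfSol.up {a E R : ℝ} {f : ℝ → ℝ} {W : Pl → ℝ} (h : HalfSol f W) {K : NNReal} (hK : Lwz K W)
    (ad : Adm a f E R) (hKR : K ≤ R) {xa ta x2 t2 : ℝ} (hx1 : xa ≤ 0) (hx2 : x2 ≤ 0) (sv : 0 ≤ ta) (ht2 : 0 ≤ t2) :
    W (x2,t2) ≤ W (xa,ta) + cc f E (t2-ta) (x2-xa) := by
  have hs : ∀ x t : ℝ, Tendsto (fun ε : ℝ => W (x-ε,t+ε)) (nhdsWithin 0 (Ioi 0)) (nhds (W (x,t))) := by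
    intro x t
    have : Continuous (fun ε : ℝ => W (x-ε,t+ε)) := hK.continuous.comp (by fun_prop)
    simpa using (this.tendsto 0).mono_left nhdsWithin_le_nhds
  refine le_of_tendsto_of_tendsto (hs x2 t2) ((hs xa ta).add_const _) ?_
  filter_upwards [self_mem_nhdsWithin] with ε hε
  have hε : 0 < ε := hε
  have := h.upx hK ad hKR (xa := xa - ε) (x2 := x2 - ε) (ta := ta + ε) (t2 := t2 + ε) ln ln ln ln
  simpa using this
set_option maxHeartbeats 1000000 in
lemma HalfSol.HL {a E R : ℝ} {f : ℝ → ℝ} {W : Pl → ℝ} (h : HalfSol f W) {K : NNReal} (hK : Lwz K W)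
    (ad : Adm a f E R) (hKR : K < R) {xb td : ℝ} (xd : xb < 0) (tq : 0 < td) :
    (∃ y ≤ 0, W (y,0) + cc f E td (xb-y) ≤ W (xb,td)) ∨ ∃ τ, 0 ≤ τ ∧ τ < td ∧ W (0,τ) + cc f E (td-τ) xb ≤ W (xb,td) := by
  by_contra hcon
  push Not at hcon
  obtain ⟨hc1, hc2⟩ := hcon
  set wa := W (xb,td)
  set G : Pl → ℝ := fun p => W p + cc f E (td - p.2) (xb - p.1) with hG
  have hGc : Continuous G := hK.continuous.add (ad.continuous.comp (by fun_prop : Continuous fun p : Pl => (td - p.2, xb - p.1)))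
  set C := (K + |E|) * td + 1 with hC
  have sp : 0 < C := by positivity
  have hGlow : ∀ x t, 0 ≤ t → t ≤ td → wa + (R - K) * |x - xb| - C + 1 ≤ G (x,t) := by
    intro x t sa h2
    have eb := ad.coer' (td - t) (xb - x)
    have ea := (abs_le.1 ((Re _ _).symm.trans_le (hK.dist_le_mul (x,t) (xb,td)))).1
    have ed : dist (x,t) (xb,td) ≤ |x - xb| + td := by
      rw [Prod.dist_eq, Re, Re, abs_sub_comm t td, Ai (by linarith : 0 ≤ td - t)]
      exact max_le ln (by linarith [abs_nonneg (x - xb)])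
    have ef := Mll ed K.2
    have ej : E * (td - t) ≤ |E| * td := (Mlr (le_abs_self E) ln).trans (Mll ln An)
    rw [abs_sub_comm xb x] at eb
    simp only [hG, hC]
    have e6 : (↑K : ℝ) * (|x - xb| + td) = K * |x - xb| + K * td := by ring
    have e7 : ((K:ℝ) + |E|) * td = K * td + |E| * td := by ring
    simp only [NNReal.val_eq_coe] at ef
    nlinarith
  set X := C / (R - K) + |xb| + 1
  have hRK : 0 < R - K := sub_pos.2 hKR
  have hX0 : 0 < X := by positivity
  have hfar : ∀ x t, 0 ≤ t → t ≤ td → x ≤ 0 → x < xb - X → wa + 1 ≤ G (x,t) := by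
    intro x t sa h2 sd si
    have := hGlow x t sa h2
    have sm : X ≤ |x - xb| := by rw [abs_sub_comm]; exact (le_of_lt ln).trans (le_abs_self _)
    have sx : C ≤ (R - K) * |x - xb| := by
      have : C = (R - K) * (C / (R-K)) := by field_simp
      rw [this]; apply Mll _ hRK.le
      refine le_trans ?_ sm; simp only [X]; linarith [abs_nonneg xb]
    linarith
  obtain ⟨δ, hδ0, hδ1, tv, hb2⟩ : ∃ δ, 0 < δ ∧ δ ≤ 1 ∧ (∀ y ≤ 0, wa + δ ≤ G (y,0)) ∧ ∀ τ, 0 ≤ τ → τ ≤ td → wa + δ ≤ G (0,τ) := by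
    obtain ⟨su, hy1, hm1⟩ := (isCompact_Icc (a := xb - X) (b := 0)).exists_isMinOn ⟨0, by constructor <;> linarith⟩
      (hGc.comp (by fun_prop : Continuous fun y : ℝ => (y,sf))).continuousOn
    obtain ⟨xe, hτ1, hm2⟩ := (isCompact_Icc (a := 0) (b := td)).exists_isMinOn ⟨0, by constructor <;> linarith⟩
      (hGc.comp (by fun_prop : Continuous fun y : ℝ => (sf,y))).continuousOn
    have p1 : wa < G (su,0) := by have := hc1 su hy1.2; simpa [hG] using this
    have p2 : wa < G (0,xe) := by
      rcases hτ1.2.lt_or_eq with hlt | heq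
      · have := hc2 xe hτ1.1 hlt; simpa [hG] using this
      · have eb := ad.coer' 0 xb
        have ea := (abs_le.1 ((Re _ _).symm.trans_le (hK.dist_le_mul (0,td) (xb,td)))).1
        have ed : dist (sf,td) (xb,td) = |xb| := by simp [Prod.dist_eq, Real.dist_eq]
        rw [ed] at ea
        have : 0 < |xb| := abs_pos.2 xd.ne
        simp only [hG, heq, sub_self, sub_zero]
        nlinarith
    refine ⟨min 1 (min (G (su,0) - wa) (G (0,xe) - wa)), lt_min one_pos (lt_min ln ln), Mnl, ?_, ?_⟩
    · intro y hy
      rcases lt_or_ge y (xb - X) with sa | sa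
      · have := hfar y 0 le_rfl tq.le hy sa
        have := min_le_left so (min (G (su,0) - wa) (G (0,xe) - wa)); linarith
      · have ic : G (su,0) ≤ G (y,0) := hm1 ⟨sa, hy⟩
        have := (min_le_right so (min (G (su,0) - wa) (G (0,xe) - wa))).trans Mnl; linarith
    · intro τ sa h2
      have ic : G (0,xe) ≤ G (0,τ) := hm2 ⟨sa, h2⟩
      have := (min_le_right so (min (G (su,0) - wa) (G (0,xe) - wa))).trans Mnr; linarith
  obtain ⟨s, hs0, hs1, hs2⟩ : ∃ s, 0 < s ∧ s < td ∧ G (xb,td - s) ≤ wa + δ/3 := by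
    have hc : Continuous (fun s : ℝ => G (xb,td-s)) := hGc.comp (by fun_prop)
    have se : G (xb,td-0) < wa + δ/3 := by simp [hG, ad.zero, wa]; linarith
    have hev : ∀ᶠ s in nhdsWithin sf (Ioi 0), G (xb,td-s) < wa + δ/3 := nhdsWithin_le_nhds (hc.continuousAt.eventually (gt_mem_nhds se))
    obtain ⟨s, sa, h2⟩ := (hev.and (Ioo_mem_nhdsGT tq : ∀ᶠ s in nhdsWithin sf (Ioi 0), s ∈ Ioo 0 td)).exists
    exact ⟨s, h2.1, h2.2, sa.le⟩
  set η := s * δ / 3 with hη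
  have hη0 : 0 < η := by positivity
  set H : Pl → ℝ := fun p => G p + η / (td - p.2) with hH
  have hHs : H (xb,td-s) ≤ wa + 2*δ/3 := by
    simp only [hH]
    have : η / (td - (td - s)) = δ/3 := by rw [sub_sub_cancel, hη]; field_simp
    rw [this]; linarith
  set ε := min (η / (C + 1)) s with hε
  have hε0 : 0 < ε := lt_min ps hs0
  have hεs : ε ≤ s := Mnr
  have hHG : ∀ x t, t < td → G (x,t) ≤ H (x,t) := by
    intro x t ht; simp only [hH]; have : 0 ≤ η / (td - t) := div_nonneg hη0.le ln
    linarith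
  have hHt : ∀ x t, 0 ≤ t → t < td → td - ε < t → wa + 1 ≤ H (x,t) := by
    intro x t sa h2 sd
    have ic := hGlow x t sa h2.le
    have ia : C + 1 ≤ η / (td - t) := by
      rw [le_div_iff₀ ln]
      have : ε ≤ η / (C+1) := Mnl
      rw [le_div_iff₀ ps] at this
      nlinarith
    have ie : 0 ≤ (R-K) * |x - xb| := by positivity
    simp only [hH]; linarith
  obtain ⟨Z1, hZ1, hmin⟩ := ((isCompact_Icc (a := xb - X) (b := 0)).prod (isCompact_Icc (a := 0) (b := td - ε))).exists_isMinOn (f := H)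
    ⟨(xb,td-s), ⟨⟨by linarith, by linarith⟩, ⟨by simp only; linarith, by simp only; linarith⟩⟩⟩ (by
      refine hGc.continuousOn.add (continuousOn_const.div (by fun_prop) ?_)
      rintro p ⟨_, hp⟩; have := hp.2; linarith)
  obtain ⟨xa, ta⟩ := Z1
  obtain ⟨⟨hx1a, hx1b⟩, ⟨ht1a, ht1b⟩⟩ := hZ1
  simp only at hx1a hx1b ht1a ht1b
  have hval : H (xa,ta) ≤ wa + 2*δ/3 := le_trans (hmin (⟨⟨by simp only; linarith, by simp only; linarith⟩, ⟨by simp only; linarith, by simp only; linarith⟩⟩ : (xb,td-s) ∈ Icc (xb - X) 0 ×ˢ Icc 0 (td - ε))) hHs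
  have hglob : ∀ x t, x ≤ 0 → 0 ≤ t → t < td → H (xa,ta) ≤ H (x,t) := by
    intro x t sa h2 sd
    rcases lt_or_ge x (xb - X) with si | si
    · have := hfar x t h2 sd.le sa si; have := hHG x t sd; linarith
    rcases lt_or_ge (td - ε) t with sm | sm
    · have := hHt x t h2 sd sm; linarith
    · exact hmin (⟨⟨si, sa⟩, ⟨h2, sm⟩⟩ : (x,t) ∈ Icc (xb - X) 0 ×ˢ Icc 0 (td - ε))
  have ht1t : ta < td := by linarith
  have hx1 : xa < 0 := by
    refine lt_of_le_of_ne hx1b fun se => ?_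
    have := hb2 ta ht1a ht1t.le; have := hHG xa ta ht1t; rw [se] at this hval; linarith
  have sv : 0 < ta := by
    refine lt_of_le_of_ne ht1a fun se => ?_
    have := tv xa hx1b; have := hHG xa ta ht1t; rw [← se] at this hval; linarith
  set S := td - ta with hS
  have hS0 : 0 < S := sub_pos.2 ht1t
  obtain ⟨k, hk1, hk2, hk3⟩ := ad.argmax S (xb - xa)
  obtain ⟨Λ, hΛ0, -, hΛ⟩ := ad.lipf
  have ha := ad.ha
  refine SUP h ad.C2 (k := k) (q := - f k - η / S^2) (N := 2 * (1+Λ^2) / (2*a*S) + 2 * η / S^3) (r := min (S/2) (min (-xa) ta)) hx1 sv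
    (lt_min ln (lt_min ln sv)) ps (by linarith [show 0 < η / S^2 by positivity]) ?_
  intro x t hx ht
  have xf := abs_le.1 (ht.trans Mnl)
  have r2 := abs_le.1 (hx.trans ((Mnr).trans Mnl))
  have r3 := abs_le.1 (ht.trans ((Mnr).trans Mnr))
  have hg := hglob x t ln ln ln
  simp only [hH, hG] at hg
  rw [← hS, hk2] at hg
  have hq := ad.quad (sl := td - t) (da := xb - x) hS0 hk1 hk3 hΛ
  have eb : (|xb - x - (xb - xa)| + Λ * |td - t - S|)^2 / (2*a*S) ≤ 2 * (1+Λ^2) / (2*a*S) * ((x-xa)^2 + (t-ta)^2) := by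
    rw [div_mul_eq_mul_div]
    apply div_le_div_of_nonneg_right _ ps
    have ic : |xb - x - (xb - xa)| = |x - xa| := by rw [abs_sub_comm]; congr 1; ring
    have ia : |td - t - S| = |t - ta| := by rw [abs_sub_comm]; congr 1; simp only [hS]; ring
    rw [ic, ia, ← sq_abs (x - xa), ← sq_abs (t - ta)]
    nlinarith [sq_nonneg (|x - xa| - Λ * |t-ta|), sq_nonneg (|t-ta|), sq_nonneg (Λ * |x - xa|)]
  have ea : η / (td - t) - η / S ≤ η / S^2 * (t - ta) + 2 * η / S^3 * (t-ta)^2 := by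
    set z := t - ta
    have i0 : td - t = S - z := by simp only [hS, z]; ring
    have ie : 0 < S - z := by linarith
    rw [i0]
    have : η / S^2 * z + 2 * η / S^3 * z^2 - (η / (S - z) - η / S) = η * z^2 * (S - 2 * z) / (S^3 * (S - z)) := by
      field_simp; ring
    have si : 0 ≤ η * z^2 * (S - 2 * z) / (S^3 * (S - z)) := by
      have : 0 ≤ S - 2 * z := by linarith
      positivity
    linarith
  have ed : 0 ≤ 2 * η / S^3 * (x-xa)^2 := by positivity
  have ef : f k * (td - t) = f k * S - f k * (t - ta) := by simp only [hS]; ring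
  linarith
def Leg (fl fr : ℝ → ℝ) (E s y e : ℝ) : Prop := (y ≤ 0 ∧ e = cc fl E s (-y)) ∨ (0 ≤ y ∧ e = cc fr E s (-y))
def Cost (fl fr : ℝ → ℝ) (E γ T y x e : ℝ) : Prop :=
  (x ≤ 0 ∧ y ≤ 0 ∧ e = cc fl E T (x-y)) ∨ (0 ≤ x ∧ 0 ≤ y ∧ e = cc fr E T (x-y)) ∨
  ∃ σ τ eb ea, 0 ≤ σ ∧ σ ≤ τ ∧ τ ≤ T ∧ Leg fl fr E σ y eb ∧ Leg fr fl E (T-τ) (-x) ea ∧ e = eb - γ * (τ - σ) + ea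
lemma Cost.refl {fl fr : ℝ → ℝ} {E γ T y x e : ℝ} (h : Cost fl fr E γ T y x e) : Cost fr fl E γ T (-x) (-y) e := by
  rcases h with ⟨sa, h2, sd⟩ | ⟨sa, h2, sd⟩ | ⟨σ, τ, eb, ea, sa, h2, sd, si, sm, sx⟩
  · exact Or.inr (Or.inl ⟨by linarith, by linarith, by rw [sd]; congr 1; ring⟩)
  · exact Or.inl ⟨by linarith, by linarith, by rw [sd]; congr 1; ring⟩
  · exact Or.inr (Or.inr ⟨T - τ, T - σ, ea, eb, by linarith, by linarith, by linarith, sm, by rw [neg_neg, sub_sub_cancel]; exact si, by rw [sx]; ring⟩)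
lemma adm_ex {a : ℝ} {f : ℝ → ℝ} (ha : 0 < a) (C2 : ContDiff ℝ 2 f) (h2 : ∀ w, a ≤ deriv (deriv f) w) {R : ℝ} (hR : 0 < R) : ∃ ee, ∀ E, ee ≤ E → Adm a f E R := by
  obtain ⟨C, _, hC⟩ := bdd_on C2.continuous R
  exact ⟨C, fun E hE => ⟨ha, C2, h2, hR, fun k hk => ((le_abs_self _).trans (hC k hk)).trans hE⟩⟩
namespace HalfSol
variable {a E R : ℝ} {f : ℝ → ℝ} {W : Pl → ℝ} {K : NNReal}
lemma goodcl (hK : Lwz K W) (ad : Adm a f E R) (hKR : K < R) (T : ℝ) :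
    IsCompact {p : Pl | p ∈ Icc (-1) 0 ×ˢ Icc 0 T ∧ ∃ y ≤ 0, W (y,0) + cc f E p.2 (p.1-y) ≤ W p} := by
  have hRK : 0 < R - K := sub_pos.2 hKR
  set X := 1 + (|E| + K) * |T| / (R-K)
  have hcl : IsCompact ((Icc (-1:ℝ) 0 ×ˢ Icc 0 T) ×ˢ Icc (-X) 0 ∩ {q : (Pl) × ℝ | W (q.2,0) + cc f E q.1.2 (q.1.1 - q.2) ≤ W q.1}) := by
    apply IsCompact.inter_right ((isCompact_Icc.prod isCompact_Icc).prod isCompact_Icc)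
    refine isClosed_le ((hK.continuous.comp (by fun_prop)).add ?_) (hK.continuous.comp continuous_fst)
    exact ad.continuous.comp (by fun_prop : Continuous fun q : (Pl) × ℝ => (q.1.2, q.1.1 - q.2))
  convert hcl.image continuous_fst using 1
  ext ⟨x,t⟩
  simp only [mem_ofPred_eq, mem_image, mem_inter_iff, Prod.exists, exists_and_right, exists_eq_right, mem_prod]
  constructor
  · rintro ⟨sa, y, hy, h2⟩
    refine ⟨y, ⟨sa, ?_, hy⟩, h2⟩
    have eb := ad.coer' t (x - y)
    have ea := (abs_le.1 ((Re _ _).symm.trans_le (hK.dist_le_mul (x,t) (y,0)))).2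
    have ed : dist (x,t) (y,0) ≤ |x - y| + T := by
      rw [Prod.dist_eq, Re, Re, sub_zero, Ai sa.2.1]
      exact max_le (by linarith [sa.2.1, sa.2.2]) (by linarith [abs_nonneg (x - y), sa.2.2])
    have ef := Mll ed K.coe_nonneg
    have hT : 0 ≤ T := sa.2.1.trans sa.2.2
    have ej : E * t ≤ |E| * T := (Mlr (le_abs_self E) sa.2.1).trans (Mll sa.2.2 An)
    have e6 : |x - y| ≤ (|E| + K) * |T| / (R-K) := by
      rw [le_div_iff₀ hRK, Ai hT]; nlinarith
    have := le_abs_self (x - y)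
    simp only [X]; linarith [sa.1.1]
  · rintro ⟨y, ⟨sa, h2⟩, sd⟩
    exact ⟨sa, y, h2.2, sd⟩
lemma igood (h : HalfSol f W) (hK : Lwz K W) (ad : Adm a f E R) (hKR : K < R) {θ : ℝ} (hθ : deriv f θ = 0)
    {τ w : ℝ} (hτ : 0 < τ) (hd : HasDerivWithinAt (fun y => W (y,τ)) w (Iic 0) 0) (hw : θ < w) :
    ∃ y ≤ 0, W (y,0) + cc f E τ (-y) ≤ W (0,τ) := by
  have hfr : ∀ᶠ x in nhdsWithin sf (Iio 0), (x,τ) ∈ {p : Pl | p ∈ Icc (-1) 0 ×ˢ Icc 0 τ ∧ ∃ y ≤ 0, W (y,0) + cc f E p.2 (p.1-y) ≤ W p} := by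
    have hd' := hd.mono Iio_subset_Iic_self
    rw [hasDerivWithinAt_iff_tendsto_slope' (by simp)] at hd'
    filter_upwards [hd'.eventually (lt_mem_nhds hw), Ioo_mem_nhdsLT (show (-1:ℝ) < 0 by norm_num)] with x sa h2
    refine ⟨⟨⟨h2.1.le, h2.2.le⟩, hτ.le, le_rfl⟩, ?_⟩
    rcases h.HL hK ad hKR h2.2 hτ with sd | ⟨tb, si, sm, sx⟩
    · exact sd
    exfalso
    have sz := h.up hK ad hKR.le (xa := 0) (x2 := 0) (ta := tb) (t2 := τ) le_rfl le_rfl si hτ.le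
    rw [sub_zero, ad.cc_zero hθ ln] at sz
    have tm := ad.ge (τ - tb) x (ad.theta_mem hθ)
    rw [slope_def_field, lt_div_iff_of_neg (by linarith [h2.2])] at sa
    nlinarith
  have hcl := (goodcl hK ad hKR τ).isClosed
  have := hcl.mem_of_tendsto (((continuous_id.prodMk cst).tendsto sf).mono_left nhdsWithin_le_nhds) hfr
  simpa using this.2
end HalfSol
namespace ABSol
variable {fl fr : ℝ → ℝ} {A B : ℝ} {ua : ℝ → ℝ}
lemma rep {a γ θl θr : ℝ} (hc : Conn a fl fr A B γ θl θr) (sol : ABSol fl fr A B ua) : ∃ ee, ∀ E, ee ≤ E →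
    ∀ T, 0 < T → (∀ y x e, Cost fl fr E γ T y x e → sol.pot (x,T) ≤ sol.pot (y,0) + e) ∧
      ∀ x, ∃ y e, Cost fl fr E γ T y x e ∧ sol.pot (y,0) + e ≤ sol.pot (x,T) := by
  have hL := sol.half_l hc.Cl.continuous hc.Cr.continuous
  have hR := sol.half_r hc.Cl.continuous hc.Cr.continuous
  obtain ⟨K1, hK1⟩ := hL.lip
  obtain ⟨K2, hK2⟩ := hR.lip
  set R : ℝ := K1 + K2 + 1
  have hR0 : 0 < R := by positivity
  have la : (K1:ℝ) < R := by simp only [R]; linarith [K2.coe_nonneg]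
  have l2 : (K2:ℝ) < R := by simp only [R]; linarith [K1.coe_nonneg]
  obtain ⟨eg, hE1⟩ := adm_ex hc.ha hc.Cl hc.l2 hR0
  obtain ⟨eh, hE2⟩ := adm_ex hc.ha hc.Cr hc.r2 hR0
  refine ⟨max eg eh, fun E hE => ?_⟩
  have al := hE1 E ((Mxl).trans hE)
  have ar := hE2 E ((Mxr).trans hE)
  have arn := ar.neg
  have upl : ∀ {xa ta x2 t2 : ℝ}, xa ≤ 0 → x2 ≤ 0 → 0 ≤ ta → 0 ≤ t2 → sol.pot (x2,t2) ≤ sol.pot (xa,ta) + cc fl E (t2-ta) (x2-xa) :=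
    fun sa h2 sd si => hL.up hK1 al la.le sa h2 sd si
  have upr : ∀ {xa ta x2 t2 : ℝ}, 0 ≤ xa → 0 ≤ x2 → 0 ≤ ta → 0 ≤ t2 → sol.pot (x2,t2) ≤ sol.pot (xa,ta) + cc fr E (t2-ta) (x2-xa) := by
    intro xa ta x2 t2 sa h2 sd si
    have := hR.up hK2 arn l2.le (xa := -xa) (x2 := -x2) ln ln sd si
    rw [ar.neg_cc] at this
    simpa [rfl2_ap, sub_eq_add_neg, add_comm] using this
  have upi : ∀ {s t : ℝ}, 0 ≤ s → s ≤ t → sol.pot (0,t) ≤ sol.pot (0,s) - γ * (t - s) := by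
    intro s t sa h2
    have e := sol.pot_t hc.Cl.continuous hc.Cr.continuous 0 sa h2
    have : ∫ z in s..t, γ ≤ ∫ z in s..t, sol.F 0 z := by
      apply intervalIntegral.integral_mono_ae_restrict h2 intervalIntegrable_const (sol.Fi hc.Cl.continuous hc.Cr.continuous _ _ _)
      have sd : ∀ᵐ z : ℝ ∂volume.restrict (Icc s t), z ≠ s := ae_restrict_of_ae (by simp [ae_iff])
      filter_upwards [ae_restrict_of_ae (sol.icond hc), sd, ae_restrict_mem measurableSet_Icc] with z hz si sm
      exact (hz (lt_of_le_of_lt sa (lt_of_le_of_ne sm.1 (Ne.symm si)))).1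
    rw [intervalIntegral.integral_const, smul_eq_mul] at this
    linarith
  have ilo : ∀ t, 0 ≤ t → ∃ σ y e, 0 ≤ σ ∧ σ ≤ t ∧ Leg fl fr E σ y e ∧ sol.pot (y,0) + e - γ * (t - σ) ≤ sol.pot (0,t) := by
    intro t ht
    have cp : ∀ {W : Pl → ℝ} {f : ℝ → ℝ} {K : NNReal}, Lwz K W → Adm a f E R → K < R → IsCompact {τ : ℝ | τ ∈ Icc 0 t ∧ ∃ y ≤ 0, W (y,0) + cc f E τ (-y) ≤ W (0,τ)} := by
      intro W f K hK ad hKR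
      have sa := ((HalfSol.goodcl hK ad hKR t).inter_right (isClosed_eq continuous_fst (continuous_const (y := sf)))).image continuous_snd
      convert sa using 1
      ext τ
      simp only [mem_ofPred_eq, mem_image, mem_inter_iff, Prod.exists, mem_prod]
      constructor
      · rintro ⟨h, y, hy, hh⟩; exact ⟨0, τ, ⟨⟨⟨by norm_num, h⟩, y, hy, by simpa using hh⟩, rfl⟩, rfl⟩
      · rintro ⟨x, tb, ⟨⟨⟨_, h⟩, y, hy, hh⟩, rfl⟩, rfl⟩; exact ⟨h, y, hy, by simpa using hh⟩
    have hcomp := (cp hK1 al la).union (cp hK2 arn l2)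
    obtain ⟨σ, hσ, hmax⟩ := hcomp.exists_isGreatest ⟨0, Or.inl ⟨⟨le_rfl, ht⟩, 0, le_rfl, by simp [al.zero]⟩⟩
    have tx : σ ∈ Icc 0 t := by rcases hσ with h | h <;> exact h.1
    have hflat : sol.pot (0,t) = sol.pot (0,σ) - γ * (t - σ) := by
      have e := sol.pot_t hc.Cl.continuous hc.Cr.continuous 0 tx.1 tx.2
      have : ∫ z in σ..t, sol.F 0 z = ∫ z in σ..t, γ := by
        apply intervalIntegral.integral_congr_ae
        filter_upwards [sol.icond hc] with z hz sm
        rw [uIoc_of_le tx.2] at sm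
        have hz0 : 0 < z := lt_of_le_of_lt tx.1 sm.1
        have hz01 : z ∈ Icc 0 t := ⟨hz0.le, sm.2⟩
        apply (hz hz0).2
        · by_contra hlt; push Not at hlt
          exact absurd (hmax (Or.inl ⟨hz01, hL.igood hK1 al la hc.hl hz0 (sol.pot_left 0 hz0) hlt⟩)) (not_le.2 sm.1)
        · by_contra hlt; push Not at hlt
          have hd : HasDerivWithinAt (fun y => (sol.pot ∘ sj) (y,z)) (-sol.up 0 z) (Iic 0) 0 := by
            have sa := sol.pot_right 0 hz0
            have h2 : HasDerivWithinAt (fun y : ℝ => -y) (-1) (Iic 0) 0 := (hasDerivAt_neg sf).hasDerivWithinAt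
            have sd := HasDerivWithinAt.comp (x := sf) (h := fun y : ℝ => -y) (h₂ := fun y => sol.pot (y,z)) (s' := Ici 0) (h₂' := sol.up 0 z) (by simpa using sa) h2 (fun y hy => by simpa using hy)
            simpa [Function.comp_def, rfl2_ap] using sd
          have hθ : deriv (fun k => fr (-k)) (-θr) = 0 := by rw [deriv_comp_neg, neg_neg, hc.hr, neg_zero]
          exact absurd (hmax (Or.inr ⟨hz01, hR.igood hK2 arn l2 hθ hz0 hd ln⟩)) (not_le.2 sm.1)
      rw [this, intervalIntegral.integral_const, smul_eq_mul] at e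
      linarith
    rcases hσ with ⟨_, y, hy, sa⟩ | ⟨_, y, hy, sa⟩
    · exact ⟨σ, y, _, tx.1, tx.2, Or.inl ⟨hy, rfl⟩, by linarith⟩
    · rw [ar.neg_cc] at sa
      simp only [Function.comp, rfl2_ap, neg_zero] at sa
      exact ⟨σ, -y, _, tx.1, tx.2, Or.inr ⟨by linarith, rfl⟩, by linarith⟩
  intro T hT
  constructor
  · rintro y x e (⟨sa, h2, sd⟩ | ⟨sa, h2, sd⟩ | ⟨σ, τ, eb, ea, sa, h2, sd, si, sm, sx⟩)
    · have := upl h2 sa le_rfl hT.le; rw [sub_zero] at this; rw [sd]; exact this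
    · have := upr h2 sa le_rfl hT.le; rw [sub_zero] at this; rw [sd]; exact this
    · have ic : sol.pot (0,σ) ≤ sol.pot (y,0) + eb := by
        rcases si with ⟨sz, tm⟩ | ⟨sz, tm⟩ <;> rw [tm]
        · simpa using upl sz le_rfl le_rfl sa
        · simpa using upr sz le_rfl le_rfl sa
      have ia := upi sa h2
      have ie : sol.pot (x,T) ≤ sol.pot (0,τ) + ea := by
        rcases sm with ⟨sz, tm⟩ | ⟨sz, tm⟩ <;> rw [tm, neg_neg]
        · simpa using upr le_rfl (by linarith : 0 ≤ x) (sa.trans h2) hT.le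
        · simpa using upl le_rfl (by linarith : x ≤ 0) (sa.trans h2) hT.le
      rw [sx]; linarith
  · intro x
    rcases lt_trichotomy x 0 with hx | hx | hx
    · rcases hL.HL hK1 al la hx hT with ⟨y, hy, sa⟩ | ⟨τ, sa, h2, sd⟩
      · exact ⟨y, _, Or.inl ⟨hx.le, hy, rfl⟩, sa⟩
      · obtain ⟨σ, y, e, si, sm, sx, sz⟩ := ilo τ sa
        exact ⟨y, _, Or.inr (Or.inr ⟨σ, τ, e, _, si, sm, h2.le, sx, Or.inr ⟨by linarith, rfl⟩, rfl⟩), by rw [neg_neg]; linarith⟩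
    · obtain ⟨σ, y, e, si, sm, sx, sz⟩ := ilo T hT.le
      exact ⟨y, _, Or.inr (Or.inr ⟨σ, T, e, 0, si, sm, le_rfl, sx, Or.inl ⟨by linarith, by simp [hx, ar.zero]⟩, rfl⟩), by rw [hx]; linarith⟩
    · rcases hR.HL hK2 arn l2 (xb := -x) ln hT with ⟨y, hy, sa⟩ | ⟨τ, sa, h2, sd⟩
      · rw [ar.neg_cc] at sa
        simp only [Function.comp, rfl2_ap, neg_neg] at sa
        exact ⟨-y, _, Or.inr (Or.inl ⟨hx.le, by linarith, rfl⟩), by convert sa using 3; ring⟩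
      · obtain ⟨σ, y, e, si, sm, sx, sz⟩ := ilo τ sa
        rw [ar.neg_cc] at sd
        simp only [Function.comp, rfl2_ap, neg_neg, neg_zero] at sd
        exact ⟨y, _, Or.inr (Or.inr ⟨σ, τ, e, _, si, sm, h2.le, sx, Or.inl ⟨by linarith, rfl⟩, rfl⟩), by rw [neg_neg]; linarith⟩
end ABSol
def intP (g : ℝ → ℝ) (x : ℝ) : ℝ := ∫ z in (0:ℝ)..x, g z
lemma intP_congr {g h : ℝ → ℝ} (e : ∀ᵐ x : ℝ, g x = h x) (x : ℝ) : intP g x = intP h x :=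
  intervalIntegral.integral_congr_ae (by filter_upwards [e] with z hz _; exact hz)
lemma IsLinf.ii {g : ℝ → ℝ} (h : IsLinf g) (x y : ℝ) : IntervalIntegrable g volume x y := by
  obtain ⟨hm, M, hM⟩ := h
  rw [intervalIntegrable_iff]
  exact Measure.integrableOn_of_bounded (M := M) (by simp) hm.aestronglyMeasurable (ae_restrict_of_ae hM)
lemma IsLinf.loc {g : ℝ → ℝ} (h : IsLinf g) : LocallyIntegrable g volume := by
  intro x
  exact ⟨Ioc (x-1) (x+1), Ioc_mem_nhds ln ln, (intervalIntegrable_iff_integrableOn_Ioc_of_le ln).1 (h.ii (x-1) (x+1))⟩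
lemma IsLinf.lip {g : ℝ → ℝ} (h : IsLinf g) : ∃ M : NNReal, Lwz M (intP g) := by
  obtain ⟨M, hM⟩ := h.2
  refine ⟨M.toNNReal, LipschitzWith.of_dist_le_mul fun x y => ?_⟩
  have sw : 0 ≤ M := by
    obtain ⟨x, hx⟩ := hM.exists
    exact (An).trans hx
  rw [Re, Re, Real.coe_toNNReal _ sw]
  have e : intP g x - intP g y = ∫ z in y..x, g z := intervalIntegral.integral_interval_sub_left (h.ii _ _) (h.ii _ _)
  rw [e]
  exact intervalIntegral.norm_integral_le_of_norm_le_const_ae (f := g) (by filter_upwards [hM] with z hz _; exact hz)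
lemma IsLinf.eq {g h : ℝ → ℝ} (hg : IsLinf g) (hh : IsLinf h) {c : ℝ} (e : ∀ x, intP g x = intP h x + c) : ∀ᵐ x : ℝ, g x = h x := by
  filter_upwards [LocallyIntegrable.ae_hasDerivAt_integral hg.loc, LocallyIntegrable.ae_hasDerivAt_integral hh.loc] with x sa h2
  have ei : (fun x => ∫ z in (0:ℝ)..x, g z) = fun x => (∫ z in (0:ℝ)..x, h z) + c := funext e
  have sd := sa 0
  rw [ei] at sd
  exact sd.unique ((h2 0).add_const c)
lemma IsLinf.comb {g h : ℝ → ℝ} (hg : IsLinf g) (hh : IsLinf h) (a b : ℝ) : IsLinf (fun x => a * g x + b * h x) := by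
  obtain ⟨sa, M, hM⟩ := hg
  obtain ⟨h2, N, hN⟩ := hh
  refine ⟨(sa.const_mul a).add (h2.const_mul b), |a| * M + |b| * N, ?_⟩
  filter_upwards [hM, hN] with x eb ea
  refine (abs_add_le _ _).trans ?_
  rw [abs_mul, abs_mul]; gcongr
lemma intP_comb {g h : ℝ → ℝ} (hg : IsLinf g) (hh : IsLinf h) (a b x : ℝ) : intP (fun x => a * g x + b * h x) x = a * intP g x + b * intP h x := by
  unfold intP
  rw [intervalIntegral.integral_add ((hg.ii _ _).const_mul a) ((hh.ii _ _).const_mul b), intervalIntegral.integral_const_mul, intervalIntegral.integral_const_mul]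
lemma intP_neg (g : ℝ → ℝ) (x : ℝ) : intP (fun z => g (-z)) x = - intP g (-x) := by
  unfold intP
  rw [intervalIntegral.integral_comp_neg, intervalIntegral.integral_symm, neg_zero]
namespace ABSol
variable {fl fr : ℝ → ℝ} {A B : ℝ} {ua : ℝ → ℝ} (sol : ABSol fl fr A B ua)
lemma pot0 (y : ℝ) : sol.pot (y,0) = intP ua y := by
  have : sol.pot (y,0) = intP (fun z => sol.u z 0) y := by simp [pot, intP]
  rw [this]; exact intP_congr sol.init y
lemma linf (T : ℝ) : IsLinf (fun x => sol.u x T) := by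
  obtain ⟨M, hM⟩ := sol.bdd
  exact ⟨sol.umeas_x T, M, Ef fun x => hM x T⟩
lemma potT {T : ℝ} (hT : 0 < T) (x : ℝ) : sol.pot (x,T) = intP (fun z => sol.u z T) x + sol.pot (0,T) := by
  have := sol.pot_x x 0 T
  rw [max_eq_left hT.le] at this; unfold intP; linarith
end ABSol
def Att (fl fr : ℝ → ℝ) (E γ T : ℝ) (Ω W : ℝ → ℝ) : Prop :=
  (∀ y x e, Cost fl fr E γ T y x e → Ω x ≤ W y + e) ∧ ∀ x, ∃ y e, Cost fl fr E γ T y x e ∧ W y + e ≤ Ω x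
section
variable {a γ θl θr A B T : ℝ} {fl fr ω : ℝ → ℝ}
lemma att_of {u : ℝ → ℝ} (hc : Conn a fl fr A B γ θl θr) (hT : 0 < T) (hu : u ∈ InitialSet T fl fr A B ω) :
    ∃ c ee, ∀ E, ee ≤ E → Att fl fr E γ T (intP ω) (fun y => intP u y - c) := by
  obtain ⟨hl, sol, hs⟩ := hu
  obtain ⟨ee, hE0⟩ := sol.rep hc
  refine ⟨sol.pot (0,T), ee, fun E hE => ?_⟩
  obtain ⟨sa, h2⟩ := hE0 E hE T hT
  have e : ∀ x, sol.pot (x,T) = intP ω x + sol.pot (0,T) := fun x => by rw [sol.potT hT, intP_congr hs]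
  constructor
  · intro y x ei hC
    have := sa y x ei hC; rw [e, sol.pot0] at this; linarith
  · intro x
    obtain ⟨y, ei, hC, hh⟩ := h2 x
    refine ⟨y, ei, hC, ?_⟩
    rw [e, sol.pot0] at hh; linarith
lemma of_att {u : ℝ → ℝ} (hc : Conn a fl fr A B γ θl θr) (hT : 0 < T) (hu : IsLinf u) (hω : ∃ xg, IsLinf xg ∧ ∀ᵐ x : ℝ, xg x = ω x)
    (sol : ABSol fl fr A B u) {c ee : ℝ} (h : ∀ E, ee ≤ E → Att fl fr E γ T (intP ω) (fun y => intP u y - c)) : u ∈ InitialSet T fl fr A B ω := by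
  refine ⟨hu, sol, ?_⟩
  obtain ⟨xg, sa, h2⟩ := hω
  obtain ⟨eg, hE1⟩ := sol.rep hc
  obtain ⟨ud, ue⟩ := h _ (le_max_left ee eg)
  obtain ⟨v1, v2⟩ := hE1 _ (le_max_right ee eg) T hT
  have e : ∀ x, sol.pot (x,T) = intP ω x + c := by
    intro x
    apply le_antisymm
    · obtain ⟨y, e, hC, hh⟩ := ue x
      have := v1 y x e hC; rw [sol.pot0] at this; linarith
    · obtain ⟨y, e, hC, hh⟩ := v2 x
      have := ud y x e hC; rw [sol.pot0] at hh; linarith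
  have ea : ∀ x, intP (fun z => sol.u z T) x = intP xg x + (c - sol.pot (0,T)) := by
    intro x
    have := e x; rw [sol.potT hT, ← intP_congr h2] at this; linarith
  filter_upwards [(sol.linf T).eq sa ea, h2] with x ic ia
  rw [ic, ia]
lemma foot {E R k x y e : ℝ} {Ω U : ℝ → ℝ} {M : NNReal} (hT : 0 < T) (al : Adm a fl E R) (hM : Lwz M Ω) (hMR : M < R) (hl : deriv fl θl = 0)
    (hU : ∀ y x e, Cost fl fr E γ T y x e → Ω x ≤ U y + e) (hx : x < 0) (hfar : (|fl θl| + |E|) * T < (R - M) * |x|)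
    (hd : HasDerivAt Ω k x) (hk : fl k < E) (hC : Cost fl fr E γ T y x e) (ht : U y + e ≤ Ω x) : y = x - deriv fl k * T := by
  rcases hC with ⟨sa, h2, sd⟩ | ⟨sa, h2, sd⟩ | ⟨σ, τ, eb, ea, sa, h2, sd, si, sm, sx⟩
  · obtain ⟨κ, kc, kg, ke⟩ := al.argmax T (x - y)
    obtain ⟨Λ, -, -, hΛ⟩ := al.lipf
    have ha := al.ha
    have hloc : ∀ xc ≤ 0, Ω xc ≤ Ω x + κ * (xc - x) + (xc - x)^2 / (2*a*T) := by
      intro xc ty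
      have ic := hU y xc _ (Or.inl ⟨ty, h2, rfl⟩)
      have ia := al.quad (sl := T) (da := xc - y) hT kc ke hΛ
      have ie : (|xc - y - (x - y)| + Λ * |T - T|)^2 = (xc - x)^2 := by
        rw [sub_self, abs_zero, mul_zero, add_zero, sq_abs]; ring
      rw [ie] at ia; rw [sd, kg] at ht; linarith
    have hκ : k = κ := by
      have hmax : IsLocalMax (fun xc => Ω xc - (κ * (xc - x) + (xc - x)^2 / (2*a*T))) x := by
        filter_upwards [Iio_mem_nhds hx] with xc ty
        have := hloc xc (le_of_lt ty); simp only [sub_self]; simp only [mul_zero, zero_add]; norm_num; linarith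
      have db : HasDerivAt (fun xc : ℝ => xc - x) 1 x := (hasDerivAt_id x).sub_const x
      have := hmax.hasDerivAt_eq_zero (hd.sub ((db.const_mul κ).add ((db.pow 2).div_const (2*a*T))))
      simp at this; linarith
    rw [← hκ] at kc ke
    have hopen : ∀ᶠ ka in nhds k, fl ka ≤ E := (al.cont.continuousAt.eventually (gt_mem_nhds hk)).mono fun _ h => le_of_lt h
    obtain ⟨ε, hε, hball⟩ := Metric.eventually_nhds_iff.1 hopen
    have v1 := al.vari kc (hball (y := k + ε/2) (by rw [Real.dist_eq]; simp; rw [abs_of_pos (half_pos hε)]; linarith)) ke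
    have v2 := al.vari kc (hball (y := k - ε/2) (by rw [Real.dist_eq]; simp; rw [abs_of_pos (half_pos hε)]; linarith)) ke
    have : x - y - deriv fl k * T = 0 := by apply le_antisymm <;> nlinarith
    linarith
  · linarith
  · exfalso
    have i5 : ea = cc fl E (T-τ) x := by
      rcases sm with ⟨sz, tm⟩ | ⟨sz, tm⟩
      · linarith
      · rwa [neg_neg] at tm
    have ic := hU y 0 _ (Or.inr (Or.inr ⟨σ, τ, eb, _, sa, h2, sd, si, Or.inr ⟨by simp, rfl⟩, rfl⟩))
    rw [neg_zero, neg_zero, al.cc_zero hl ln] at ic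
    have ia := al.coer' (T-τ) x
    have ie := (abs_le.1 ((Re _ _).symm.trans_le (hM.dist_le_mul x 0))).2
    rw [Re, sub_zero] at ie
    have i6 : -fl θl * (T - τ) ≤ |fl θl| * T := (Mlr (neg_le_abs _) ln).trans (Mll ln An)
    have i7 : E * (T - τ) ≤ |E| * T := (Mlr (le_abs_self _) ln).trans (Mll ln An)
    rw [sx, i5] at ht
    nlinarith
theorem core {Bb Aa : ℝ} (hc : Conn a fl fr A B γ θl θr) (hc' : Conn a fr fl Bb Aa γ θr θl) (hT : 0 < T)
    (hω : Attainable T fl fr A B ω) (hex : ∀ u, IsLinf u → Nonempty (ABSol fl fr A B u))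
    (v : ABSol fr fl Bb Aa (fun x => ω (-x))) (ustar : ABSol fl fr A B (fun x => v.u (-x) T)) :
    IsExtremalPt (InitialSet T fl fr A B ω) (fun x => v.u (-x) T) ∧
    (∀ w : ℝ → ℝ, IsExtremalPt (InitialSet T fl fr A B ω) w → ∀ᵐ x : ℝ ∂volume, w x = v.u (-x) T) := by
  obtain ⟨w0, hw0, sol0, hs0⟩ := hω
  have hω' : ∃ xg, IsLinf xg ∧ ∀ᵐ x : ℝ, xg x = ω x := ⟨_, sol0.linf T, hs0⟩
  have hw0I : w0 ∈ InitialSet T fl fr A B ω := ⟨hw0, sol0, hs0⟩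
  have hst : IsLinf (fun x => v.u (-x) T) := by
    obtain ⟨M, hM⟩ := v.bdd
    exact ⟨(v.umeas_x T).comp measurable_neg, M, Ef fun x => hM _ T⟩
  set us : ℝ → ℝ := fun x => v.u (-x) T with hus
  obtain ⟨cs, Ev, hEv⟩ : ∃ c ee, ∀ E, ee ≤ E → (∀ y x e, Cost fl fr E γ T y x e → intP ω x ≤ intP us y - c + e) ∧
      ∀ y, ∃ x e, Cost fl fr E γ T y x e ∧ intP us y - c + e ≤ intP ω x := by
    obtain ⟨ee, hE0⟩ := v.rep hc'
    refine ⟨v.pot (0,T), ee, fun E hE => ?_⟩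
    obtain ⟨sa, h2⟩ := hE0 E hE T hT
    have eb : ∀ y, v.pot (-y,T) = - (intP us y - v.pot (0,T)) := by
      intro y
      rw [v.potT hT]
      have := intP_neg (fun z => v.u z T) y
      rw [this]; ring
    have ea : ∀ x, v.pot (x,0) = - intP ω (-x) := fun x => by rw [v.pot0, intP_neg]
    constructor
    · intro y x e hC
      have := sa _ _ e hC.refl
      rw [eb, ea, neg_neg] at this; linarith
    · intro y
      obtain ⟨x, e, hC, hh⟩ := h2 (-y)
      rw [eb, ea] at hh
      refine ⟨-x, e, ?_, by linarith⟩
      have := hC.refl; rwa [neg_neg] at this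
  set Us : ℝ → ℝ := fun y => intP us y - cs with hUs
  have hcmp : ∀ {E W}, Ev ≤ E → Att fl fr E γ T (intP ω) W → ∀ y, Us y ≤ W y := by
    intro E W hE hW y
    obtain ⟨x, e, hC, hh⟩ := (hEv E hE).2 y
    have := hW.1 y x e hC
    simp only [hUs]; linarith
  have hustar : us ∈ InitialSet T fl fr A B ω := by
    obtain ⟨c0, ee, se⟩ := att_of hc hT hw0I
    refine of_att hc hT hst hω' ustar (c := cs) (ee := max ee Ev) fun E hE => ?_
    have hW := se E ((Mxl).trans hE)
    have hE' := (Mxr).trans hE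
    refine ⟨(hEv E hE').1, fun x => ?_⟩
    obtain ⟨y, e, hC, hh⟩ := hW.2 x
    have := hcmp hE' hW y
    exact ⟨y, e, hC, by simp only [hUs] at this; linarith⟩
  refine ⟨⟨hustar, ?_⟩, ?_⟩
  · intro ud hu1 ue hu2 lam hlam hcomb
    obtain ⟨ca, eg, hA1⟩ := att_of hc hT hu1
    obtain ⟨c2, eh, hA2⟩ := att_of hc hT hu2
    obtain ⟨M, hM⟩ := (sol0.linf T).lip
    have eΩ : intP (fun x => sol0.u x T) = intP ω := funext (intP_congr hs0)
    rw [eΩ] at hM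
    obtain ⟨E3, hE3⟩ := adm_ex hc.ha hc.Cl hc.l2 (R := M + 1) ps
    obtain ⟨Ck, _, hCk⟩ := bdd_on hc.Cl.continuous M
    set E := max (max eg eh) (max (max E3 Ev) (Ck + 1))
    have la : eg ≤ E := (Mxl).trans Mxl
    have l2 : eh ≤ E := (Mxr).trans Mxl
    have lb : E3 ≤ E := ((Mxl).trans Mxl).trans Mxr
    have l4 : Ev ≤ E := ((Mxr).trans Mxl).trans Mxr
    have l5 : Ck + 1 ≤ E := (Mxr).trans Mxr
    have al := hE3 E lb
    have ga := hcmp l4 (hA1 E la)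
    have g2 := hcmp l4 (hA2 E l2)
    obtain ⟨x, hxd, hx⟩ : ∃ x : ℝ, DifferentiableAt ℝ (intP ω) x ∧ x < -((|fl θl| + |E|) * T) - 1 := by
      have sa : ∃ᶠ x in ae (volume : Measure ℝ), x ∈ Iio (-((|fl θl| + |E|) * T) - 1) := by
        rw [frequently_ae_mem_iff]; simp
      obtain ⟨x, hx⟩ := (sa.and_eventually hM.ae_differentiableAt_real).exists
      exact ⟨x, hx.2, hx.1⟩
    have hpos : 0 ≤ (|fl θl| + |E|) * T := by positivity
    have xd : x < 0 := by linarith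
    have hfar : (|fl θl| + |E|) * T < ((M + 1 : ℝ) - M) * |x| := by
      rw [abs_of_neg xd]; linarith
    have hkb : |deriv (intP ω) x| ≤ M := norm_deriv_le_of_lipschitz hM
    have hk : fl (deriv (intP ω) x) < E := by
      have := (le_abs_self _).trans (hCk _ hkb); linarith
    have ft : ∀ {y e}, Cost fl fr E γ T y x e → Us y + e ≤ intP ω x → y = x - deriv fl (deriv (intP ω) x) * T :=
      fun hC ht => foot hT al hM ln hc.hl (hEv E l4).1 xd hfar hxd.hasDerivAt hk hC ht
    obtain ⟨su, eb, hC1, sv⟩ := (hA1 E la).2 x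
    obtain ⟨y2, ea, hC2, ht2⟩ := (hA2 E l2).2 x
    have ic := ft hC1 (by linarith [ga su])
    have ia := ft hC2 (by linarith [g2 y2])
    have q1 := (hEv E l4).1 _ _ _ hC1
    have q2 := (hEv E l4).1 _ _ _ hC2
    rw [← ic] at ia
    rw [ia] at ht2 q2
    have hlin : ∀ y, intP us y = lam * intP ud y + (1-lam) * intP ue y := fun y => by
      rw [← intP_comb hu1.1 hu2.1]; exact intP_congr hcomb y
    obtain ⟨hl0, hl1⟩ := hlam
    have hc0 : cs = lam * ca + (1-lam) * c2 := by
      have := hlin su; have sa := ga su; have h2 := g2 su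
      simp only [hUs] at sa h2
      have xf : intP us su - cs = intP ud su - ca := by linarith
      have r2 : intP us su - cs = intP ue su - c2 := by linarith
      linear_combination this - lam * xf - (1-lam) * r2
    have key : ∀ y, lam * (intP ud y - ca - Us y) + (1-lam) * (intP ue y - c2 - Us y) = 0 := by
      intro y; simp only [hUs]; rw [hc0, hlin y]; ring
    constructor
    · refine hu1.1.eq hst (c := ca - cs) fun y => ?_
      have sa := ga y; have h2 := g2 y; have := key y
      have : intP ud y - ca - Us y = 0 := by nlinarith [Pn hl0.le (sub_nonneg.2 sa), Pn (sub_nonneg.2 hl1.le) (sub_nonneg.2 h2)]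
      simp only [hUs] at this; linarith
    · refine hu2.1.eq hst (c := c2 - cs) fun y => ?_
      have sa := ga y; have h2 := g2 y; have := key y
      have : intP ue y - c2 - Us y = 0 := by nlinarith [Pn hl0.le (sub_nonneg.2 sa), Pn (sub_nonneg.2 hl1.le) (sub_nonneg.2 h2)]
      simp only [hUs] at this; linarith
  · rintro w ⟨hw, hext⟩
    obtain ⟨ca, eg, hA1⟩ := att_of hc hT hw
    have hw1 : IsLinf (fun x => 2 * w x + (-1) * us x) := hw.1.comb hst 2 (-1)
    obtain ⟨sol1⟩ := hex _ hw1
    have hI : (fun x => 2 * w x + (-1) * us x) ∈ InitialSet T fl fr A B ω := by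
      refine of_att hc hT hw1 hω' sol1 (c := 2 * ca - cs) (ee := max eg Ev) fun E hE => ?_
      have hW := hA1 E ((Mxl).trans hE)
      have hE' := (Mxr).trans hE
      have hg := hcmp hE' hW
      simp only [intP_comb hw.1 hst]
      constructor
      · intro y x e hC
        have := hW.1 y x e hC; have sa := hg y
        simp only [hUs] at sa; linarith
      · intro x
        obtain ⟨y, e, hC, hh⟩ := hW.2 x
        have := (hEv E hE').1 y x e hC
        have sa := hg y
        simp only [hUs] at sa
        exact ⟨y, e, hC, by linarith⟩
    have := (hext _ hI us hustar (1/2) nn (Ef fun x => by ring)).2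
    filter_upwards [this] with x hx
    exact hx.symm
end
structure QP (a : ℝ) (f : ℝ → ℝ) (E R θ K ec : ℝ) (ba m : ℝ → ℝ) : Prop where
  adm : Adm a f E R
  th : deriv f θ = 0
  hθ : |θ| ≤ R
  hK : K < R
  hE' : ec < E
  hb : ∀ y sn, |ba y - ba sn| ≤ K * |y - sn|
  m0 : m 0 = ba 0
  c2 : ∀ τ y, 0 ≤ τ → y ≤ 0 → m τ ≤ ba y + cc f E τ (-y)
  up : ∀ tb τ, 0 ≤ tb → tb ≤ τ → m τ ≤ m tb - f θ * (τ - tb)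
  lo : ∀ tb τ, 0 ≤ tb → tb ≤ τ → m tb ≤ m τ + ec * (τ - tb)
  sc : ∀ t, 0 < t → ∃ δ > 0, ∃ C ≥ 0, ∀ τ, |τ - t| < δ → ∃ p, ∀ tb, |tb - t| < δ → m tb ≤ m τ + p * (tb - τ) + C * (tb - τ)^2
lemma tl {α : Type*} {l : Filter α} [l.IsCountablyGenerated] {g : α → ℝ} {M κ0 : ℝ} (hb : ∀ᶠ x in l, |g x| ≤ M)
    (h : ∀ (x : ℕ → α) (κ : ℝ), Tendsto x atTop l → Tendsto (fun n => g (x n)) atTop (nhds κ) → κ = κ0) : Tendsto g l (nhds κ0) := by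
  refine tendsto_of_subseq_tendsto fun ns hns => ?_
  have hb' := hns.eventually hb
  obtain ⟨κ, _, φ, hφ, hl⟩ := tendsto_subseq_of_frequently_bounded (x := fun n => g (ns n)) (Metric.isBounded_closedBall (x := sf) (r := M))
    (hb'.frequently.mono fun n hn => by simpa using hn)
  refine ⟨φ, ?_⟩
  rw [← h _ κ (hns.comp hφ.tendsto_atTop) hl]
  exact hl
namespace QP
variable {a E R θ K ec : ℝ} {f ba m : ℝ → ℝ}
local notation "QQ" => QP a f E R θ K ec ba m
def G (f : ℝ → ℝ) (E : ℝ) (ba m : ℝ → ℝ) (p x t : ℝ) : ℝ := (ba (min p 0) + m (max p 0) - m 0) + cc f E (t - max p 0) (x - min p 0)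
def V (f : ℝ → ℝ) (E : ℝ) (ba m : ℝ → ℝ) (x t : ℝ) : ℝ := ⨅ p, G f E ba m p x t
local notation "VV" => V f E ba m
structure IsMin (f : ℝ → ℝ) (E : ℝ) (ba m : ℝ → ℝ) (x t p k : ℝ) : Prop where
  hp : G f E ba m p x t = V f E ba m x t
  hk : f k ≤ E
  mx : ∀ ka, f ka ≤ E → ka * (x - min p 0) - f ka * (t - max p 0) ≤ k * (x - min p 0) - f k * (t - max p 0)
lemma lipM (q : QQ) : ∀ τ tb, 0 ≤ τ → 0 ≤ tb → |m τ - m tb| ≤ (|ec| + |f θ|) * |τ - tb| := by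
  have key : ∀ τ tb, 0 ≤ tb → tb ≤ τ → |m τ - m tb| ≤ (|ec| + |f θ|) * |τ - tb| := by
    intro τ tb sa h2
    have eb := q.up tb τ sa h2; have ea := q.lo tb τ sa h2
    have sd : 0 ≤ τ - tb := by linarith
    rw [Ai sd, abs_le]
    have aa := Mlr (le_abs_self ec) sd
    have ab := Mlr (neg_abs_le (f θ)) sd
    have ac := Pn (abs_nonneg ec) sd
    have a4 := Pn (abs_nonneg (f θ)) sd
    constructor <;> nlinarith
  intro τ tb sa h2
  rcases le_total tb τ with h | h
  · exact key τ tb h2 h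
  · rw [abs_sub_comm, abs_sub_comm τ]; exact key tb τ sa h
lemma bcont (q : QQ) : Continuous ba := by
  have : Lwz K.toNNReal ba := LipschitzWith.of_dist_le_mul fun x y => by
    rw [Re, Real.dist_eq]; exact (q.hb x y).trans (Mlr (Real.le_coe_toNNReal K) An)
  exact this.continuous
lemma mcont (q : QQ) : Continuous (fun p => m (max p 0)) := by
  have : Lwz (|ec| + |f θ|).toNNReal (fun p => m (max p 0)) := LipschitzWith.of_dist_le_mul fun x y => by
    rw [Re, Re, Real.coe_toNNReal _ ps]
    refine (q.lipM _ _ Mxr Mxr).trans (Mll ?_ ps)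
    simpa using abs_max_sub_max_le_abs x y 0
  exact this.continuous
lemma Gcont (q : QQ) : Continuous (fun z : ℝ × ℝ × ℝ => G f E ba m z.1 z.2.1 z.2.2) := by
  unfold G
  refine (((q.bcont.comp (by fun_prop)).add (q.mcont.comp continuous_fst)).sub cst).add ?_
  exact q.adm.continuous.comp (by fun_prop : Continuous fun z : ℝ × ℝ × ℝ => (z.2.2 - max z.1 0, z.2.1 - min z.1 0))
lemma coer (q : QQ) (p x t : ℝ) : m 0 - R * |x| - E * t + min (R-K) (E-ec) * |p| ≤ G f E ba m p x t - (ba 0 - m 0) := by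
  have sa := q.adm.coer' (t - max p 0) (x - min p 0)
  have h2 := (abs_le.1 (q.hb (min p 0) 0)).1
  have sd := q.lo 0 (max p 0) le_rfl Mxr
  have si : |p| = |min p 0| + max p 0 := by
    rcases le_total p 0 with h | h <;> simp [h, abs_of_nonneg]
  have sm : |min p 0| ≤ |x - min p 0| + |x| := by
    have := abs_sub_abs_le_abs_sub (min p 0) x; rw [abs_sub_comm] at this; linarith
  have sx := Mll sm q.adm.hR.le
  have sz := Mlr (min_le_left (R-K) (E-ec)) (abs_nonneg (min p 0))
  have tm := Mlr (min_le_right (R-K) (E-ec)) (le_max_right p 0)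
  simp only [sub_zero] at h2 sd
  unfold G; rw [si]; nlinarith [q.m0]
lemma kap (q : QQ) : 0 < min (R-K) (E-ec) := lt_min (sub_pos.2 q.hK) (sub_pos.2 q.hE')
lemma exG (q : QQ) (x t : ℝ) : ∃ p, ∀ p', G f E ba m p x t ≤ G f E ba m p' x t := by
  have hc : Continuous (fun p => G f E ba m p x t) := q.Gcont.comp (by fun_prop : Continuous fun p : ℝ => (p, x, t))
  refine hc.exists_forall_le ?_
  have : Tendsto (fun p : ℝ => (m 0 - R * |x| - E * t) + min (R-K) (E-ec) * |p|) (cocompact ℝ) atTop := by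
    apply tendsto_atTop_add_const_left
    exact (tendsto_norm_cocompact_atTop (E := ℝ)).const_mul_atTop q.kap
  refine tendsto_atTop_mono (fun p => ?_) this
  have := q.coer p x t; rw [q.m0] at this ⊢; linarith
lemma le (q : QQ) (p x t : ℝ) : VV x t ≤ G f E ba m p x t := by
  obtain ⟨pa, h⟩ := q.exG x t
  exact ciInf_le ⟨_, by rintro _ ⟨p, rfl⟩; exact h p⟩ p
lemma exmin (q : QQ) (x t : ℝ) : ∃ p k, IsMin f E ba m x t p k := by
  obtain ⟨p, h⟩ := q.exG x t
  obtain ⟨k, sa, h2, sd⟩ := q.adm.argmax (t - max p 0) (x - min p 0)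
  exact ⟨p, k, le_antisymm (le_ciInf h) (q.le p x t), sa, sd⟩
lemma IsMin.cc_eq (q : QQ) {x t p k : ℝ} (h : IsMin f E ba m x t p k) :
    cc f E (t - max p 0) (x - min p 0) = k * (x - min p 0) - f k * (t - max p 0) := by
  obtain ⟨ka, sa, h2, sd⟩ := q.adm.argmax (t - max p 0) (x - min p 0)
  rw [h2]; exact le_antisymm (h.mx _ sa) (sd _ h.hk)
lemma vlip (q : QQ) : ∃ L, 0 < L ∧ (∀ k, f k ≤ E → |k| ≤ L ∧ |f k| ≤ L) ∧ ∀ x t xc tg, VV x t ≤ VV xc tg + L * (|t - tg| + |x - xc|) := by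
  obtain ⟨L, se, _, _, hL⟩ := q.adm.bnd
  refine ⟨L, se, hL, fun x t xc tg => ?_⟩
  obtain ⟨p, k, h⟩ := q.exmin xc tg
  have sa := q.le p x t
  have h2 := q.adm.lip hL (t - max p 0) (x - min p 0) (tg - max p 0) (xc - min p 0)
  rw [sub_sub_sub_cancel_right, sub_sub_sub_cancel_right] at h2
  rw [← h.hp]; unfold G at *; linarith
lemma Vcont (q : QQ) : ∃ K, Lwz K (fun z : Pl => VV z.1 z.2) := by
  obtain ⟨L, se, _, h⟩ := q.vlip
  refine ⟨(2*L).toNNReal, LipschitzWith.of_le_add_mul _ fun z z' => ?_⟩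
  rw [Real.coe_toNNReal _ ln]
  have sa : |z.1 - z'.1| ≤ dist z z' := Mxl
  have h2 : |z.2 - z'.2| ≤ dist z z' := Mxr
  have := h z.1 z.2 z'.1 z'.2
  nlinarith
lemma pbd (q : QQ) : ∃ C, 0 ≤ C ∧ ∀ x t p k, IsMin f E ba m x t p k → |p| ≤ C * (|x| + |t|) := by
  obtain ⟨L, se, h2, sd, hL⟩ := q.adm.bnd
  refine ⟨2 * L / min (R-K) (E-ec), div_nonneg ln q.kap.le, fun x t p k h => ?_⟩
  have eb := q.coer p x t
  have ea := q.le 0 x t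
  have ed := q.adm.lip hL t x 0 0
  rw [q.adm.zero] at ed
  rw [h.hp] at eb
  simp only [G, min_self, max_self, sub_zero] at ea ed
  have ef : R * |x| ≤ L * |x| := Mlr h2 An
  have ej : E * t ≤ L * |t| := (le_abs_self _).trans (by rw [abs_mul]; exact Mlr sd An)
  rw [div_mul_eq_mul_div, le_div_iff₀ q.kap]; nlinarith [q.m0]
lemma clos (q : QQ) {x t p k : ℕ → ℝ} {xb td pa kd : ℝ} (h : ∀ n, IsMin f E ba m (x n) (t n) (p n) (k n))
    (hx : Tendsto x atTop (nhds xb)) (ht : Tendsto t atTop (nhds td)) (hp : Tendsto p atTop (nhds pa)) (hk : Tendsto k atTop (nhds kd)) :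
    IsMin f E ba m xb td pa kd := by
  obtain ⟨KV, hV⟩ := q.Vcont
  have hf := q.adm.cont
  have cmin : Tendsto (fun n => x n - min (p n) 0) atTop (nhds (xb - min pa 0)) := hx.sub (hp.min tendsto_const_nhds)
  have cmax : Tendsto (fun n => t n - max (p n) 0) atTop (nhds (td - max pa 0)) := ht.sub (hp.max tendsto_const_nhds)
  have ck := (hf.tendsto kd).comp hk
  refine ⟨?_, le_of_tendsto ck (Ef fun n => (h n).hk), fun ka sr => ?_⟩
  · have sa := (q.Gcont.tendsto (pa, xb, td)).comp (hp.prodMk_nhds (hx.prodMk_nhds ht))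
    have h2 := (hV.continuous.tendsto (xb, td)).comp (hx.prodMk_nhds ht)
    refine tendsto_nhds_unique sa (h2.congr fun n => ?_)
    exact (h n).hp.symm
  · refine le_of_tendsto_of_tendsto' ((cmin.const_mul ka).sub (cmax.const_mul (f ka))) ((hk.mul cmin).sub (ck.mul cmax)) fun n => ?_
    exact (h n).mx ka sr
lemma sub (q : QQ) {x t p k : ℕ → ℝ} {xb td kd : ℝ} (h : ∀ n, IsMin f E ba m (x n) (t n) (p n) (k n))
    (hx : Tendsto x atTop (nhds xb)) (ht : Tendsto t atTop (nhds td)) (hk : Tendsto k atTop (nhds kd)) :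
    ∃ pa, ∃ φ : ℕ → ℕ, StrictMono φ ∧ Tendsto (p ∘ φ) atTop (nhds pa) ∧ IsMin f E ba m xb td pa kd := by
  obtain ⟨C, _, hC⟩ := q.pbd
  have hev : ∀ᶠ n in atTop, |p n| ≤ C * (|xb| + |td|) + 1 := by
    filter_upwards [((hx.abs.add ht.abs).const_mul C).eventually (gt_mem_nhds (show C * (|xb| + |td|) < C * (|xb| + |td|) + 1 by linarith))] with n hn
    exact (hC _ _ _ _ (h n)).trans hn.le
  obtain ⟨pa, _, φ, hφ, hl⟩ := tendsto_subseq_of_frequently_bounded (x := p) (Metric.isBounded_closedBall (x := sf) (r := C * (|xb| + |td|) + 1))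
    (hev.frequently.mono fun n hn => by simpa using hn)
  have hm := hφ.tendsto_atTop
  exact ⟨pa, φ, hφ, hl, q.clos (fun n => h (φ n)) (hx.comp hm) (ht.comp hm) hl (hk.comp hm)⟩
lemma slow (q : QQ) : ∃ c > 0, ∀ x t p k, x < 0 → 0 < t → IsMin f E ba m x t p k → p ≤ 0 ∨ (0 < p ∧ c * |x| ≤ t - p) := by
  obtain ⟨Λ, hΛ, hΛ', -⟩ := q.adm.lipf
  obtain ⟨-, α, hα, hαE⟩ := q.adm.endp
  have key : ∀ x t p k r, x < 0 → IsMin f E ba m x t p k → 0 < r → r ≤ p → 0 ≤ t - p + r → Λ * (t - p + r) < |x| → False := by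
    intro x t p k r hx h hr hrp se hlt
    obtain ⟨ka, kc, kg, ke⟩ := q.adm.argmax (t - p + r) x
    have hv := q.adm.vari kc hαE.le ke
    have hneg : x - deriv f ka * (t - p + r) < 0 := by
      have := (abs_le.1 (hΛ' ka kc)).1
      rw [abs_of_neg hx] at hlt
      nlinarith
    have hle : ka ≤ α := by by_contra hh; push Not at hh; nlinarith
    have hEk : f ka = E := by
      apply le_antisymm kc; rw [← hαE]
      exact cv_anti q.adm.ha q.adm.C2 q.adm.h2 q.th hle (by linarith [(abs_le.1 q.hθ).1])
    have eb := q.adm.ge (t - p) x kc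
    have ea := q.le (p - r) x t
    have ed := q.lo (p - r) p ln ln
    rw [← h.hp] at ea
    have xh : 0 < p := by linarith
    have ef : t - (p - r) = t - p + r := by ring
    simp only [G, min_eq_right xh.le, max_eq_left xh.le, min_eq_right (show 0 ≤ p - r by linarith), max_eq_left (show 0 ≤ p - r by linarith), sub_zero, ef, kg, hEk] at ea
    rw [hEk] at eb
    nlinarith [q.hE']
  refine ⟨1 / (2 * Λ), by positivity, fun x t p k hx ht h => ?_⟩
  by_contra hcon
  push Not at hcon
  obtain ⟨hp, h2⟩ := hcon
  have h2 := h2 hp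
  have ty : 0 < |x| := abs_pos.2 hx.ne
  rw [div_mul_eq_mul_div, one_mul, lt_div_iff₀ ps] at h2
  rcases lt_or_ge (t - p) 0 with sd | sd
  · refine key x t p k (p - t) hx h ln ln ln ?_
    rw [show t - p + (p - t) = 0 by ring, mul_zero]; exact ty
  · refine key x t p k (min p (|x| / (2 * Λ))) hx h (lt_min hp ps) Mnl ps ?_
    have := Mll (min_le_right p (|x| / (2 * Λ))) hΛ.le
    have e : Λ * (|x| / (2 * Λ)) = |x| / 2 := by field_simp
    nlinarith
lemma sup (q : QQ) : ∃ Λ, 0 < Λ ∧ ∀ x t p k, IsMin f E ba m x t p k → 0 < t - max p 0 → ∀ xc tg,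
    VV xc tg ≤ VV x t + k * (xc - x) - f k * (tg - t) + (|xc - x| + Λ * |tg - t|)^2 / (2 * a * (t - max p 0)) := by
  obtain ⟨Λ, hΛ, -, hΛ'⟩ := q.adm.lipf
  refine ⟨Λ, hΛ, fun x t p k h hs xc tg => ?_⟩
  have eb := q.le p xc tg
  have ea := q.adm.quad (sl := tg - max p 0) (da := xc - min p 0) hs h.hk h.mx hΛ'
  have ed := IsMin.cc_eq q h
  rw [sub_sub_sub_cancel_right, sub_sub_sub_cancel_right] at ea
  rw [← h.hp]; unfold G at *; nlinarith
lemma bdry (q : QQ) (r : ℝ) : VV (min r 0) (max r 0) = ba (min r 0) + m (max r 0) - m 0 := by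
  apply le_antisymm
  · have := q.le r (min r 0) (max r 0)
    simpa [G, q.adm.zero] using this
  · refine le_ciInf fun p => ?_
    unfold G
    have c := q.adm.coer' (max r 0 - max p 0) (min r 0 - min p 0)
    have hb := (abs_le.1 (q.hb (min r 0) (min p 0))).2
    have hKR := Mlr q.hK.le (abs_nonneg (min r 0 - min p 0))
    rcases le_total r p with h | h
    · rcases le_total p 0 with hp | hp
      · simp only [min_eq_left hp, max_eq_right hp, min_eq_left (h.trans hp), max_eq_right (h.trans hp)] at *; linarith
      · have sa := q.lo (max r 0) p Mxr (max_le h hp)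
        simp only [min_eq_right hp, max_eq_left hp] at *
        have := Mlr q.hE'.le (sub_nonneg.2 (max_le h hp))
        linarith
    · rcases le_total r 0 with hr | hr
      · simp only [min_eq_left hr, max_eq_right hr, min_eq_left (h.trans hr), max_eq_right (h.trans hr)] at *; linarith
      · rcases le_total p 0 with hp | hp
        · have := q.c2 r p hr hp
          simp only [min_eq_left hp, max_eq_right hp, min_eq_right hr, max_eq_left hr, sub_zero, zero_sub, q.m0] at *; linarith
        · have := q.up p r hp h
          simp only [min_eq_right hp, max_eq_left hp, min_eq_right hr, max_eq_left hr, sub_self]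
          rw [q.adm.cc_zero q.th ln]; linarith
lemma Vm (q : QQ) {t : ℝ} (ht : 0 ≤ t) : VV 0 t = m t := by
  have := q.bdry t; simpa [ht, q.m0] using this
end QP
namespace QP
variable {a E R θ K ec : ℝ} {f ba m : ℝ → ℝ}
local notation "QQ" => QP a f E R θ K ec ba m
local notation "VV" => V f E ba m
attribute [local irreducible] V
def w (f : ℝ → ℝ) (E : ℝ) (ba m : ℝ → ℝ) (x t : ℝ) : ℝ :=
  limsup (fun n : ℕ => ((n:ℝ)+1) * (V f E ba m (x + ι n) t - V f E ba m x t)) atTop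
local notation "ww" => w f E ba m
lemma loc (q : QQ) {ε : ℝ} (hε : 0 < ε) : ∃ C, 0 ≤ C ∧ ∀ x t p k, x ≤ -ε → ε ≤ t → IsMin f E ba m x t p k → ∀ xc tg,
    VV xc tg ≤ VV x t + k * (xc - x) - f k * (tg - t) + C * (|xc - x| + |tg - t|)^2 := by
  obtain ⟨Λ, hΛ, h⟩ := q.sup
  obtain ⟨c, hc, hs⟩ := q.slow
  have ha := q.adm.ha
  have se : 0 < min ε (c * ε) := lt_min hε ps
  refine ⟨(1+Λ)^2 / (2 * a * min ε (c*ε)), by positivity, fun x t p k hx ht hm xc tg => ?_⟩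
  have sa : min ε (c * ε) ≤ t - max p 0 := by
    rcases hs x t p k ln ln hm with h2 | ⟨h2, sd⟩
    · rw [max_eq_right h2]; exact (Mnl).trans ln
    · rw [max_eq_left h2.le]; refine (Mnr).trans (le_trans ?_ sd)
      exact Mll (by rw [abs_of_neg ln]; linarith) hc.le
  have h2 := h x t p k hm (se.trans_le sa) xc tg
  have sd : (|xc - x| + Λ * |tg - t|)^2 ≤ (1+Λ)^2 * (|xc - x| + |tg - t|)^2 := by
    rw [← mul_pow]; apply pow_le_pow_left₀ ps
    nlinarith [abs_nonneg (xc-x), abs_nonneg (tg-t), Pn hΛ.le (abs_nonneg (xc - x))]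
  have si : (|xc - x| + Λ * |tg - t|)^2 / (2 * a * (t - max p 0)) ≤ (1+Λ)^2 / (2 * a * min ε (c*ε)) * (|xc - x| + |tg - t|)^2 := by
    rw [div_mul_eq_mul_div]
    exact div_le_div₀ ps sd ps (by gcongr)
  linarith
lemma wtend (q : QQ) {x t : ℝ} (hx : x < 0) (ht : 0 < t) :
    ∃ p κ, IsMin f E ba m x t p κ ∧ Tendsto (fun n : ℕ => ((n:ℝ)+1) * (VV (x + ι n) t - VV x t)) atTop (nhds κ) := by
  obtain ⟨L, tp, hL, hlip⟩ := q.vlip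
  set D := fun n : ℕ => ((n:ℝ)+1) * (VV (x + ι n) t - VV x t) with hD
  have hε : 0 < min (-x/2) t := lt_min ln ht
  obtain ⟨C, hC, hloc⟩ := q.loc hε
  have ic := min_le_left (-x/2) t
  have ia := min_le_right (-x/2) t
  have hup : ∀ p κ, IsMin f E ba m x t p κ → ∀ n : ℕ, D n ≤ κ + C * ι n := by
    intro p κ h n
    have := hloc x t p κ ln ia h (x + ι n) t
    have hn : sf < (n:ℝ)+1 := by positivity
    rw [add_sub_cancel_left, sub_self, abs_zero, add_zero, sq_abs, mul_zero, sub_zero] at this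
    have h2 : ((n:ℝ)+1) * (κ * ι n + C * ι n^2) = κ + C * ι n := by field_simp
    rw [← h2]; exact Mll ln hn.le
  have hlow : ∀ n : ℕ, ι n < -x/2 → ∀ p k, IsMin f E ba m (x + ι n) t p k → k - C * ι n ≤ D n := by
    intro n hn' p κ h
    have := hloc _ t p κ ln ia h x t
    have hn : sf < (n:ℝ)+1 := by positivity
    rw [sub_add_cancel_left, sub_self, abs_zero, add_zero, sq_abs, mul_zero, sub_zero] at this
    have h2 : ((n:ℝ)+1) * (κ * ι n - C * ι n^2) = κ - C * ι n := by field_simp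
    rw [← h2]; exact Mll ln hn.le
  have hb : ∀ n, |D n| ≤ L := by
    intro n
    have hn : sf < (n:ℝ)+1 := by positivity
    have eb := hlip (x + ι n) t x t
    have ea := hlip x t (x + ι n) t
    rw [sub_self, abs_zero, zero_add, add_sub_cancel_left, abs_of_pos ps] at eb
    rw [sub_self, abs_zero, zero_add, sub_add_cancel_left, abs_neg, abs_of_pos ps] at ea
    have h2 : ((n:ℝ)+1) * (L * ι n) = L := by field_simp
    rw [hD, abs_mul, abs_of_pos hn, ← h2]
    refine Mll (abs_le.2 ⟨by linarith, by linarith⟩) hn.le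
  have h1n := tendsto_one_div_add_atTop_nhds_zero_nat (𝕜 := ℝ)
  have stepA : ∀ (φ : ℕ → ℕ) κ, Tendsto φ atTop atTop → Tendsto (fun n => D (φ n)) atTop (nhds κ) → ∃ p, IsMin f E ba m x t p κ := by
    intro φ κ hφ hκ
    choose p k hpk using fun n : ℕ => q.exmin (x + 1/(((φ n : ℕ):ℝ)+1)) t
    obtain ⟨kd, _, ψ, hψ, hk0⟩ := tendsto_subseq_of_bounded (x := k) (Metric.isBounded_closedBall (x := sf) (r := L)) (fun n => by simpa using (hL _ (hpk n).hk).1)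
    have hφψ := hφ.comp hψ.tendsto_atTop
    have h1s := h1n.comp hφψ
    have hxs : Tendsto (fun n => x + 1/(((φ (ψ n) : ℕ):ℝ)+1)) atTop (nhds x) := by simpa using h1s.const_add x
    obtain ⟨pa, _, _, _, hmin⟩ := q.sub (fun n => hpk (ψ n)) hxs tendsto_const_nhds hk0
    have hκ' := hκ.comp hψ.tendsto_atTop
    have : κ = kd := by
      apply le_antisymm
      · have la := (h1s.const_mul C).const_add kd
        rw [mul_zero, add_zero] at la
        exact le_of_tendsto_of_tendsto' hκ' la fun n => hup pa kd hmin _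
      · have la := hk0.sub (h1s.const_mul C)
        rw [mul_zero, sub_zero] at la
        refine le_of_tendsto_of_tendsto la hκ' ?_
        filter_upwards [h1s.eventually (gt_mem_nhds (show 0 < -x/2 by linarith))] with n hn
        exact hlow _ hn _ _ (hpk (ψ n))
    rw [this]; exact ⟨pa, hmin⟩
  obtain ⟨κ, _, φ, hφ, hκ⟩ := tendsto_subseq_of_bounded (x := D) (Metric.isBounded_closedBall (x := sf) (r := L)) (fun n => by simpa using hb n)
  obtain ⟨p, hp⟩ := stepA φ κ hφ.tendsto_atTop hκ
  refine ⟨p, κ, hp, tl (Ef hb) fun ψ te hψ hκ' => ?_⟩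
  obtain ⟨p', hp'⟩ := stepA ψ te hψ hκ'
  apply le_antisymm
  · have la := ((h1n.comp hψ).const_mul C).const_add κ
    rw [mul_zero, add_zero] at la
    exact le_of_tendsto_of_tendsto' hκ' la fun n => hup p κ hp _
  · have la := ((h1n.comp hφ.tendsto_atTop).const_mul C).const_add te
    rw [mul_zero, add_zero] at la
    exact le_of_tendsto_of_tendsto' hκ la fun n => hup p' te hp' _
lemma wmin (q : QQ) {x t : ℝ} (hx : x < 0) (ht : 0 < t) : ∃ p, IsMin f E ba m x t p (ww x t) := by
  obtain ⟨p, κ, sa, h2⟩ := q.wtend hx ht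
  refine ⟨p, ?_⟩
  rw [w, h2.limsup_eq]; exact sa
lemma wmeas (q : QQ) : Measurable (Function.uncurry (ww)) := by
  obtain ⟨KV, hV⟩ := q.Vcont
  unfold w
  refine Measurable.limsup fun n => ?_
  have sa : Continuous fun z : Pl => VV (z.1 + ι n) z.2 := hV.continuous.comp (by fun_prop : Continuous fun z : Pl => (z.1 + ι n, z.2))
  exact (continuous_const.mul (sa.sub hV.continuous)).measurable
lemma wlim (q : QQ) {x t : ℝ} (hx : x < 0) (ht : 0 < t) :
    (∃ l, Tendsto (fun y => ww y t) (nhdsWithin x (Iio x)) (nhds l)) ∧ ∃ l, Tendsto (fun y => ww y t) (nhdsWithin x (Ioi x)) (nhds l) := by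
  obtain ⟨L, tp, hL, hlip⟩ := q.vlip
  obtain ⟨C, hC, hloc⟩ := q.loc (lt_min (show 0 < -x/2 by linarith) ht)
  have ic := min_le_left (-x/2) t
  have ia := min_le_right (-x/2) t
  set g := fun y => 2 * C * y - ww y t with hg
  have hmono : MonotoneOn g (Iio (x/2)) := by
    intro y hy z hz hyz
    obtain ⟨p, hp⟩ := q.wmin (show y < 0 by have : y < x/2 := hy; linarith) ht
    obtain ⟨p', hp'⟩ := q.wmin (show z < 0 by have : z < x/2 := hz; linarith) ht
    have eb := hloc y t p _ (by have : y < x/2 := hy; linarith) ia hp z t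
    have ea := hloc z t p' _ (by have : z < x/2 := hz; linarith) ia hp' y t
    rw [sub_self, abs_zero, add_zero, sq_abs, mul_zero, sub_zero] at eb ea
    rcases hyz.eq_or_lt with h | h
    · rw [h]
    · simp only [hg]
      by_contra hcon
      push Not at hcon
      nlinarith [mul_pos (sub_pos.2 h) (sub_pos.2 hcon)]
  have hb : ∀ y, y < 0 → |ww y t| ≤ L := fun y hy => by
    obtain ⟨p, hp⟩ := q.wmin hy ht
    exact (hL _ hp.hk).1
  have fin : ∀ (F : Filter ℝ), F ≤ nhds x → (∃ l, Tendsto g F (nhds l)) → ∃ l, Tendsto (fun y => ww y t) F (nhds l) := by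
    rintro F hF ⟨l, hl⟩
    refine ⟨2 * C * x - l, ?_⟩
    have := ((tendsto_id.mono_left hF).const_mul (2*C)).sub hl
    exact this.congr fun y => by simp [hg]
  constructor
  · refine fin _ nhdsWithin_le_nhds ⟨_, MonotoneOn.tendsto_nhdsWithin_Ioo_left (x := x) (y := x - 1) (by simp) (hmono.mono ?_) ⟨2 * C * x + L, ?_⟩⟩
    · intro y hy; have := hy.2; show y < x/2; linarith
    · rintro _ ⟨y, hy, rfl⟩
      have := (abs_le.1 (hb y (by linarith [hy.2]))).1; have := Mll hy.2.le (show 0 ≤ 2 * C by linarith); simp only [hg]; linarith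
  · refine fin _ nhdsWithin_le_nhds ⟨_, MonotoneOn.tendsto_nhdsWithin_Ioo_right (x := x) (y := x/2) (by simp; linarith) (hmono.mono ?_) ⟨2 * C * x - L, ?_⟩⟩
    · intro y hy; exact hy.2
    · rintro _ ⟨y, hy, rfl⟩
      have := (abs_le.1 (hb y (by linarith [hy.2]))).2; have := Mll hy.1.le (show 0 ≤ 2 * C by linarith); simp only [hg]; linarith
lemma eq_of_super {g : ℝ → ℝ} {d k x C : ℝ} (hd : HasDerivAt g d x) (h : ∀ᶠ y in nhds x, g y ≤ g x + k * (y - x) + C * (y - x)^2) : k = d := by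
  have hmax : IsLocalMax (fun y => g y - (k * (y - x) + C * (y - x)^2)) x := by
    filter_upwards [h] with y hy; simp; linarith
  have db : HasDerivAt (fun y : ℝ => y - x) 1 x := (hasDerivAt_id x).sub_const x
  have := hmax.hasDerivAt_eq_zero (hd.sub ((db.const_mul k).add ((db.pow 2).const_mul C)))
  simp at this; linarith
lemma deriv_eq (q : QQ) {x t p k : ℝ} (hx : x < 0) (ht : 0 < t) (h : IsMin f E ba m x t p k) {d : ℝ}
    (hd : HasDerivAt (fun y => VV y t) d x) : k = d := by
  obtain ⟨C, hC, hloc⟩ := q.loc (lt_min (show 0 < -x by linarith) ht)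
  refine eq_of_super (C := C) hd (Ef fun y => ?_)
  have := hloc x t p k (by linarith [min_le_left (-x) t]) Mnr h y t
  rw [sub_self, abs_zero, add_zero, sq_abs, mul_zero, sub_zero] at this
  exact this
lemma fd_eq (q : QQ) {x t : ℝ} (hx : x < 0) (ht : 0 < t) (hd : DifferentiableAt ℝ (fun z : Pl => VV z.1 z.2) (x,t)) :
    Dx (fun z : Pl => VV z.1 z.2) (x,t) = ww x t ∧ Dt (fun z : Pl => VV z.1 z.2) (x,t) = - f (ww x t) := by
  obtain ⟨p, hp⟩ := q.wmin hx ht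
  obtain ⟨C, hC, hloc⟩ := q.loc (lt_min (show 0 < -x by linarith) ht)
  have hl := hloc x t p _ (by linarith [min_le_left (-x) t]) Mnr hp
  have sa : HasDerivAt (fun y : ℝ => (y, t)) exz x := (hasDerivAt_id x).prodMk (hasDerivAt_const _ _)
  have h2 : HasDerivAt (fun y : ℝ => (x, y)) et t := (hasDerivAt_const _ _).prodMk (hasDerivAt_id t)
  have db := HasFDerivAt.comp_hasDerivAt (l := fun z : Pl => VV z.1 z.2) (f := fun y => (y,t)) x hd.hasFDerivAt sa
  have dc := HasFDerivAt.comp_hasDerivAt (l := fun z : Pl => VV z.1 z.2) (f := fun y => (x,y)) t hd.hasFDerivAt h2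
  constructor
  · exact (q.deriv_eq hx ht hp db).symm
  · refine (eq_of_super (C := C) dc (Ef fun y => ?_)).symm
    have := hl x y
    rw [sub_self, abs_zero, zero_add, sq_abs, mul_zero, add_zero] at this
    simp only [Function.comp]; linarith
lemma tc (q : QQ) {x td : ℝ} (hx : x < 0) (ht : 0 < td) (hd : DifferentiableAt ℝ (fun y => VV y td) x) :
    Tendsto (fun t => ww x t) (nhds td) (nhds (ww x td)) := by
  obtain ⟨L, tp, hL, hlip⟩ := q.vlip
  have ev : ∀ᶠ t in nhds td, 0 < t := lt_mem_nhds ht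
  refine tl (M := L) ?_ fun ts κ hts hκ => ?_
  · filter_upwards [ev] with t h
    obtain ⟨p, hp⟩ := q.wmin hx h
    exact (hL _ hp.hk).1
  · obtain ⟨N, hN⟩ := eventually_atTop.1 (hts.eventually ev)
    choose p hp using fun n => q.wmin hx (hN (n+N) (by omega))
    have sh := tendsto_add_atTop_nat N
    obtain ⟨pa, _, _, _, hm⟩ := q.sub hp tendsto_const_nhds (hts.comp sh) (hκ.comp sh)
    obtain ⟨p1, hp1⟩ := q.wmin hx ht
    rw [q.deriv_eq hx ht hm hd.hasDerivAt, q.deriv_eq hx ht hp1 hd.hasDerivAt]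
lemma tc0 (q : QQ) {x d : ℝ} (hx : x < 0) (hd : HasDerivAt ba d x) :
    Tendsto (fun t => ww x t) (nhdsWithin 0 (Ioi 0)) (nhds d) := by
  obtain ⟨L, tp, hRL, hEL, hL⟩ := q.adm.bnd
  obtain ⟨c, hc, hslow⟩ := q.slow
  have ha := q.adm.ha
  have hdK : |d| ≤ K := by
    have hK0 : 0 ≤ K := by have := q.hb 0 1; norm_num at this; exact (An).trans this
    have : Lwz K.toNNReal ba := LipschitzWith.of_dist_le_mul fun x y => by
      rw [Re, Re, Real.coe_toNNReal _ hK0]; exact q.hb x y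
    have h2 := norm_deriv_le_of_lipschitz (x₀ := x) this
    rwa [hd.deriv, Real.coe_toNNReal _ hK0] at h2
  have hfd : f d ≤ E := q.adm.hE d (hdK.trans q.hK.le)
  have hRK : 0 < R - K := sub_pos.2 q.hK
  set M := 2 * L / (R - K) + |deriv f d| with hM
  have sw : 0 ≤ M := by positivity
  have main : ∀ ε > 0, ∀ᶠ t in nhdsWithin sf (Ioi 0), a / 2 * (d - ww x t)^2 ≤ ε * M := by
    intro ε hε
    have ho := hd.isLittleO.def hε
    simp only [Ra, smul_eq_mul] at ho
    obtain ⟨r, hr, hball⟩ := Metric.eventually_nhds_iff.1 ho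
    have ev1 : ∀ᶠ t in nhdsWithin sf (Ioi 0), t < c * |x| := nhdsWithin_le_nhds (gt_mem_nhds (mul_pos hc (abs_pos.2 hx.ne)))
    have ev2 : ∀ᶠ t in nhdsWithin sf (Ioi 0), M * t < r := by
      have : Tendsto (fun t => M * t) (nhds 0) (nhds (M * 0)) := (continuous_const.mul continuous_id).tendsto 0
      exact nhdsWithin_le_nhds (this.eventually (gt_mem_nhds (by simpa using hr)))
    have ev3 : ∀ᶠ t in nhdsWithin sf (Ioi 0), M * t < -x := by
      have : Tendsto (fun t => M * t) (nhds 0) (nhds (M * 0)) := (continuous_const.mul continuous_id).tendsto 0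
      exact nhdsWithin_le_nhds (this.eventually (gt_mem_nhds (by simpa using hx)))
    filter_upwards [ev1, ev2, ev3, self_mem_nhdsWithin] with t sa h2 sd ht
    have ht : 0 < t := ht
    obtain ⟨p, hp⟩ := q.wmin hx ht
    set k := ww x t
    have xh : p ≤ 0 := by
      rcases hslow x t p k hx ht hp with h | ⟨h, sk⟩
      · exact h
      · linarith
    have eb := IsMin.cc_eq q hp
    have ea := hp.hp
    have ed := hp.mx
    simp only [G, min_eq_left xh, max_eq_right xh, sub_zero] at eb ea ed
    have le' : ∀ y, y ≤ 0 → VV x t ≤ ba y + cc f E t (x - y) := fun y hy => by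
      have := q.le y x t; simp only [G, min_eq_left hy, max_eq_right hy, sub_zero] at this; linarith
    have bb : |x - p| ≤ 2 * L / (R-K) * t := by
      have ic := le' x hx.le
      have ia := q.adm.coer' t (x - p)
      have ie := (abs_le.1 (q.hb x p)).2
      have i4 := q.adm.lip hL t 0 0 0
      rw [q.adm.zero, sub_self, sub_zero, abs_zero, abs_of_pos ht] at i4
      rw [sub_self] at ic
      have i5 : E * t ≤ L * t := Mlr ((le_abs_self E).trans hEL) ht.le
      rw [div_mul_eq_mul_div, le_div_iff₀ hRK]; nlinarith
    have b1' : |x - p| ≤ M * t := bb.trans (Mlr (by simp only [hM]; linarith [abs_nonneg (deriv f d)]) ht.le)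
    have bd : |deriv f d * t| ≤ M * t := by
      rw [abs_mul, abs_of_pos ht]; refine Mlr ?_ ht.le
      have : 0 ≤ 2 * L / (R-K) := by positivity
      simp only [hM]; linarith
    have o1 := hball (y := p) (by rw [Re, abs_sub_comm]; linarith)
    have o2 := hball (y := x - deriv f d * t) (by rw [Real.dist_eq]; simp only [sub_sub_cancel_left, abs_neg]; linarith)
    have j1 := le' (x - deriv f d * t) (by linarith [(abs_le.1 bd).1])
    rw [sub_sub_cancel] at j1
    have j2 : cc f E t (deriv f d * t) ≤ d * (deriv f d * t) - f d * t := by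
      obtain ⟨ka, kc, kg, ke⟩ := q.adm.argmax t (deriv f d * t)
      rw [kg]
      have := q.adm.uc d ka
      nlinarith [Pn ha.le (sq_nonneg (ka - d))]
    have j3 := q.adm.strong ht.le hp.hk hfd ed
    rw [sub_sub_cancel_left, abs_neg] at o2
    rw [abs_sub_comm p x] at o1
    have o1' := (abs_le.1 o1).1
    have o2' := (abs_le.1 o2).2
    have nb : |x - p| + |deriv f d * t| ≤ M * t := by
      rw [abs_mul, abs_of_pos ht, hM, add_mul]; linarith
    have nd := Mll nb hε.le
    have fin : t * (a / 2 * (d - k)^2) ≤ t * (ε * M) := by nlinarith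
    exact le_of_mul_le_mul_left fin ht
  rw [Metric.tendsto_nhds]
  intro η hη
  filter_upwards [main (a / 2 * η^2 / (2 * (M+1))) ps] with t ht
  rw [Re, abs_sub_comm, ← sq_lt_sq₀ An hη.le, sq_abs]
  have : a / 2 * η^2 / (2 * (M+1)) * M < a / 2 * η^2 := by
    rw [div_mul_eq_mul_div, div_lt_iff₀ ps]
    have : 0 < a / 2 * η^2 := by positivity
    nlinarith
  have h2 := ht.trans_lt this
  exact lt_of_mul_lt_mul_left h2 ps
end QP
namespace QP
variable {a E R θ K ec : ℝ} {f ba m : ℝ → ℝ}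
local notation "QQ" => QP a f E R θ K ec ba m
local notation "ww" => w f E ba m
attribute [local irreducible] V w
def A1 (f : ℝ → ℝ) (E : ℝ) (ba m : ℝ → ℝ) (t κ : ℝ) : Prop := ∃ C, 0 ≤ C ∧ ∀ x, x < 0 → V f E ba m x t ≤ m t + κ * x + C * x^2
def SG (f m : ℝ → ℝ) (t κ : ℝ) : Prop := ∃ C, 0 ≤ C ∧ ∃ δ, 0 < δ ∧ ∀ τ, |τ - t| < δ → m τ ≤ m t - f κ * (τ - t) + C * (τ - t)^2
lemma typeI (q : QQ) {t p κ : ℝ} (ht : 0 < t) (h : IsMin f E ba m 0 t p κ) (hp : max p 0 < t) :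
    A1 f E ba m t κ ∧ SG f m t κ ∧ θ ≤ κ := by
  obtain ⟨Λ, hΛ, hs⟩ := q.sup
  have ha := q.adm.ha
  have se : 0 < t - max p 0 := by linarith
  have sa := hs 0 t p κ h se
  rw [q.Vm ht.le] at sa
  refine ⟨⟨1 / (2 * a * (t - max p 0)), by positivity, fun x hx => ?_⟩, ⟨Λ^2 / (2 * a * (t - max p 0)), by positivity, t, ht, fun τ hτ => ?_⟩, ?_⟩
  · have := sa x t
    rw [sub_self, abs_zero, mul_zero, mul_zero, add_zero, sub_zero, sub_zero, sq_abs] at this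
    rw [div_mul_eq_mul_div, one_mul]; exact this
  · have := sa 0 τ
    rw [q.Vm (by linarith [(abs_lt.1 hτ).1]), sub_self, abs_zero, zero_add, mul_zero, add_zero, mul_pow, sq_abs] at this
    rw [div_mul_eq_mul_div]; exact this
  · exact q.adm.arg_ge q.th se (by linarith [min_le_right p 0]) h.hk h.mx
lemma clus (q : QQ) {t : ℝ} (ht : 0 < t) {x p k : ℕ → ℝ} {κ : ℝ} (hx : ∀ n, x n < 0) (xd : Tendsto x atTop (nhds 0))
    (hm : ∀ n, IsMin f E ba m (x n) t (p n) (k n)) (hk : Tendsto k atTop (nhds κ)) :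
    SG f m t κ ∧ ((θ ≤ κ ∧ A1 f E ba m t κ) ∨ (κ ≤ θ ∧ ∀ te, SG f m t te → f κ ≤ f te)) ∧ ∀ te, A1 f E ba m t te → θ ≤ te → te ≤ κ := by
  obtain ⟨pa, φ, hφ, hp, se⟩ := q.sub hm xd tendsto_const_nhds hk
  have ty := xd.comp hφ.tendsto_atTop
  have sr := hk.comp hφ.tendsto_atTop
  obtain ⟨Λ, hΛ, hs⟩ := q.sup
  obtain ⟨c, hc, hslow⟩ := q.slow
  have ha := q.adm.ha
  have hfc := q.adm.cont
  by_cases hI : max pa 0 < t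
  · obtain ⟨ic, ia, ie⟩ := q.typeI ht se hI
    refine ⟨ia, Or.inl ⟨ie, ic⟩, fun te ⟨cf, hC', sk⟩ _ => ?_⟩
    set tt := t - max pa 0 with hs0
    have hs0' : 0 < tt := by linarith
    have ev : ∀ᶠ n in atTop, tt / 2 < t - max (p (φ n)) 0 := by
      have : Tendsto (fun n => t - max (p (φ n)) 0) atTop (nhds tt) := (hp.max tendsto_const_nhds).const_sub t
      exact this.eventually (lt_mem_nhds ln)
    have la : Tendsto (fun n => k (φ n) - (1 / (a * tt) + cf) * x (φ n)) atTop (nhds κ) := by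
      have := sr.sub (ty.const_mul (1 / (a * tt) + cf)); rw [mul_zero, sub_zero] at this; exact this
    refine ge_of_tendsto la ?_
    filter_upwards [ev] with n hn
    have eb := hs _ _ _ _ (hm (φ n)) ln 0 t
    have ea := sk _ (hx (φ n))
    rw [q.Vm ht.le, sub_self, abs_zero, mul_zero, mul_zero, add_zero, sub_zero, zero_sub, abs_neg, sq_abs] at eb
    have ed : x (φ n)^2 / (2 * a * (t - max (p (φ n)) 0)) ≤ 1 / (a * tt) * x (φ n)^2 := by
      rw [div_mul_eq_mul_div, one_mul]
      exact div_le_div_of_nonneg_left (sq_nonneg _) ps (by nlinarith)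
    have hxn := hx (φ n)
    have : 0 ≤ (te - k (φ n) + (1 / (a * tt) + cf) * x (φ n)) * x (φ n) := by nlinarith
    by_contra hcon
    push Not at hcon
    nlinarith
  · push Not at hI
    have xh : t ≤ pa := by
      rcases le_max_iff.1 hI with h | h
      · exact h
      · linarith
    have ev : ∀ᶠ n in atTop, 0 < p (φ n) := hp.eventually (lt_mem_nhds ln)
    have evs : ∀ᶠ n in atTop, 0 < p (φ n) ∧ c * |x (φ n)| ≤ t - p (φ n) := by
      filter_upwards [ev] with n hn
      exact (hslow _ _ _ _ (hx (φ n)) ht (hm (φ n))).resolve_left ln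
    have hpt : pa = t := by
      refine le_antisymm (le_of_tendsto hp ?_) xh
      filter_upwards [evs] with n hn
      have := Pn hc.le (abs_nonneg (x (φ n))); simp only [Function.comp]; linarith [hn.2]
    subst hpt
    have hcv : ∀ n, 0 < p (φ n) → c * |x (φ n)| ≤ pa - p (φ n) → 0 < pa - p (φ n) := fun n _ h => lt_of_lt_of_le (mul_pos hc (abs_pos.2 (hx _).ne)) h
    have hle : ∀ᶠ n in atTop, k (φ n) ≤ θ := by
      filter_upwards [evs] with n hn
      have := (hm (φ n)).mx
      rw [min_eq_right hn.1.le, max_eq_left hn.1.le] at this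
      exact q.adm.arg_le q.th (hcv n hn.1 hn.2) (by linarith [hx (φ n)]) (hm (φ n)).hk this
    have hκθ : κ ≤ θ := le_of_tendsto sr hle
    obtain ⟨δ, hδ, C, hC, hsc⟩ := q.sc pa ht
    have evd : ∀ᶠ n in atTop, |p (φ n) - pa| < δ := by
      have := (hp.sub_const pa).abs
      rw [sub_self, abs_zero] at this
      exact this.eventually (gt_mem_nhds hδ)
    have evg : ∀ᶠ n in atTop, ∀ tb, |tb - pa| < δ → m tb ≤ m (p (φ n)) - f (k (φ n)) * (tb - p (φ n)) + C * (tb - p (φ n))^2 := by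
      filter_upwards [evs, evd] with n hn hd
      obtain ⟨g, hg⟩ := hsc _ hd
      have hsn := hcv n hn.1 hn.2
      obtain ⟨L, _, -, hL⟩ := q.adm.lipf
      have hmin := hm (φ n)
      have mx := hmin.mx
      have ce := IsMin.cc_eq q hmin
      have hV := hmin.hp
      simp only [G, min_eq_right hn.1.le, max_eq_left hn.1.le] at mx ce hV
      have key : ∀ᶠ τ in nhds (p (φ n)), -f (k (φ n)) * (τ - p (φ n)) + (-(L^2/(2*a*(pa - p (φ n))))) * (τ - p (φ n))^2 ≤ g * (τ - p (φ n)) + C * (τ - p (φ n))^2 := by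
        have eb : ∀ᶠ τ in nhds (p (φ n)), 0 < τ := lt_mem_nhds hn.1
        have ea : ∀ᶠ τ in nhds (p (φ n)), |τ - pa| < δ := (continuous_abs.comp (continuous_id.sub cst)).continuousAt.eventually (gt_mem_nhds hd)
        filter_upwards [eb, ea] with τ sa h2
        have f1 := q.le τ (x (φ n)) pa
        have f2 := q.adm.quad (sl := pa - τ) (da := x (φ n) - 0) hsn hmin.hk mx hL
        have f3 := hg τ h2
        simp only [G, min_eq_right sa.le, max_eq_left sa.le] at f1
        rw [sub_self, abs_zero, zero_add, mul_pow, sq_abs, show (pa - τ - (pa - p (φ n))) = -(τ - p (φ n)) by ring, neg_sq, mul_div_right_comm] at f2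
        linarith
      have hgk : g = -f (k (φ n)) := by
        refine (eq_of_super (g := fun τ => -f (k (φ n)) * (τ - p (φ n))) (C := C + L^2/(2*a*(pa - p (φ n)))) (x := p (φ n)) ?_ ?_)
        · simpa using ((hasDerivAt_id (p (φ n))).sub_const (p (φ n))).const_mul (-f (k (φ n)))
        · filter_upwards [key] with τ hτ
          rw [sub_self, mul_zero]; linarith
      intro tb sk
      have := hg tb sk
      rw [hgk] at this; linarith
    have hmc : Tendsto (fun n => m (p (φ n))) atTop (nhds (m pa)) := by
      have := (q.mcont.tendsto pa).comp hp
      rw [max_eq_left ht.le] at this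
      refine this.congr' ?_
      filter_upwards [ev] with n hn
      simp only [Function.comp, max_eq_left hn.le]
    have hfk := (hfc.tendsto κ).comp sr
    refine ⟨⟨C, hC, δ, hδ, fun tb sk => ?_⟩, Or.inr ⟨hκθ, fun te ⟨cf, hC', δ', hδ', sk⟩ => ?_⟩, fun te ⟨cf, hC', sk⟩ hθκ => ?_⟩
    · have la := (hmc.sub (hfk.mul (hp.const_sub tb))).add (((hp.const_sub tb).pow 2).const_mul C)
      refine ge_of_tendsto la ?_
      filter_upwards [evg] with n hn
      exact hn tb sk
    · have la := ((hp.const_sub pa).const_mul (C + cf)).const_add (f te)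
      rw [sub_self, mul_zero, add_zero] at la
      refine le_of_tendsto_of_tendsto hfk la ?_
      have evd' : ∀ᶠ n in atTop, |p (φ n) - pa| < δ' := by
        have := (hp.sub_const pa).abs
        rw [sub_self, abs_zero] at this
        exact this.eventually (gt_mem_nhds hδ')
      filter_upwards [evg, evd', evs] with n sa h2 sd
      have eb := sa pa (by rwa [sub_self, abs_zero])
      have ea := sk _ h2
      have ed := hcv n sd.1 sd.2
      simp only [Function.comp]
      have : 0 ≤ (pa - p (φ n)) * (f te - f (k (φ n)) + (C + cf) * (pa - p (φ n))) := by nlinarith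
      have := nonneg_of_mul_nonneg_right this ed
      linarith
    · have main : ∀ᶠ n in atTop, a / 2 * c * (θ - k (φ n))^2 ≤ (θ - te) + cf * -x (φ n) := by
        filter_upwards [evs] with n hn
        have eb := sk _ (hx (φ n))
        have hsn := hcv n hn.1 hn.2
        have hmin := hm (φ n)
        have mx := hmin.mx
        have ce := IsMin.cc_eq q hmin
        have hV := hmin.hp
        simp only [G, min_eq_right hn.1.le, max_eq_left hn.1.le, sub_zero] at mx ce hV
        have ea := q.adm.strong hsn.le hmin.hk (q.adm.theta_mem q.th) mx
        have ed := q.up _ _ hn.1.le (show p (φ n) ≤ pa by linarith)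
        have hb0 := q.m0
        have ef := hn.2
        have hxn := hx (φ n)
        rw [abs_of_neg hxn] at ef
        have ej := Mlr ef (Pn (half_pos ha).le (sq_nonneg (θ - k (φ n))))
        have : (-x (φ n)) * (a / 2 * c * (θ - k (φ n))^2) ≤ (-x (φ n)) * ((θ - te) + cf * -x (φ n)) := by nlinarith
        exact le_of_mul_le_mul_left this ln
      have la := ((sr.const_sub θ).pow 2).const_mul (a / 2 * c)
      have l2 := ((ty.neg).const_mul cf).const_add (θ - te)
      have := le_of_tendsto_of_tendsto la l2 main
      rw [neg_zero, mul_zero, add_zero] at this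
      have sa : 0 < a / 2 * c := by positivity
      have h2 : (θ - κ)^2 ≤ 0 := by
        by_contra hh; push Not at hh
        nlinarith
      have sd : θ - κ = 0 := by nlinarith [sq_nonneg (θ - κ)]
      nlinarith [Pn sa.le (sq_nonneg (θ - κ))]
lemma trace (q : QQ) {t : ℝ} (ht : 0 < t) : ∃ κ, Tendsto (fun x => ww x t) (nhdsWithin 0 (Iio 0)) (nhds κ) ∧
    (∀ mc, HasDerivAt m mc t → f κ = -mc) ∧ ((∃ y, y ≤ 0 ∧ m t = ba y + cc f E t (-y)) → θ ≤ κ) := by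
  obtain ⟨L, tp, hL, hlip⟩ := q.vlip
  have wb : ∀ x, x < 0 → |ww x t| ≤ L := fun x hx => by
    obtain ⟨p, hp⟩ := q.wmin hx ht
    exact (hL _ hp.hk).1
  have cl : ∀ (xs : ℕ → ℝ) κ, Tendsto xs atTop (nhdsWithin 0 (Iio 0)) → Tendsto (fun n => ww (xs n) t) atTop (nhds κ) →
      SG f m t κ ∧ ((θ ≤ κ ∧ A1 f E ba m t κ) ∨ (κ ≤ θ ∧ ∀ te, SG f m t te → f κ ≤ f te)) ∧ ∀ te, A1 f E ba m t te → θ ≤ te → te ≤ κ := by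
    intro xs κ sa h2
    obtain ⟨N, hN⟩ := eventually_atTop.1 (sa.eventually snw)
    have hneg : ∀ n, xs (n + N) < 0 := fun n => hN _ (by omega)
    choose p hp using fun n => q.wmin (hneg n) ht
    have sh := tendsto_add_atTop_nat N
    exact q.clus ht hneg ((tendsto_nhds_of_tendsto_nhdsWithin sa).comp sh) hp (h2.comp sh)
  have xb : Tendsto (fun n : ℕ => -ι n) atTop (nhdsWithin 0 (Iio 0)) := by
    refine tendsto_nhdsWithin_iff.2 ⟨by simpa using (tendsto_one_div_add_atTop_nhds_zero_nat (𝕜 := ℝ)).neg, Ef fun n => ?_⟩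
    have : sf < ι n := by positivity
    show -ι n < 0; linarith
  obtain ⟨κ, _, φ, hφ, hκ⟩ := tendsto_subseq_of_bounded (x := fun n : ℕ => ww (-ι n) t) (Metric.isBounded_closedBall (x := sf) (r := L))
    (fun n => by
      have : sf < ι n := by positivity
      rw [mem_closedBall_zero_iff, Real.norm_eq_abs]; exact wb _ ln)
  have c0 := cl _ κ (xb.comp hφ.tendsto_atTop) hκ
  have uniq : ∀ tj ti, tj ≤ θ → ti ≤ θ → f tj = f ti → tj = ti := by
    have key : ∀ tj ti, tj ≤ ti → ti ≤ θ → f tj = f ti → tj = ti := by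
      intro tj ti sa h2 sd
      have eb := q.adm.uc ti tj
      have ea : deriv f ti ≤ 0 := by
        have := deriv_growth q.adm.C2 q.adm.h2 h2
        rw [q.th] at this; have := q.adm.ha; nlinarith
      have ha := q.adm.ha
      have ed : (tj - ti)^2 ≤ 0 := by
        by_contra hh; push Not at hh
        nlinarith [mul_pos ha hh, Pn (neg_nonneg.2 ea) (sub_nonneg.2 sa)]
      nlinarith [sq_nonneg (tj - ti)]
    intro tj ti sa h2 sd
    rcases le_total tj ti with h | h
    · exact key _ _ h h2 sd
    · exact (key _ _ h sa sd.symm).symm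
  refine ⟨κ, tl (M := L) (eventually_nhdsWithin_of_forall fun x hx => wb x hx) fun xs te sa h2 => ?_, fun mc hd => ?_, ?_⟩
  · obtain ⟨s1, ta, ud⟩ := cl xs te sa h2
    obtain ⟨s2, t2, ue⟩ := c0
    rcases ta with ⟨aa, bb⟩ | ⟨aa, bb⟩ <;> rcases t2 with ⟨ab, bd⟩ | ⟨ab, bd⟩
    · exact le_antisymm (ue _ bb aa) (ud _ bd ab)
    · have := ue _ bb aa; linarith
    · have := ud _ bd ab; linarith
    · exact uniq _ _ aa ab (le_antisymm (bb _ s2) (bd _ s1))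
  · obtain ⟨⟨C, _, δ, hδ, h⟩, _⟩ := c0
    have := eq_of_super (k := -f κ) (C := C) hd (by
      filter_upwards [Metric.ball_mem_nhds t hδ] with τ hτ
      have := h τ (by simpa [Real.dist_eq] using hτ); linarith)
    linarith
  · rintro ⟨y, hy, hmy⟩
    obtain ⟨k, kc, kg, ke⟩ := q.adm.argmax t (-y)
    have hmin : IsMin f E ba m 0 t y k := by
      refine ⟨?_, kc, ?_⟩
      · rw [q.Vm ht.le]; simp only [G, min_eq_left hy, max_eq_right hy, sub_zero, zero_sub]; linarith
      · rw [min_eq_left hy, max_eq_right hy, sub_zero, zero_sub]; exact ke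
    obtain ⟨ic, ia, ie⟩ := q.typeI ht hmin (by rwa [max_eq_right hy])
    exact ie.trans (c0.2.2 k ic ie)
end QP
structure NP (ec D : ℝ) (n : ℝ → ℝ) : Prop where
  D0 : 0 ≤ D
  nc : Continuous n
  lo : ∀ tb τ, 0 ≤ tb → tb ≤ τ → n tb ≤ n τ + ec * (τ - tb)
  sc : ∀ σ, 0 < σ → ∃ p, ∀ τ, n τ ≤ n σ + p * (τ - σ) + D / σ * (τ - σ)^2
lemma NP.min {ec D D' : ℝ} {n n' : ℝ → ℝ} (h : NP ec D n) (sk : NP ec D' n') : NP ec (max D D') (fun s => min (n s) (n' s)) where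
  D0 := h.D0.trans Mxl
  nc := h.nc.min sk.nc
  lo := fun tb τ sa h2 => by
    rw [min_add]
    exact min_le_min (h.lo tb τ sa h2) (sk.lo tb τ sa h2)
  sc := fun σ hσ => by
    have key : ∀ d, d ≤ max D D' → ∀ z, d / σ * z^2 ≤ max D D' / σ * z^2 := fun d hd z =>
      Mlr (div_le_div_of_nonneg_right hd hσ.le) (sq_nonneg _)
    rcases le_total (n σ) (n' σ) with hh | hh
    · obtain ⟨p, hp⟩ := h.sc σ hσ
      refine ⟨p, fun τ => (Mnl).trans ?_⟩
      simp only [min_eq_left hh]; linarith [hp τ, key D Mxl (τ - σ)]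
    · obtain ⟨p, hp⟩ := sk.sc σ hσ
      refine ⟨p, fun τ => (Mnr).trans ?_⟩
      simp only [min_eq_right hh]; linarith [hp τ, key D' Mxr (τ - σ)]
lemma arrival {a E R K ec : ℝ} {f ba : ℝ → ℝ} (h : Adm a f E R) (hK0 : 0 ≤ K) (hK : K < R) (hfK : f K ≤ ec) (hE : ec ≤ E)
    (hb : ∀ y sn, |ba y - ba sn| ≤ K * |y - sn|) : ∃ n D, NP ec D n ∧ n 0 = ba 0 ∧
    (∀ σ y, y ≤ 0 → n σ ≤ ba y + cc f E σ (-y)) ∧ ∀ σ, ∃ y, y ≤ 0 ∧ n σ = ba y + cc f E σ (-y) := by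
  have hbc : Continuous ba := by
    have : Lwz K.toNNReal ba := LipschitzWith.of_dist_le_mul fun x y => by
      rw [Re, Re, Real.coe_toNNReal _ hK0]; exact hb x y
    exact this.continuous
  have hco : ∀ σ y, ba 0 + (R - K) * |y| - E * σ ≤ ba y + cc f E σ (-y) := fun σ y => by
    have := h.coer' σ (-y); rw [abs_neg] at this
    have h2 := (abs_le.1 (hb y 0)).1; rw [sub_zero] at h2; linarith
  have ex : ∀ σ, ∃ y, y ≤ 0 ∧ ∀ sn, sn ≤ 0 → ba y + cc f E σ (-y) ≤ ba sn + cc f E σ (-sn) := by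
    intro σ
    have hc : Continuous (fun p : ℝ => ba (-|p|) + cc f E σ (|p|)) :=
      (hbc.comp (by fun_prop)).add (h.continuous.comp (by fun_prop : Continuous fun p : ℝ => (σ, |p|)))
    obtain ⟨p, hp⟩ := hc.exists_forall_le (by
      have : Tendsto (fun p : ℝ => (ba 0 - E * σ) + (R-K) * |p|) (cocompact ℝ) atTop := by
        apply tendsto_atTop_add_const_left
        exact (tendsto_norm_cocompact_atTop (E := ℝ)).const_mul_atTop (sub_pos.2 hK)
      refine tendsto_atTop_mono (fun p => ?_) this
      have := hco σ (-|p|); rw [abs_neg, abs_abs, neg_neg] at this; linarith)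
    refine ⟨-|p|, by simp, fun sn hy => ?_⟩
    have := hp sn
    rw [abs_of_nonpos hy, neg_neg] at this; rw [neg_neg]; exact this
  choose Y hY hYm using ex
  set n := fun σ => ba (Y σ) + cc f E σ (-Y σ) with hn
  obtain ⟨L, tp, hRL, hEL, hL⟩ := h.bnd
  obtain ⟨Λ, hΛ, -, hΛ'⟩ := h.lipf
  have ha := h.ha
  refine ⟨n, Λ^2/(2*a), ⟨by positivity, ?_, ?_, ?_⟩, ?_, fun σ y hy => hYm σ y hy, fun σ => ⟨Y σ, hY σ, rfl⟩⟩
  · have hl : ∀ σ τ, n σ ≤ n τ + L * |σ - τ| := fun σ τ => by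
      have eb := hYm σ (Y τ) (hY τ)
      have ea := h.lip hL σ (-Y τ) τ (-Y τ)
      rw [sub_self, abs_zero, add_zero] at ea; simp only [hn]; linarith
    have : Lwz L.toNNReal n := LipschitzWith.of_dist_le_mul fun x y => by
      rw [Re, Re, Real.coe_toNNReal _ tp.le, abs_le]
      have sa := hl x y; have h2 := hl y x; rw [abs_sub_comm] at h2
      constructor <;> linarith
    exact this.continuous
  · intro tb τ sa h2
    rcases sa.eq_or_lt with se | se
    · subst se
      have eb := hYm 0 0 le_rfl
      rw [neg_zero, h.zero] at eb
      have ed := h.ge τ (-Y τ) (hfK.trans hE)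
      have ef := (abs_le.1 (hb (Y τ) 0)).1
      rw [sub_zero, abs_of_nonpos (hY τ)] at ef
      have ej := Mlr hfK h2
      simp only [hn]; linarith
    · have hτ : 0 < τ := se.trans_le h2
      set l := tb / τ with hl
      have hlτ : l * τ = tb := by rw [hl]; field_simp
      have hl1 : l ≤ 1 := (div_le_one hτ).2 h2
      have hl0 : 0 ≤ l := by positivity
      have eb := hYm tb (l * Y τ) (mul_nonpos_of_nonneg_of_nonpos hl0 (hY τ))
      have ea := h.hom τ (-Y τ) hl0
      rw [hlτ, mul_neg] at ea
      have ed := h.ge τ (-Y τ) (hfK.trans hE)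
      have ef := (abs_le.1 (hb (l * Y τ) (Y τ))).2
      rw [show l * Y τ - Y τ = (1 - l) * (-Y τ) by ring, abs_mul, Ai (sub_nonneg.2 hl1), abs_neg, abs_of_nonpos (hY τ)] at ef
      have ej := Mlr hfK hτ.le
      have e6 := Mll (ed.trans' (show K * (-Y τ) - ec * τ ≤ _ by linarith)) (sub_nonneg.2 hl1)
      simp only [hn]; rw [ea] at eb
      have : ec * (τ - tb) = (1 - l) * (ec * τ) := by rw [← hlτ]; ring
      linarith
  · intro σ hσ
    obtain ⟨k, kc, kg, ke⟩ := h.argmax σ (-Y σ)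
    refine ⟨-f k, fun τ => ?_⟩
    have eb := hYm τ (Y σ) (hY σ)
    have ea := h.quad (sl := τ) (da := -Y σ) hσ kc ke hΛ'
    rw [sub_self, abs_zero, zero_add, mul_pow, sq_abs] at ea
    have : Λ^2/(2*a)/σ * (τ-σ)^2 = Λ^2 * (τ-σ)^2 / (2*a*σ) := by field_simp
    simp only [hn]; rw [this]; linarith
  · apply le_antisymm
    · have := hYm 0 0 le_rfl; rwa [neg_zero, h.zero, add_zero] at this
    · have := hco 0 (Y 0)
      rw [mul_zero, sub_zero] at this
      have := Pn (sub_pos.2 hK).le (abs_nonneg (Y 0)); simp only [hn]; linarith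
lemma build {ec D γ : ℝ} {n : ℝ → ℝ} (h : NP ec D n) (hγ : γ ≤ ec) : ∃ m : ℝ → ℝ, m 0 = n 0 ∧ (∀ t, 0 ≤ t → m t ≤ n t) ∧
    (∀ tb τ, 0 ≤ tb → tb ≤ τ → m τ ≤ m tb - γ * (τ - tb)) ∧ (∀ tb τ, 0 ≤ tb → tb ≤ τ → m tb ≤ m τ + ec * (τ - tb)) ∧
    (∀ t, 0 < t → ∃ δ > 0, ∃ C ≥ 0, ∀ τ, |τ - t| < δ → ∃ p, ∀ tb, |tb - t| < δ → m tb ≤ m τ + p * (tb - τ) + C * (tb - τ)^2) ∧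
    (∀ t mc, 0 < t → HasDerivAt m mc t → mc ≤ -γ ∧ (mc = -γ ∨ m t = n t)) := by
  have ex : ∀ t, ∃ σ, 0 ≤ t → (0 ≤ σ ∧ σ ≤ t ∧ ∀ s, 0 ≤ s → s ≤ t → n σ - γ * (t - σ) ≤ n s - γ * (t - s)) := by
    intro t
    by_cases ht : 0 ≤ t
    · obtain ⟨σ, sa, h2⟩ := isCompact_Icc.exists_isMinOn (nonempty_Icc.2 ht) (show Continuous fun s => n s - γ * (t - s) from h.nc.sub (by fun_prop)).continuousOn
      exact ⟨σ, fun _ => ⟨sa.1, sa.2, fun s a b => h2 ⟨a, b⟩⟩⟩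
    · exact ⟨0, fun h => absurd h ht⟩
  choose σ hσ using ex
  set m := fun t => n (σ t) - γ * (t - σ t) with hm
  have up : ∀ tb τ, 0 ≤ tb → tb ≤ τ → m τ ≤ m tb - γ * (τ - tb) := fun tb τ sa h2 => by
    obtain ⟨aa, ab, ac⟩ := hσ tb sa
    have := (hσ τ (sa.trans h2)).2.2 _ aa (ab.trans h2)
    simp only [hm]; linarith
  have sup : ∀ τ s, 0 ≤ τ → 0 ≤ s → s ≤ τ → m τ ≤ n s - γ * (τ - s) := fun τ s se sa h2 => (hσ τ se).2.2 s sa h2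
  refine ⟨m, ?_, fun t ht => ?_, up, ?_, ?_, ?_⟩
  · obtain ⟨aa, ab, _⟩ := hσ 0 le_rfl
    have : σ 0 = 0 := le_antisymm ab aa
    simp [hm, this]
  · have := sup t t ht ht le_rfl; linarith
  · intro tb τ sa h2
    obtain ⟨aa, ab, _⟩ := hσ τ (sa.trans h2)
    rcases le_total (σ τ) tb with sd | sd
    · have e := sup tb (σ τ) sa aa sd
      have := Mlr hγ (sub_nonneg.2 h2)
      simp only [hm] at e ⊢; linarith
    · have e := sup tb tb sa sa le_rfl
      have ea := h.lo tb (σ τ) sa sd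
      have := Mlr hγ (sub_nonneg.2 ab)
      simp only [hm] at e ⊢; linarith
  · intro t ht
    have hD := h.D0
    refine ⟨t/8, by positivity, 2 * D / t, by positivity, fun τ hτ => ?_⟩
    have hτ' := abs_lt.1 hτ
    obtain ⟨aa, ab, _⟩ := hσ τ ln
    rcases le_total (σ τ) (t/2) with sd | sd
    · refine ⟨-γ, fun tb sk => ?_⟩
      have h'' := abs_lt.1 sk
      have e := sup tb (σ τ) ln aa ln
      have : 0 ≤ 2 * D / t * (tb - τ)^2 := by positivity
      simp only [hm] at e ⊢; linarith
    · obtain ⟨p, hp⟩ := h.sc (σ τ) ln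
      refine ⟨p, fun tb sk => ?_⟩
      have h'' := abs_lt.1 sk
      have e := sup tb (σ τ + tb - τ) ln ln ln
      have ea := hp (σ τ + tb - τ)
      rw [show σ τ + tb - τ - σ τ = tb - τ by ring] at ea
      have : D / σ τ * (tb - τ)^2 ≤ 2 * D / t * (tb - τ)^2 := by
        refine Mlr ?_ (sq_nonneg _)
        rw [div_le_div_iff₀ ln ht]; nlinarith
      simp only [hm] at e ⊢; linarith
  · intro t mc ht hd
    have hd0 := hd
    refine ⟨?_, ?_⟩
    · have := (hasDerivWithinAt_iff_tendsto_slope' (s := Ioi t) (by simp)).1 hd.hasDerivWithinAt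
      refine le_of_tendsto this (eventually_nhdsWithin_of_forall fun τ hτ => ?_)
      have hτ : t < τ := hτ
      have := up t τ ht.le hτ.le
      rw [slope_def_field, div_le_iff₀ ln]; linarith
    · obtain ⟨aa, ab, _⟩ := hσ t ht.le
      rcases ab.eq_or_lt with sd | sd
      · right; simp [hm, sd]
      · left
        refine (QP.eq_of_super (k := -γ) (C := 0) hd ?_).symm
        filter_upwards [lt_mem_nhds sd] with τ hτ
        have := sup τ (σ t) ln aa hτ.le
        simp only [hm] at this ⊢; linarith
lemma int_fd0 {F : Pl → ℝ} (h : ContDiff ℝ 1 F) (hc : Hcs F) (v : Pl) :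
    Integrable (fun p => fderiv ℝ F p v) ∧ ∫ p, fderiv ℝ F p v = 0 := by
  have ic : Integrable (fun p => fderiv ℝ F p v) := 
    ((h.continuous_fderiv nn).clm_apply cst).integrable_of_hasCompactSupport (hc.fderiv_apply (𝕜 := ℝ) v)
  have := integral_mul_fderiv_eq_neg_fderiv_mul_of_integrable (μ := (volume : Measure (Pl))) (f := fun _ => so) (g := F) (v := v)
    (by simp) (by simpa using ic) (by simpa using h.continuous.integrable_of_hasCompactSupport hc)
    (fun x _ => differentiableAt_const _) (fun x _ => h.differentiable nn x)
  exact ⟨ic, by simpa using this⟩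
lemma entA {f η e q : ℝ → ℝ} (hf : ContDiff ℝ 1 f) (he : ContDiff ℝ 1 e) (cη : ContDiff ℝ 1 η) (cq : ContDiff ℝ 1 q)
    (hη : ∀ z, HasDerivAt η (e z) z) (hq : ∀ z, HasDerivAt q (e z * deriv f z) z) {w φ : Pl → ℝ} (hw : ContDiff ℝ 2 w)
    (sa : ContDiff ℝ 1 φ) (hc : Hcs φ) (se : ∀ p, 0 ≤ φ p) {C L : ℝ} (hC : 0 ≤ C) (bb : ∀ z, |e z| ≤ 2)
    (bd : ∀ z, 0 ≤ deriv e z ∧ deriv e z ≤ L)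
    (hr : ∀ p, φ p ≠ 0 → Dt w p ≤ - f Dx w p)
    (ux : ∀ p, φ p ≠ 0 → Dx (fun p => Dx w p) p ≤ C) :
    0 ≤ ∫ p, (η Dx w p * Dt φ p + q Dx w p * Dx φ p
      + (- Dt w p - f Dx w p) * (C * L * φ p + 2 * |Dx φ p|)) := by
  set u : Pl → ℝ := fun p => Dx w p with hu
  set wt : Pl → ℝ := fun p => Dt w p with hwt
  have tu : ∀ v, ContDiff ℝ 1 (fun p => fderiv ℝ w p v) := fun v =>
    (hw.fderiv_right (m := 1) nn).clm_apply contDiff_const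
  have cu : ContDiff ℝ 1 u := tu _
  have cwt : ContDiff ℝ 1 wt := tu _
  have sy : ∀ p, Dt u p = Dx wt p := by
    intro p
    have hD : DifferentiableAt ℝ (fderiv ℝ w) p := (hw.fderiv_right (m := 1) nn).differentiable nn p
    have hs := (hw.contDiffAt (x := p)).isSymmSndFDerivAt (by simp)
    rw [hu, hwt, fderiv_clm_apply hD (differentiableAt_const _), fderiv_clm_apply hD (differentiableAt_const _)]
    simpa using hs (0,1) (1,0)
  have hcv : ∀ v, Continuous (fun p => fderiv ℝ φ p v) := fun v => (sa.continuous_fderiv nn).clm_apply cst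
  have hcs : ∀ v, Hcs (fun p => fderiv ℝ φ p v) := fun v => hc.fderiv_apply (𝕜 := ℝ) v
  have db : ∀ {F : Pl → ℝ}, ContDiff ℝ 1 F → ∀ p, HasFDerivAt F (fderiv ℝ F p) p := fun h p => (h.differentiable nn p).hasFDerivAt
  have ca : ContDiff ℝ 1 (fun p => η (u p) * φ p) := (cη.comp cu).mul sa
  have c2 : ContDiff ℝ 1 (fun p => q (u p) * φ p) := (cq.comp cu).mul sa
  have cr : ContDiff ℝ 1 (fun p => - wt p - f (u p)) := cwt.neg.sub (hf.comp cu)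
  have cb : ContDiff ℝ 1 (fun p => (- wt p - f (u p)) * (e (u p) * φ p)) := cr.mul ((he.comp cu).mul sa)
  obtain ⟨ic, z1⟩ := int_fd0 ca hc.mul_left (0,1)
  obtain ⟨ia, z2⟩ := int_fd0 c2 hc.mul_left (1,0)
  obtain ⟨ie, z3⟩ := int_fd0 cb hc.mul_left.mul_left (1,0)
  have hz : ∫ p, (Dt (fun p => η (u p) * φ p) p + Dx (fun p => q (u p) * φ p) p
      + fderiv ℝ (fun p => (- wt p - f (u p)) * (e (u p) * φ p)) p (1,0)) = 0 := by
    have j := integral_add (ic.add ia) ie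
    have j2 := integral_add ic ia
    simp only [Pi.add_apply] at j
    rw [j, j2, z1, z2, z3]; simp
  refine hz.symm.trans_le (integral_mono ((ic.add ia).add ie) ?_ fun p => ?_)
  · have J : ∀ {g ψ : Pl → ℝ}, Continuous g → Continuous ψ → Hcs ψ → Integrable (fun p => g p * ψ p) := 
      fun hg hψ hs => (hg.mul hψ).integrable_of_hasCompactSupport hs.mul_left
    have := ((J (cη.comp cu).continuous (hcv (0,1)) (hcs _)).add (J (cq.comp cu).continuous (hcv (1,0)) (hcs _))).add
      (((J cr.continuous sa.continuous hc).const_mul (C * L)).add ((J cr.continuous (hcv (1,0)).abs (hcs _).norm).const_mul 2))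
    refine this.congr (Ef fun p => ?_)
    simp only [Pi.add_apply, Function.comp, hu, hwt]; ring
  · have du := db cu p
    have eb := ((hη (u p)).comp_hasFDerivAt p du).mul (db sa p)
    have ea := ((hq (u p)).comp_hasFDerivAt p du).mul (db sa p)
    have hfd : HasDerivAt f (deriv f (u p)) (u p) := (hf.differentiable nn _).hasDerivAt
    have hed : HasDerivAt e (deriv e (u p)) (u p) := (he.differentiable nn _).hasDerivAt
    have ed := ((db cwt p).neg.sub (hfd.comp_hasFDerivAt p du)).mul ((hed.comp_hasFDerivAt p du).mul (db sa p))
    have eg : fderiv ℝ (fun p => η (u p) * φ p) p = _ := eb.fderiv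
    have eh : fderiv ℝ (fun p => q (u p) * φ p) p = _ := ea.fderiv
    have E3 : fderiv ℝ (fun p => (- wt p - f (u p)) * (e (u p) * φ p)) p = _ := ed.fderiv
    simp only [eg, eh, E3]
    simp only [_root_.add_apply, _root_.smul_apply, _root_.sub_apply, _root_.neg_apply, smul_eq_mul, Function.comp, Pi.sub_apply, Pi.neg_apply, sy, Pi.mul_apply]
    by_cases hp : φ p = 0
    · rw [fd_min se hp, hp]; simp
    · have st : 0 ≤ - wt p - f (u p) := by have := hr p hp; simp only [hwt, hu]; linarith
      have kc : deriv e (u p) * Dx u p ≤ C * L := by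
        have := ux p hp
        have := Mll this (bd (u p)).1
        have := Mll (bd (u p)).2 hC
        linarith
      have kg : e (u p) * Dx φ p ≤ 2 * |Dx φ p| := by
        refine (le_abs_self _).trans ?_; rw [abs_mul]; exact Mlr (bb _) An
      have ke := Mlr kc (se p)
      have k4 := Mll (add_le_add ke kg) st
      change _ ≤ η (u p) * _ + q (u p) * _ + (- wt p - f (u p)) * _
      linarith
lemma nx : ‖exz‖ = 1 := by simp [Prod.norm_def]
lemma nt : ‖et‖ = 1 := by simp [Prod.norm_def]
structure SC (a : ℝ) (f : ℝ → ℝ) (W : Pl → ℝ) (ε C : ℝ) : Prop where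
  ha : 0 < a
  C2 : ContDiff ℝ 2 f
  h2 : ∀ w, a ≤ deriv (deriv f) w
  hε : 0 < ε
  hC : 0 ≤ C
  hj : ∀ᵐ p : Pl, p.1 < -ε → ε < p.2 → Dt W p = - f Dx W p
  sc : ∀ h, 0 < h → ∀ᵐ p : Pl, p.1 + h < -ε → ε < p.2 → Dx W (p + (h,0)) ≤ Dx W p + C * h
lemma SC.reg {a ε C : ℝ} {f : ℝ → ℝ} {W : Pl → ℝ} (S : SC a f W ε C) {K : NNReal} (hW : Lwz K W) {j : ℕ} (hj : ι j < ε / 2)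
    {p : Pl} (sa : p.1 < - (2 * ε)) (h2 : 2 * ε < p.2) : 
    Dt (moll j W) p ≤ - f Dx (moll j W) p ∧ Dx (fun p => Dx (moll j W) p) p ≤ C := by
  have hε := S.hε
  have near : ∀ q : Pl, ‖q‖ < ι j → |q.1| < ε / 2 ∧ |q.2| < ε / 2 := fun q hq =>
    ⟨(norm_fst_le q).trans_lt (hq.trans hj), (norm_snd_le q).trans_lt (hq.trans hj)⟩
  constructor
  · set u := Dx (moll j W) p with hu
    have e : ((deriv f u, 1) : Pl) = deriv f u • exz + et := by ext <;> simp
    have := moll_fderiv_le hW j p (deriv f u, 1) (c := deriv f u * u - f u) (by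
      filter_upwards [S.hj] with q hq hn
      obtain ⟨nb, nd⟩ := near _ hn
      rw [abs_lt] at nb nd
      simp only [Prod.fst_sub, Prod.snd_sub] at nb nd
      rw [e, map_add, map_smul, hq ln ln, smul_eq_mul]
      have := uconv S.C2 S.h2 u Dx W q
      have := Pn S.ha.le (sq_nonneg (Dx W q - u))
      linarith)
    rw [e, map_add, map_smul, ← hu, smul_eq_mul] at this
    linarith
  · have cu : ContDiff ℝ 1 (fun p => Dx (moll j W) p) :=
      ((moll_contDiff j hW.continuous 2).fderiv_right (m := 1) nn).clm_apply contDiff_const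
    set u := fun p => Dx (moll j W) p with hu
    have key : ∀ h, 0 < h → h < ε / 2 → u (p + (h,0)) - u p ≤ C * h := by
      intro h hh hlt
      have mm : ∀ p : Pl, Measurable fun q => lineDeriv ℝ W (p - q) (1,0) := fun p =>
        (measurable_lineDeriv hW.continuous).comp (measurable_const.sub measurable_id)
      have ii : ∀ p : Pl, Integrable fun q => mker j q * lineDeriv ℝ W (p - q) (1,0) := fun p =>
        (mker_integrable j).mul_bdd (c := K * ‖exz‖) (mm p).aestronglyMeasurable (Ef fun q => lineDeriv_bdd hW _ _)
      simp only [hu]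
      rw [moll_fderiv hW, moll_fderiv hW, ← integral_sub (ii _) (ii _)]
      simp_rw [← mul_sub]
      refine mker_le (M := K * ‖exz‖ + K * ‖exz‖) ((mm _).sub (mm _)) (fun q => (abs_sub _ _).trans (add_le_add (lineDeriv_bdd hW _ _) (lineDeriv_bdd hW _ _))) ?_
      have hd := hW.ae_differentiableAt (μ := (volume : Measure (Pl)))
      filter_upwards [(Measure.measurePreserving_sub_left volume p).quasiMeasurePreserving.ae hd,
        (Measure.measurePreserving_sub_left volume (p + (h,0))).quasiMeasurePreserving.ae hd,
        (Measure.measurePreserving_sub_left volume p).quasiMeasurePreserving.ae (S.sc h hh)] with q q1 q2 q3 hn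
      obtain ⟨nb, nd⟩ := near _ hn
      rw [abs_lt] at nb nd
      rw [q1.lineDeriv_eq_fderiv, q2.lineDeriv_eq_fderiv, show p + (h,0) - q = p - q + (h,0) by abel]
      have := q3 (by simp only [Prod.fst_sub]; linarith) (by simp only [Prod.snd_sub]; linarith)
      linarith
    have hd := ((cu.differentiable nn p).hasFDerivAt.hasLineDerivAt (1,0))
    have ht := hd.tendsto_slope_zero_right
    refine le_of_tendsto ht ?_
    filter_upwards [Ioo_mem_nhdsGT (show sf < ε/2 by linarith)] with h hh
    have := key h hh.1 hh.2
    have e : p + h • exz = p + (h,0) := by simp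
    rw [e, smul_eq_mul, inv_mul_le_iff₀ hh.1]
    linarith
lemma entB {a ε C : ℝ} {f : ℝ → ℝ} {W : Pl → ℝ} (S : SC a f W ε C) {K : NNReal} (hW : Lwz K W) 
    {η e q : ℝ → ℝ} (he : ContDiff ℝ 1 e) (cη : ContDiff ℝ 1 η) (cq : ContDiff ℝ 1 q)
    (hη : ∀ z, HasDerivAt η (e z) z) (hq : ∀ z, HasDerivAt q (e z * deriv f z) z) {φ : Pl → ℝ}
    (sa : ContDiff ℝ 1 φ) (hc : Hcs φ) (se : ∀ p, 0 ≤ φ p) {L : ℝ} (bb : ∀ z, |e z| ≤ 2)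
    (bd : ∀ z, 0 ≤ deriv e z ∧ deriv e z ≤ L) (hs : ∀ p, -(2 * ε) ≤ p.1 ∨ p.2 ≤ 2 * ε → φ p = 0) :
    0 ≤ ∫ p, (η Dx W p * Dt φ p + q Dx W p * Dx φ p) := by
  have hε := S.hε
  have hf := S.C2.of_le (m := 1) nn
  have tw : ∀ p, φ p ≠ 0 → p.1 < -(2 * ε) ∧ 2 * ε < p.2 := fun p hp => by
    constructor <;> (by_contra h; exact hp (hs p (by first | exact Or.inl (not_lt.1 h) | exact Or.inr (not_lt.1 h))))
  have hcv : ∀ v, Continuous (fun p => fderiv ℝ φ p v) := fun v => (sa.continuous_fderiv nn).clm_apply cst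
  have hcs : ∀ v, Hcs (fun p => fderiv ℝ φ p v) := fun v => hc.fderiv_apply (𝕜 := ℝ) v
  have ia : ∀ v, Integrable (fun p => fderiv ℝ φ p v) := fun v => (hcv v).integrable_of_hasCompactSupport (hcs v)
  obtain ⟨md, ma, B1⟩ := bdd_on cη.continuous K
  obtain ⟨me, mb, B2⟩ := bdd_on cq.continuous K
  obtain ⟨M3, m3, B3⟩ := bdd_on hf.continuous K
  have bx : ∀ j p, |Dx (moll j W) p| ≤ K := fun j p => by simpa [nx] using moll_fderiv_bdd hW j p (1,0)
  have bt : ∀ j p, |Dt (moll j W) p| ≤ K := fun j p => by simpa [nt] using moll_fderiv_bdd hW j p (0,1)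
  have lim : Tendsto (fun j => ∫ p, (η Dx (moll j W) p * Dt φ p + q Dx (moll j W) p * Dx φ p
      + (- Dt (moll j W) p - f Dx (moll j W) p) * (C * L * φ p + 2 * |Dx φ p|))) atTop
      (nhds (∫ p, (η Dx W p * Dt φ p + q Dx W p * Dx φ p))) := by
    apply tendsto_integral_of_dominated_convergence (fun p => md * |Dt φ p| + me * |Dx φ p| + (K + M3) * |(C * L * φ p + 2 * |Dx φ p|)|)
    · intro j
      have := fun v => meas_fd (g := moll j W) v
      have := fun v => meas_fd (g := φ) v
      exact ((((cη.continuous.measurable.comp (meas_fd _)).mul (meas_fd _)).add ((cq.continuous.measurable.comp (meas_fd _)).mul (meas_fd _))).add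
        (((meas_fd _).neg.sub (hf.continuous.measurable.comp (meas_fd _))).mul ((sa.continuous.measurable.const_mul _).add ((meas_fd _).abs.const_mul 2)))).aestronglyMeasurable
    · exact (((ia _).abs.const_mul _).add ((ia _).abs.const_mul _)).add
        ((((sa.continuous.integrable_of_hasCompactSupport hc).const_mul _).add ((ia _).abs.const_mul 2)).abs.const_mul _)
    · intro j
      filter_upwards with p
      rw [Real.norm_eq_abs]
      refine (abs_add_le _ _).trans (add_le_add ((abs_add_le _ _).trans ?_) ?_)
      · rw [abs_mul, abs_mul]
        exact add_le_add (Mlr (B1 _ (bx j p)) An) (Mlr (B2 _ (bx j p)) An)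
      · rw [abs_mul]
        refine Mlr ((abs_sub _ _).trans ?_) An
        rw [abs_neg]
        exact add_le_add (bt j p) (B3 _ (bx j p))
    · filter_upwards [moll_fderiv_tendsto hW (0,1), moll_fderiv_tendsto hW (1,0), S.hj] with p ta t2 t3
      have := ((((cη.continuous.tendsto _).comp t2).mul_const Dt φ p).add (((cq.continuous.tendsto _).comp t2).mul_const Dx φ p)).add
        ((ta.neg.sub ((hf.continuous.tendsto _).comp t2)).mul_const (C * L * φ p + 2 * |Dx φ p|))
      suffices e : (- Dt W p - f Dx W p) * (C * L * φ p + 2 * |Dx φ p|) = 0 by rw [e, add_zero] at this; exact this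
      by_cases hp : φ p = 0
      · rw [fd_min se hp, hp]; simp
      · rw [t3 (by linarith [(tw p hp).1]) (by linarith [(tw p hp).2])]; ring
  refine ge_of_tendsto lim ?_
  filter_upwards [inv_lt_ev (half_pos hε)] with j hj
  exact entA hf he cη cq hη hq (moll_contDiff j hW.continuous 2) sa hc se S.hC bb bd
    (fun p hp => (S.reg hW hj (tw p hp).1 (tw p hp).2).1) (fun p hp => (S.reg hW hj (tw p hp).1 (tw p hp).2).2)
def en (k : ℝ) (n : ℕ) (s : ℝ) : ℝ := Real.arctan (n * (s - k))
lemma en_cd (k : ℝ) (n : ℕ) : ContDiff ℝ 1 (en k n) := Real.contDiff_arctan.comp (by fun_prop)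
lemma en_b (k : ℝ) (n : ℕ) (s : ℝ) : |en k n s| ≤ 2 := by
  have sa := Real.arctan_lt_pi_div_two (n * (s - k)); have h2 := Real.neg_pi_div_two_lt_arctan (n * (s - k)); have := Real.pi_le_four
  rw [en, abs_le]; constructor <;> linarith
lemma en_d (k : ℝ) (n : ℕ) (z : ℝ) : 0 ≤ deriv (en k n) z ∧ deriv (en k n) z ≤ n := by
  have h : HasDerivAt (en k n) (1 / (1 + (n * (z - k))^2) * (n * 1)) z :=
    (((hasDerivAt_id z).sub_const k).const_mul (n:ℝ)).arctan
  have sa : 1 / (1 + (n * (z - k))^2) ≤ 1 := by rw [div_le_one ps]; linarith [sq_nonneg (n * (z - k))]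
  rw [h.deriv, mul_one]
  exact ⟨by positivity, by simpa using Mlr sa (Nat.cast_nonneg (α := ℝ) n)⟩
lemma en_int {g : ℝ → ℝ} (hg : Continuous g) (k z : ℝ) : Tendsto (fun n => ∫ s in k..z, en k n s * g s) atTop
    (nhds (Real.pi / 2 * (Real.sign (z - k) * ∫ s in k..z, g s))) := by
  rw [← mul_assoc, ← intervalIntegral.integral_const_mul]
  apply intervalIntegral.tendsto_integral_filter_of_dominated_convergence (fun s => 2 * |g s|)
  · exact Ef fun n => ((en_cd k n).continuous.mul hg).aestronglyMeasurable
  · refine Ef fun n => Ef fun s _ => ?_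
    rw [Ra, abs_mul]; exact Mlr (en_b _ _ _) An
  · exact (hg.abs.const_mul 2).intervalIntegrable _ _
  · filter_upwards [compl_mem_ae_iff.2 (measure_singleton k)] with s hs hz
    refine Tendsto.mul_const _ ?_
    have hs : s ≠ k := hs
    have tn : Tendsto (fun n : ℕ => (n:ℝ)) atTop atTop := tendsto_natCast_atTop_atTop
    rcases lt_or_gt_of_ne hs with h | h
    · have : z < k := by by_contra hh; rw [uIoc_of_le (not_lt.1 hh)] at hz; linarith [hz.1]
      rw [Real.sign_of_neg (sub_neg.2 this), mul_neg_one]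
      exact (tendsto_nhdsWithin_iff.1 (Real.tendsto_arctan_atBot.comp (tn.atTop_mul_const_of_neg (sub_neg.2 h)))).1
    · have : k < z := by by_contra hh; rw [uIoc_of_ge (not_lt.1 hh)] at hz; linarith [hz.2]
      rw [Real.sign_of_pos (sub_pos.2 this), mul_one]
      exact (tendsto_nhdsWithin_iff.1 (Real.tendsto_arctan_atTop.comp (tn.atTop_mul_const (sub_pos.2 h)))).1
lemma entC {a ε C : ℝ} {f : ℝ → ℝ} {W : Pl → ℝ} (S : SC a f W ε C) {K : NNReal} (hW : Lwz K W) (k : ℝ)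
    {φ : Pl → ℝ} (sa : ContDiff ℝ 1 φ) (hc : Hcs φ) (se : ∀ p, 0 ≤ φ p)
    (hs : ∀ p, -(2 * ε) ≤ p.1 ∨ p.2 ≤ 2 * ε → φ p = 0) : 0 ≤ ∫ p, kint f W k φ p := by
  have hf := S.C2.of_le (m := 1) nn
  have hdf : Continuous (deriv f) := hf.continuous_deriv nn
  have ia : ∀ v, Integrable (fun p => fderiv ℝ φ p v) := fun v =>
    ((sa.continuous_fderiv nn).clm_apply cst).integrable_of_hasCompactSupport (hc.fderiv_apply (𝕜 := ℝ) v)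
  have bx : ∀ p, |Dx W p| ≤ K := fun p => by simpa [nx] using fderiv_bdd hW p (1,0)
  have hI : ∀ {g : ℝ → ℝ}, Continuous g → ∀ n z, HasDerivAt (fun z => ∫ s in k..z, en k n s * g s) (en k n z * g z) z := fun hg n z =>
    ((en_cd k n).continuous.mul hg).integral_hasStrictDerivAt k z |>.hasDerivAt
  have cI : ∀ {g : ℝ → ℝ}, Continuous g → ∀ n, ContDiff ℝ 1 (fun z => ∫ s in k..z, en k n s * g s) := fun hg n => by
    rw [contDiff_one_iff_deriv]
    refine ⟨fun z => (hI hg n z).differentiableAt, ?_⟩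
    rw [show deriv (fun z => ∫ s in k..z, en k n s * _) = _ from funext fun z => (hI hg n z).deriv]
    exact (en_cd k n).continuous.mul hg
  have bI : ∀ {g : ℝ → ℝ}, Continuous g → ∃ M, ∀ (n : ℕ) (z : ℝ), |z| ≤ (K:ℝ) → |∫ s in k..z, en k n s * g s| ≤ M := fun {g} hg => by
    obtain ⟨M, hM, hB⟩ := bdd_on hg (K + |k|)
    refine ⟨2 * M * (K + |k|), fun n z hz => ?_⟩
    rw [← Real.norm_eq_abs]
    refine (intervalIntegral.norm_integral_le_of_norm_le_const (C := 2 * M) fun s hs => ?_).trans ?_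
    · rw [Ra, abs_mul]
      refine mul_le_mul (en_b _ _ _) (hB s ?_) An zero_le_two
      have := uIoc_subset_uIcc hs
      rw [mem_uIcc] at this
      rw [abs_le] at hz ⊢
      have := neg_abs_le k; have := le_abs_self k
      have := abs_nonneg k; have := K.2
      constructor <;> rcases ‹_ ∨ _› with h | h <;> linarith [h.1, h.2]
    · exact Mll ((abs_sub _ _).trans (add_le_add_left hz _)) ps
  obtain ⟨md, B1⟩ := bI (continuous_const (y := so))
  obtain ⟨me, B2⟩ := bI hdf
  have lim : Tendsto (fun n => ∫ p, ((∫ s in k..Dx W p, en k n s * 1) * Dt φ p + (∫ s in k..Dx W p, en k n s * deriv f s) * Dx φ p)) atTop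
      (nhds (∫ p, Real.pi / 2 * kint f W k φ p)) := by
    apply tendsto_integral_of_dominated_convergence (fun p => md * |Dt φ p| + me * |Dx φ p|)
    · intro n
      exact ((((cI cst n).continuous.measurable.comp (meas_fd _)).mul (meas_fd _)).add (((cI hdf n).continuous.measurable.comp (meas_fd _)).mul (meas_fd _))).aestronglyMeasurable
    · exact (((ia _).abs.const_mul _).add ((ia _).abs.const_mul _))
    · intro n
      filter_upwards with p
      rw [Real.norm_eq_abs]
      refine (abs_add_le _ _).trans ?_
      rw [abs_mul, abs_mul]
      exact add_le_add (Mlr (B1 n _ (bx p)) An) (Mlr (B2 n _ (bx p)) An)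
    · filter_upwards with p
      have := ((en_int (continuous_const (y := so)) k Dx W p).mul_const Dt φ p).add ((en_int hdf k Dx W p).mul_const Dx φ p)
      convert this using 2
      rw [intervalIntegral.integral_deriv_eq_sub (fun x _ => hf.differentiable nn x) (hdf.intervalIntegrable _ _), kint]
      simp only [intervalIntegral.integral_const, smul_eq_mul, mul_one, sign_mul_self']
      ring
  have := ge_of_tendsto lim (Ef fun n => entB S hW (en_cd k n) (cI cst n) (cI hdf n) (fun z => by simpa using hI (continuous_const (y := so)) n z)
    (fun z => hI hdf n z) sa hc se (en_b k n) (en_d k n) hs)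
  rw [integral_const_mul] at this
  exact (mul_nonneg_iff_of_pos_left ps).1 this
lemma shift_lim {φ : Pl → ℝ} (sa : ContDiff ℝ 1 φ) (hc : Hcs φ)
    {P Q : Pl → ℝ} (hP : Measurable P) (hQ : Measurable Q) {M : ℝ} (hPM : ∀ p, |P p| ≤ M) (hQM : ∀ p, |Q p| ≤ M) :
    Tendsto (fun n : ℕ => ∫ p, (P p * fderiv ℝ (fun p => φ (p + ι n • (so,(-1:ℝ)))) p (0,1) + Q p * fderiv ℝ (fun p => φ (p + ι n • (so,(-1:ℝ)))) p (1,0))) atTop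
      (nhds (∫ p, (P p * Dt φ p + Q p * Dx φ p))) := by
  have hcv : ∀ v, Continuous (fun p => fderiv ℝ φ p v) := fun v => (sa.continuous_fderiv nn).clm_apply cst
  have hcs : ∀ v, Hcs (fun p => fderiv ℝ φ p v) := fun v => hc.fderiv_apply (𝕜 := ℝ) v
  obtain ⟨ρ, hρ⟩ := hc.isCompact.isBounded.subset_closedBall (0 : Pl)
  obtain ⟨md, B1⟩ := (hcs (0,1)).exists_bound_of_continuous (hcv _)
  obtain ⟨me, B2⟩ := (hcs (1,0)).exists_bound_of_continuous (hcv _)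
  have hM : 0 ≤ M := (An).trans (hPM 0)
  simp only [fderiv_comp_add_right]
  apply tendsto_integral_of_dominated_convergence ((Metric.closedBall (0:ℝ×ℝ) (ρ+1)).indicator fun _ => M * md + M * me)
  · intro n
    exact ((hP.mul ((meas_fd _).comp (measurable_add_const _))).add (hQ.mul ((meas_fd _).comp (measurable_add_const _)))).aestronglyMeasurable
  · rw [integrable_indicator_iff Metric.isClosed_closedBall.measurableSet]
    exact integrableOn_const (isCompact_closedBall _ _).measure_lt_top.ne
  · intro n
    filter_upwards with p
    set v := ι n • (so,(-1:ℝ)) with hv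
    by_cases hp : p ∈ Metric.closedBall (0:ℝ×ℝ) (ρ+1)
    · rw [indicator_of_mem hp, Real.norm_eq_abs]
      refine (abs_add_le _ _).trans ?_
      rw [abs_mul, abs_mul]
      exact add_le_add (mul_le_mul (hPM p) (B1 _) An hM) (mul_le_mul (hQM p) (B2 _) An hM)
    · have : fderiv ℝ φ (p + v) = 0 := by
        by_contra hne
        have h2 := hρ (tsupport_fderiv_subset ℝ (subset_tsupport _ hne))
        rw [mem_closedBall_zero_iff] at h2 hp
        have : ‖v‖ ≤ 1 := by
          rw [hv, norm_smul, Ra, abs_of_pos ps]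
          simp only [Prod.norm_def, norm_one, norm_neg, max_self, mul_one]
          rw [div_le_one ps]; linarith [Nat.cast_nonneg (α := ℝ) n]
        have := norm_sub_le (p + v) v
        simp only [add_sub_cancel_right] at this
        linarith
      rw [this, indicator_of_notMem hp]; simp
  · filter_upwards with p
    have t : Tendsto (fun n : ℕ => p + ι n • (so,(-1:ℝ))) atTop (nhds p) := by
      simpa using (tendsto_const_nhds (x := p)).add ((tendsto_one_div_add_atTop_nhds_zero_nat (𝕜 := ℝ)).smul_const (so,(-1:ℝ)))
    exact ((((hcv _).tendsto p).comp t).const_mul _).add ((((hcv _).tendsto p).comp t).const_mul _)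
lemma SC.half {a : ℝ} {f : ℝ → ℝ} {W : Pl → ℝ} {K : NNReal} (hW : Lwz K W) (S : ∀ ε > 0, ∃ C, SC a f W ε C) : HalfSol f W := by
  refine ⟨⟨K, hW⟩, ?_, fun k φ sa hc se hs => ?_⟩
  · have : ∀ n : ℕ, ∀ᵐ p : Pl, p.1 < -ι n → ι n < p.2 → Dt W p = - f Dx W p := fun n => by
      obtain ⟨C, hC⟩ := S ι n ps
      exact hC.hj
    filter_upwards [ae_all_iff.2 this] with p hp sa h2
    obtain ⟨n, hn⟩ := exists_nat_one_div_lt (lt_min (neg_pos.2 sa) h2)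
    exact hp n (by linarith [hn.trans_le Mnl]) (hn.trans_le Mnr)
  · have hf : Continuous f := by obtain ⟨C, hC⟩ := S 1 one_pos; exact hC.C2.continuous
    obtain ⟨ma, mb, M, bb, bd⟩ := kint_PQ hf hW k
    refine ge_of_tendsto (shift_lim sa hc ma mb bb bd) (Ef fun n => ?_)
    obtain ⟨C, hC⟩ := S (ι n/2) ps
    refine entC hC hW k (φ := fun p => φ (p + ι n • (so,(-1:ℝ)))) (sa.comp (by fun_prop)) 
      (hc.comp_homeomorph (Homeomorph.addRight _)) (fun p => se _) fun p hp => hs _ ?_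
    simp only [Prod.fst_add, Prod.snd_add, Prod.smul_mk, smul_eq_mul]
    rcases hp with hp | hp
    · left; linarith
    · right; linarith
lemma QP.half {a E R θ K ec : ℝ} {f ba m : ℝ → ℝ} (q : QP a f E R θ K ec ba m) : HalfSol f (fun z : Pl => QP.V f E ba m z.1 z.2) := by
  obtain ⟨KV, hV⟩ := q.Vcont
  have hd := hV.ae_differentiableAt (μ := (volume : Measure (Pl)))
  refine SC.half (a := a) hV fun ε hε => ?_
  obtain ⟨C, hC, hl⟩ := q.loc hε
  refine ⟨2 * C, q.adm.ha, q.adm.C2, q.adm.h2, hε, by linarith, ?_, fun h hh => ?_⟩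
  · filter_upwards [hd] with p hp sa h2
    obtain ⟨eb, ea⟩ := q.fd_eq (x := p.1) (t := p.2) ln ln hp
    rw [Prod.mk.eta] at eb ea
    rw [eb, ea]
  · filter_upwards [hd, (measurePreserving_add_right volume ((h,0) : Pl)).quasiMeasurePreserving.ae hd] with p db dc sa h2
    have eb := (q.fd_eq (x := p.1) (t := p.2) ln ln db).1
    have ed : p + (h, 0) = (p.1 + h, p.2) := by ext <;> simp
    have d2' : DifferentiableAt ℝ (fun z : Pl => QP.V f E ba m z.1 z.2) (p.1 + h, p.2) := ed ▸ dc
    have ea := (q.fd_eq (x := p.1 + h) (t := p.2) ln ln d2').1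
    rw [Prod.mk.eta] at eb
    rw [ed, eb, ea]
    obtain ⟨p1, hp1⟩ := q.wmin (x := p.1) (t := p.2) ln ln
    obtain ⟨p2, tz⟩ := q.wmin (x := p.1 + h) (t := p.2) ln ln
    have kc := hl _ _ _ _ ln ln hp1 (p.1 + h) p.2
    have kg := hl _ _ _ _ ln ln tz p.1 p.2
    simp only [sub_self, mul_zero, abs_zero, add_zero, add_sub_cancel_left, sub_zero, sub_add_cancel_left, abs_neg, sq_abs] at kc kg
    have : h * QP.w f E ba m (p.1 + h) p.2 ≤ h * (QP.w f E ba m p.1 p.2 + 2 * C * h) := by nlinarith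
    exact le_of_mul_le_mul_left this hh
lemma fd0 {F : Pl → ℝ} {p : Pl} (hd : DifferentiableAt ℝ F p) (h : (∀ q : Pl, 0 ≤ q.1 → F q = 0) ∧ 0 ≤ p.1 ∨ (∀ q : Pl, q.2 ≤ 0 → F q = 0) ∧ p.2 ≤ 0) :
    fderiv ℝ F p = 0 := by
  have key : ∀ s : Set (Pl), UniqueDiffOn ℝ s → p ∈ s → (∀ q ∈ s, F q = 0) → fderiv ℝ F p = 0 := fun s hs hp h =>
    (hs p hp).eq hd.hasFDerivAt.hasFDerivWithinAt ((hasFDerivWithinAt_const sf p s).congr h (h p hp))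
  rcases h with ⟨h, hp⟩ | ⟨h, hp⟩
  · exact key (Ici 0 ×ˢ univ) ((uniqueDiffOn_Ici 0).prod uniqueDiffOn_univ) ⟨hp, trivial⟩ fun q hq => h q hq.1
  · exact key (univ ×ˢ Iic 0) (uniqueDiffOn_univ.prod (uniqueDiffOn_Iic 0)) ⟨trivial, hp⟩ fun q hq => h q hq.2
def chi (n : ℕ) (Φ : Pl → ℝ) (p : Pl) : ℝ := (1 - stp n (p.1 - 0 + ι n)) * Φ p
lemma chi_cd (n : ℕ) {Φ : Pl → ℝ} (h : ContDiff ℝ 1 Φ) : ContDiff ℝ 1 (chi n Φ) :=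
  (contDiff_const.sub ((stp_cd n).comp ((contDiff_fst.sub contDiff_const).add contDiff_const))).mul h
lemma chi_hcs (n : ℕ) {Φ : Pl → ℝ} (h : Hcs Φ) : Hcs (chi n Φ) := h.mul_left
lemma chi_fd (n : ℕ) {Φ : Pl → ℝ} (h : ContDiff ℝ 1 Φ) (p : Pl) :
    Dt (chi n Φ) p = (1 - stp n (p.1 - 0 + ι n)) * Dt Φ p ∧
    Dx (chi n Φ) p = (1 - stp n (p.1 - 0 + ι n)) * Dx Φ p - rho n (p.1 - 0 + ι n) * Φ p := by
  have sa : HasFDerivAt (fun p : Pl => 1 - stp n (p.1 - 0 + ι n)) (-(rho n (p.1 - 0 + ι n) • ContinuousLinearMap.fst ℝ ℝ ℝ)) p :=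
    ((stp_hd n _).comp_hasFDerivAt p ((hasFDerivAt_fst.sub_const 0).add_const _)).const_sub 1
  have h2 : HasFDerivAt (chi n Φ) _ p := sa.mul (h.differentiable one_ne_zero p).hasFDerivAt
  rw [h2.fderiv]
  constructor <;> (simp <;> ring)
lemma half_lim {P Q : ℝ → ℝ → ℝ} (hP : Measurable (Function.uncurry P)) (hQ : Measurable (Function.uncurry Q)) {M : ℝ}
    (hPM : ∀ x t, |P x t| ≤ M) (hQM : ∀ x t, |Q x t| ≤ M) {Qm : ℝ → ℝ}
    (hl : ∀ t, 0 < t → Tendsto (fun x => Q x t) (nhdsWithin 0 (Iio 0)) (nhds (Qm t)))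
    {Φ : Pl → ℝ} (sa : ContDiff ℝ 1 Φ) (hc : Hcs Φ) (se : ∀ p, p.2 ≤ 0 → Φ p = 0) :
    IntegrableOn (fun t => Qm t * Φ (0,t)) (Ioi 0) ∧ Integrable (fun p : Pl => P p.1 p.2 * Dt Φ p + Q p.1 p.2 * Dx Φ p) ∧
    Tendsto (fun n : ℕ => ∫ p : Pl, (P p.1 p.2 * Dt (chi n Φ) p + Q p.1 p.2 * Dx (chi n Φ) p)) atTop
      (nhds ((∫ p in {p : Pl | p.1 < 0}, (P p.1 p.2 * Dt Φ p + Q p.1 p.2 * Dx Φ p)) - ∫ t in Ioi 0, Qm t * Φ (0,t))) := by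
  have mS : MeasurableSet {p : Pl | p.1 < 0} := measurableSet_lt measurable_fst mci
  have mΦ := sa.continuous.measurable
  obtain ⟨CΦ, hCΦ⟩ := hc.exists_bound_of_continuous sa.continuous
  have iΦ := sa.continuous.integrable_of_hasCompactSupport hc (μ := volume)
  have iF : Integrable (fun p : Pl => P p.1 p.2 * Dt Φ p + Q p.1 p.2 * Dx Φ p) :=
    ((int_fd0 sa hc (0,1)).1.bdd_mul (c := M) hP.aestronglyMeasurable (Ef fun p => hPM _ _)).add
      ((int_fd0 sa hc (1,0)).1.bdd_mul (c := M) hQ.aestronglyMeasurable (Ef fun p => hQM _ _))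
  obtain ⟨d, hd0, hd⟩ : ∃ d : ℝ, 0 < d ∧ ∀ p : Pl, d < p.2 → Φ p = 0 := by
    obtain ⟨r, hr, hr'⟩ := hc.isCompact.isBounded.exists_pos_norm_le
    refine ⟨r, hr, fun p hp => ?_⟩
    by_contra h
    have := hr' p (subset_tsupport _ h)
    have h2 := (norm_snd_le p).trans this
    rw [Real.norm_eq_abs] at h2
    linarith [le_abs_self p.2]
  have hG : Measurable (Function.uncurry fun x t => Q x t * Φ (x,t)) := hQ.mul mΦ
  have sw : 0 ≤ M := (An).trans (hPM 0 0)
  have hGM : ∀ x t, |Q x t * Φ (x,t)| ≤ M * CΦ := fun x t => by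
    rw [abs_mul]; exact mul_le_mul (hQM x t) (hCΦ _) An sw
  have hGl : ∀ t, 0 < t → Tendsto (fun x => Q x t * Φ (x,t)) (nhdsWithin 0 (Iio 0)) (nhds (Qm t * Φ (0,t))) := fun t ht =>
    (hl t ht).mul (((sa.continuous.comp (by fun_prop : Continuous fun x : ℝ => (x,t))).tendsto 0).mono_left nhdsWithin_le_nhds)
  obtain ⟨aa, ab, ac⟩ := trace_L1 hG hGM (l := nhdsWithin 0 (Iio 0)) (c := 0) (d := d) le_rfl hGl
  have bc := box_conc (aker_left 0) (b := fun _ => (Icc 0 d).indicator 1) (fun n => measurable_one.indicator measurableSet_Icc)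
    (fun n t => by by_cases h : t ∈ Icc 0 d <;> simp [h]) (fun n t h => indicator_of_notMem h _) (fun t => tendsto_const_nhds) hG hGM aa ab ac
  have z0 : ∀ t, t ∈ Ioi sf \ Ioc 0 d → Qm t * Φ (0,t) = 0 := fun t ht => by
    rw [hd (0,t) (by by_contra h; exact ht.2 ⟨ht.1, not_lt.1 h⟩), mul_zero]
  have eb : ∫ t in Icc 0 d, Qm t * Φ (0,t) * (Icc 0 d).indicator 1 t = ∫ t in Ioi 0, Qm t * Φ (0,t) := by
    rw [setIntegral_eq_of_subset_of_forall_sdiff_eq_zero measurableSet_Ioi Ioc_subset_Ioi_self z0, ← integral_Icc_eq_integral_Ioc]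
    exact setIntegral_congr_fun measurableSet_Icc fun t ht => by simp [ht]
  have i0 : IntegrableOn (fun t => Qm t * Φ (0,t)) (Ioi 0) := by
    have : IntegrableOn (fun t => Qm t * Φ (0,t)) (Ioc 0 d) :=
      IntegrableOn.mono_set (t := Icc 0 d) (Integrable.of_bound aa (M * CΦ) ab) Ioc_subset_Icc_self
    exact this.of_forall_sdiff_eq_zero measurableSet_Ioi z0
  refine ⟨i0, iF, ?_⟩
  rw [eb] at bc
  have iR : ∀ n, Integrable (fun p : Pl => rho n (p.1 - 0 + ι n) * (Q p.1 p.2 * Φ p)) := fun n => by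
    obtain ⟨C, hC⟩ := (rho_hcs n).exists_bound_of_continuous (rho_cont n)
    exact (iΦ.bdd_mul (c := M) hQ.aestronglyMeasurable (Ef fun p => hQM _ _)).bdd_mul (c := C)
      ((rho_cont n).comp (by fun_prop : Continuous fun p : Pl => p.1 - 0 + ι n)).aestronglyMeasurable (Ef fun p => hC _)
  have sc : ∀ n : ℕ, Continuous (fun p : Pl => 1 - stp n (p.1 - 0 + ι n)) := fun n =>
    continuous_const.sub ((stp_cd n).continuous.comp (by fun_prop))
  have sb : ∀ (n : ℕ) (z : ℝ), ‖1 - stp n z‖ ≤ 1 := fun n z => by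
    rw [Ra, abs_le]; constructor <;> linarith [stp_nonneg n z, stp_le_one n z]
  have la : Tendsto (fun n : ℕ => ∫ p : Pl, (1 - stp n (p.1 - 0 + ι n)) * (P p.1 p.2 * Dt Φ p + Q p.1 p.2 * Dx Φ p)) atTop
      (nhds (∫ p in {p : Pl | p.1 < 0}, (P p.1 p.2 * Dt Φ p + Q p.1 p.2 * Dx Φ p))) := by
    rw [← integral_indicator mS]
    refine tendsto_integral_of_dominated_convergence _ (fun n => (sc n).aestronglyMeasurable.mul iF.1) iF.norm
      (fun n => Ef fun p => ?_) (Ef fun p => ?_)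
    · rw [norm_mul]; exact mul_le_of_le_one_left (norm_nonneg _) (sb n _)
    · by_cases hp : p.1 < 0
      · rw [indicator_of_mem (show p ∈ {p : Pl | p.1 < 0} from hp)]
        refine tendsto_const_nhds.congr' ?_
        filter_upwards [inv_lt_ev (neg_pos.2 hp)] with n hn
        rw [stp_zero n ln]; ring
      · rw [indicator_of_notMem (show p ∉ {p : Pl | p.1 < 0} from hp)]
        refine tendsto_const_nhds.congr fun n => ?_
        rw [stp_one n ln]; ring
  refine (la.sub bc).congr fun n => ?_
  have ea : ∫ x, rho n (x - 0 + ι n) * ∫ t, Q x t * Φ (x,t) * (Icc 0 d).indicator 1 t = ∫ p : Pl, rho n (p.1 - 0 + ι n) * (Q p.1 p.2 * Φ p) := by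
    have := iR n
    rw [Measure.volume_eq_prod] at this ⊢
    rw [integral_prod _ this]
    congr 1; funext x
    rw [← integral_const_mul]
    congr 1; funext t
    by_cases ht : t ∈ Icc 0 d
    · simp [ht]
    · have : Φ (x,t) = 0 := by
        by_cases h : t ≤ 0
        · exact se _ h
        · exact hd _ (by by_contra sk; exact ht ⟨(not_le.1 h).le, not_lt.1 sk⟩)
      simp [this]
  rw [ea, ← integral_sub (iF.bdd_mul (c := 1) (sc n).aestronglyMeasurable (Ef fun p => sb n _)) (iR n)]
  congr 1; funext p
  rw [(chi_fd n sa p).1, (chi_fd n sa p).2]; ring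
structure TF (Φ : Pl → ℝ) : Prop where
  cd : ContDiff ℝ 1 Φ
  cs : Hcs Φ
  z : ∀ p, p.2 ≤ 0 → Φ p = 0
def PQ (P Q : ℝ → ℝ → ℝ) (Φ : Pl → ℝ) (p : Pl) : ℝ := P p.1 p.2 * Dt Φ p + Q p.1 p.2 * Dx Φ p
def kf (f : ℝ → ℝ) (k z : ℝ) : ℝ := Real.sign (z - k) * (f z - f k)
structure HS (f : ℝ → ℝ) (w : ℝ → ℝ → ℝ) (κ : ℝ → ℝ) : Prop where
  meas : Measurable (Function.uncurry w)
  bdd : ∃ M, ∀ x t, |w x t| ≤ M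
  lm : ∀ x t, x < 0 → 0 < t → ∃ l, Tendsto (fun y => w y t) (nhdsWithin x (Iio x)) (nhds l)
  lp : ∀ x t, x < 0 → 0 < t → ∃ l, Tendsto (fun y => w y t) (nhdsWithin x (Ioi x)) (nhds l)
  tr : ∀ t, 0 < t → Tendsto (fun y => w y t) (nhdsWithin 0 (Iio 0)) (nhds (κ t))
  tc : ∀ td, 0 ≤ td → ∀ᵐ x : ℝ, x < 0 → Tendsto (fun t => w x t) (nhdsWithin td (Ici 0)) (nhds (w x td))
  K : ∀ k Φ, TF Φ → (∀ p, 0 ≤ Φ p) → IntegrableOn (fun t => kf f k (κ t) * Φ (0,t)) (Ioi 0) ∧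
    Integrable (PQ (fun x t => |w x t - k|) (fun x t => kf f k (w x t)) Φ) ∧
    ∫ t in Ioi 0, kf f k (κ t) * Φ (0,t) ≤ ∫ p in {p : Pl | p.1 < 0}, PQ (fun x t => |w x t - k|) (fun x t => kf f k (w x t)) Φ p
  W : ∀ Φ, TF Φ → IntegrableOn (fun t => f (κ t) * Φ (0,t)) (Ioi 0) ∧ Integrable (PQ w (fun x t => f (w x t)) Φ) ∧
    ∫ p in {p : Pl | p.1 < 0}, PQ w (fun x t => f (w x t)) Φ p = ∫ t in Ioi 0, f (κ t) * Φ (0,t)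
namespace QP
variable {a E R θ K ec : ℝ} {f ba m : ℝ → ℝ}
local notation "QQ" => QP a f E R θ K ec ba m
local notation "ww" => w f E ba m
local notation "VV" => V f E ba m
attribute [local irreducible] V w
def wl (f : ℝ → ℝ) (E : ℝ) (ba m g : ℝ → ℝ) (x t : ℝ) : ℝ := if 0 < t then (if x < 0 then w f E ba m x t else 0) else g x
lemma hs (q : QQ) {g : ℝ → ℝ} (hg : Measurable g) {Mg : ℝ} (hgM : ∀ x, |g x| ≤ Mg)
    (hgd : ∀ᵐ x : ℝ, x < 0 → HasDerivAt ba (g x) x) : ∃ κ, HS f (wl f E ba m g) κ ∧ ∀ t, 0 < t →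
    (∀ mc, HasDerivAt m mc t → f (κ t) = -mc) ∧ ((∃ y, y ≤ 0 ∧ m t = ba y + cc f E t (-y)) → θ ≤ κ t) := by
  have hf : Continuous f := q.adm.C2.continuous
  have ex : ∀ t, ∃ κ, 0 < t → Tendsto (fun x => ww x t) (nhdsWithin 0 (Iio 0)) (nhds κ) ∧
    (∀ mc, HasDerivAt m mc t → f κ = -mc) ∧ ((∃ y, y ≤ 0 ∧ m t = ba y + cc f E t (-y)) → θ ≤ κ) := fun t => by
    by_cases h : 0 < t
    · obtain ⟨κ, h⟩ := q.trace h; exact ⟨κ, fun _ => h⟩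
    · exact ⟨0, fun sk => absurd sk h⟩
  choose κ hκ using ex
  have ew : ∀ {x t}, x < 0 → 0 < t → wl f E ba m g x t = ww x t := fun hx ht => by rw [wl, if_pos ht, if_pos hx]
  have meas : Measurable (Function.uncurry (wl f E ba m g)) :=
    Measurable.ite (measurableSet_lt mci measurable_snd)
      (Measurable.ite (measurableSet_lt measurable_fst mci) q.wmeas mci) (hg.comp measurable_fst)
  obtain ⟨L, tp, -, -, hL⟩ := q.adm.bnd
  obtain ⟨KV, hV⟩ := q.Vcont
  have bdd : ∀ x t, |wl f E ba m g x t| ≤ L + Mg := fun x t => by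
    have hM : 0 ≤ Mg := (An).trans (hgM 0)
    rw [wl]; split_ifs with sa h2
    · obtain ⟨p, hp⟩ := q.wmin h2 sa
      linarith [(hL _ hp.hk).1]
    · rw [abs_zero]; linarith
    · linarith [hgM x]
  have evl : ∀ x t, x ≤ 0 → 0 < t → ∀ᶠ y in nhdsWithin x (Iio x), ww y t = wl f E ba m g y t := fun x t hx ht => by
    filter_upwards [self_mem_nhdsWithin] with y hy
    exact (ew (lt_of_lt_of_le hy hx) ht).symm
  have tr : ∀ t, 0 < t → Tendsto (fun y => wl f E ba m g y t) (nhdsWithin 0 (Iio 0)) (nhds (κ t)) := fun t ht =>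
    (hκ t ht).1.congr' (evl 0 t le_rfl ht)
  have ae : ∀ᵐ p : Pl, p.1 < 0 → 0 < p.2 → Dx (fun z : Pl => VV z.1 z.2) p = wl f E ba m g p.1 p.2 ∧
      Dt (fun z : Pl => VV z.1 z.2) p = - f (wl f E ba m g p.1 p.2) := by
    filter_upwards [hV.ae_differentiableAt (μ := (volume : Measure (Pl)))] with p hp sa h2
    rw [ew sa h2]; exact q.fd_eq sa h2 hp
  have cz : ∀ (n : ℕ) {Φ : Pl → ℝ}, TF Φ → ∀ p : Pl, ¬ (p.1 < 0 ∧ 0 < p.2) → fderiv ℝ (chi n Φ) p = 0 := fun n Φ hΦ p hp => by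
    refine fd0 ((chi_cd n hΦ.cd).differentiable one_ne_zero p) ?_
    by_cases h : p.1 < 0
    · exact Or.inr ⟨fun q hq => by rw [chi, hΦ.z q hq, mul_zero], not_lt.1 fun sk => hp ⟨h, sk⟩⟩
    · exact Or.inl ⟨fun q hq => by rw [chi, stp_one n ln, sub_self, zero_mul], not_lt.1 h⟩
  refine ⟨κ, ⟨meas, ⟨_, bdd⟩, fun x t hx ht => ?_, fun x t hx ht => ?_, tr, fun td tq => ?_, fun k Φ hΦ hp => ?_, fun Φ hΦ => ?_⟩, fun t ht => (hκ t ht).2⟩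
  · obtain ⟨l, h⟩ := (q.wlim hx ht).1
    exact ⟨l, h.congr' (evl x t hx.le ht)⟩
  · obtain ⟨l, h⟩ := (q.wlim hx ht).2
    refine ⟨l, h.congr' ?_⟩
    filter_upwards [mem_nhdsWithin_of_mem_nhds (Iio_mem_nhds hx)] with y hy
    exact (ew hy ht).symm
  · rcases tq.eq_or_lt with rfl | ht
    · filter_upwards [hgd] with x hx h
      rw [← Ioi_insert, nhdsWithin_insert, tendsto_sup]
      refine ⟨tendsto_pure_nhds _ _, ?_⟩
      have := q.tc0 h (hx h)
      rw [show wl f E ba m g x 0 = g x by rw [wl, if_neg (lt_irrefl _)]]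
      refine this.congr' ?_
      filter_upwards [self_mem_nhdsWithin] with t ht
      exact (ew h ht).symm
    · have hs : Lwz KV (fun y => VV y td) := by
        have := hV.comp (LipschitzWith.prodMk_right td)
        simpa [Function.comp_def] using this
      filter_upwards [hs.ae_differentiableAt (μ := volume)] with x hx h
      rw [ew h ht]
      refine Tendsto.mono_left ((q.tc h ht hx).congr' ?_) nhdsWithin_le_nhds
      filter_upwards [Ioi_mem_nhds ht] with t ht
      exact (ew h ht).symm
  · have sc := sgn_cont hf k
    obtain ⟨C, sp, hC⟩ := bdd_on sc (L + Mg)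
    obtain ⟨ic, ia, lim⟩ := half_lim (P := fun x t => |wl f E ba m g x t - k|) (Q := fun x t => kf f k (wl f E ba m g x t)) (M := L + Mg + |k| + C)
      ((meas.sub_const k).abs) (sc.measurable.comp meas)
      (fun x t => by rw [abs_abs]; linarith [abs_sub (wl f E ba m g x t) k, bdd x t])
      (fun x t => (hC _ (bdd x t)).trans (by linarith [abs_nonneg k, (An).trans (bdd 0 0)]))
      (fun t ht => (sc.tendsto _).comp (tr t ht)) hΦ.cd hΦ.cs hΦ.z
    refine ⟨ic, ia, ?_⟩
    have : ∀ n : ℕ, 0 ≤ ∫ p : Pl, (|wl f E ba m g p.1 p.2 - k| * Dt (chi n Φ) p + kf f k (wl f E ba m g p.1 p.2) * Dx (chi n Φ) p) := fun n => by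
      have h := q.half.kru k (chi n Φ) (chi_cd n hΦ.cd) (chi_hcs n hΦ.cs) (fun p => Pn (by linarith [stp_le_one n (p.1 - 0 + ι n)]) (hp p))
        (fun p h => by
          rcases h with h | h
          · rw [chi, stp_one n ln, sub_self, zero_mul]
          · rw [chi, hΦ.z p h, mul_zero])
      refine h.trans_eq (integral_congr_ae ?_)
      filter_upwards [ae] with p hp
      by_cases h : p.1 < 0 ∧ 0 < p.2
      · rw [kint, (hp h.1 h.2).1, kf]
      · rw [kint, cz n hΦ p h]; simp
    exact sub_nonneg.1 (ge_of_tendsto' lim this)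
  · obtain ⟨C, sp, hC⟩ := bdd_on hf (L + Mg)
    have hb0 := (An).trans (bdd 0 0)
    obtain ⟨ic, ia, lim⟩ := half_lim (P := wl f E ba m g) (Q := fun x t => f (wl f E ba m g x t)) (M := L + Mg + C) meas (hf.measurable.comp meas)
      (fun x t => by linarith [bdd x t]) (fun x t => (hC _ (bdd x t)).trans ln) (fun t ht => (hf.tendsto _).comp (tr t ht)) hΦ.cd hΦ.cs hΦ.z
    refine ⟨ic, ia, ?_⟩
    have : ∀ n : ℕ, ∫ p : Pl, (wl f E ba m g p.1 p.2 * Dt (chi n Φ) p + f (wl f E ba m g p.1 p.2) * Dx (chi n Φ) p) = 0 := fun n => by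
      refine (integral_congr_ae ?_).trans (symm_parts hV (chi_cd n hΦ.cd) (chi_hcs n hΦ.cs))
      filter_upwards [ae] with p hp
      by_cases h : p.1 < 0 ∧ 0 < p.2
      · rw [(hp h.1 h.2).1, (hp h.1 h.2).2, neg_neg]
      · rw [cz n hΦ p h]; simp
    simp only [this] at lim
    have := tendsto_nhds_unique lim tendsto_const_nhds
    exact sub_eq_zero.1 this
end QP
lemma ae_ne0 : ∀ᵐ x : ℝ, x ≠ 0 := compl_mem_ae_iff.2 (measure_singleton 0)
lemma splitI {F G H : Pl → ℝ} (hG : Integrable G) (hH : Integrable H) (eb : ∀ p : Pl, p.1 < 0 → F p = G p) (ea : ∀ p : Pl, 0 < p.1 → F p = H (sj p)) :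
    ∫ p, F p = (∫ p in {p : Pl | p.1 < 0}, G p) + ∫ p in {p : Pl | p.1 < 0}, H p := by
  have mS : MeasurableSet {p : Pl | p.1 < 0} := measurableSet_lt measurable_fst mci
  have iH : Integrable (fun p => {p : Pl | p.1 < 0}.indicator H (sj p)) := mp_rfl.integrable_comp_of_integrable (hH.indicator mS)
  rw [← integral_indicator mS, ← integral_indicator mS, ← int_rfl ({p : Pl | p.1 < 0}.indicator H),
    ← integral_add (hG.indicator mS) iH]
  refine integral_congr_ae ?_
  have : ∀ᵐ p : Pl, p.1 ≠ 0 := by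
    rw [Measure.volume_eq_prod]; exact Measure.quasiMeasurePreserving_fst.ae ae_ne0
  filter_upwards [this] with p hp
  rcases lt_or_gt_of_ne hp with h | h
  · rw [indicator_of_mem (show p ∈ {p : Pl | p.1 < 0} from h), indicator_of_notMem (by rw [rfl2_ap]; simp [h.le]), eb p h, add_zero]
  · rw [indicator_of_notMem (by simp [h.le]), indicator_of_mem (by rw [rfl2_ap]; simp [h]), ea p h, zero_add]
lemma PQ_rfl (P Q : ℝ → ℝ → ℝ) (Φ : Pl → ℝ) (p : Pl) : PQ P Q (Φ ∘ sj) (sj p) =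
    P (-p.1) p.2 * Dt Φ p - Q (-p.1) p.2 * Dx Φ p := by
  rw [PQ, fd_rfl_x, fd_rfl_t, rfl2_rfl2, rfl2_ap]; ring
lemma TF.rfl' {Φ : Pl → ℝ} (h : TF Φ) : TF (Φ ∘ sj) := ⟨rfl_cd h.cd, rfl_hcs h.cs, fun p hp => h.z _ (by rw [rfl2_ap]; exact hp)⟩
lemma glue {a A B γ θl θr : ℝ} {fl fr ua : ℝ → ℝ} (hc : Conn a fl fr A B γ θl θr) {wl wr : ℝ → ℝ → ℝ} {κl κr : ℝ → ℝ}
    (L : HS fl wl κl) (R : HS (fun k => fr (-k)) wr κr) (il : ∀ᵐ x : ℝ, x < 0 → wl x 0 = ua x) (ir : ∀ᵐ x : ℝ, 0 ≤ x → -wr (-x) 0 = ua x)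
    (hi : ∀ᵐ t : ℝ, 0 < t → fl (κl t) = fr (-κr t) ∧ γ ≤ fl (κl t) ∧ (fl (κl t) = γ ∨ θl ≤ κl t ∨ -θr ≤ κr t)) :
    Nonempty (ABSol fl fr A B ua) := by
  set u : ℝ → ℝ → ℝ := fun x t => if x < 0 then wl x t else -wr (-x) t with hu
  have ul : ∀ {x t}, x < 0 → u x t = wl x t := fun h => if_pos h
  have ur : ∀ {x t}, 0 ≤ x → u x t = -wr (-x) t := fun h => if_neg (not_lt.2 h)
  have um : Measurable (Function.uncurry u) := Measurable.ite (measurableSet_lt measurable_fst mci) L.meas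
    (R.meas.comp (measurable_fst.neg.prodMk measurable_snd)).neg
  obtain ⟨md, sa⟩ := L.bdd
  obtain ⟨me, h2⟩ := R.bdd
  have ub : ∀ x t, |u x t| ≤ max md me := fun x t => by
    rcases lt_or_ge x 0 with h | h
    · rw [ul h]; exact (sa _ _).trans Mxl
    · rw [ur h, abs_neg]; exact (h2 _ _).trans Mxr
  have exm : ∀ x t, ∃ l, 0 < t → Tendsto (fun y => u y t) (nhdsWithin x (Iio x)) (nhds l) := fun x t => by
    by_cases ht : 0 < t
    swap
    · exact ⟨0, fun h => absurd h ht⟩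
    rcases lt_trichotomy x 0 with h | rfl | h
    · obtain ⟨l, hl⟩ := L.lm x t h ht
      refine ⟨l, fun _ => hl.congr' ?_⟩
      filter_upwards [self_mem_nhdsWithin] with y hy using (ul (lt_trans hy h)).symm
    · refine ⟨_, fun _ => (L.tr t ht).congr' ?_⟩
      filter_upwards [self_mem_nhdsWithin] with y hy using (ul hy).symm
    · obtain ⟨l, hl⟩ := R.lp (-x) t (neg_lt_zero.2 h) ht
      refine ⟨-l, fun _ => (hl.comp tendsto_neg_nhdsLT).neg.congr' ?_⟩
      filter_upwards [mem_nhdsWithin_of_mem_nhds (Ioi_mem_nhds h)] with y hy using (ur (le_of_lt hy)).symm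
  have exp : ∀ x t, ∃ l, 0 < t → Tendsto (fun y => u y t) (nhdsWithin x (Ioi x)) (nhds l) := fun x t => by
    by_cases ht : 0 < t
    swap
    · exact ⟨0, fun h => absurd h ht⟩
    rcases lt_trichotomy x 0 with h | rfl | h
    · obtain ⟨l, hl⟩ := L.lp x t h ht
      refine ⟨l, fun _ => hl.congr' ?_⟩
      filter_upwards [mem_nhdsWithin_of_mem_nhds (Iio_mem_nhds h)] with y hy using (ul hy).symm
    · refine ⟨_, fun _ => (((neg_zero (G := ℝ)).symm ▸ R.tr t ht : Tendsto (fun y => wr y t) (nhdsWithin (-0) (Iio (-0))) (nhds (κr t))).comp tendsto_neg_nhdsGT).neg.congr' ?_⟩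
      filter_upwards [self_mem_nhdsWithin] with y hy using (ur (le_of_lt hy)).symm
    · obtain ⟨l, hl⟩ := R.lm (-x) t (neg_lt_zero.2 h) ht
      refine ⟨-l, fun _ => (hl.comp tendsto_neg_nhdsGT).neg.congr' ?_⟩
      filter_upwards [self_mem_nhdsWithin] with y hy using (ur (le_of_lt (lt_trans h hy))).symm
  choose lm hlm using exm
  choose lp hlp using exp
  have tf : ∀ {φ : ℝ → ℝ → ℝ}, ContDiff ℝ 1 (fun p : Pl => φ p.1 p.2) → Hcs (fun p : Pl => φ p.1 p.2) → (∀ x t, t ≤ 0 → φ x t = 0) →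
    TF (fun p : Pl => φ p.1 p.2) := fun sa h2 sd => ⟨sa, h2, fun p hp => sd _ _ hp⟩
  have er : ∀ k {x t}, 0 ≤ x → |u x t - k| = |wr (-x) t - (-k)| ∧ Real.sign (u x t - k) * (fr (u x t) - fr k) = - kf (fun k => fr (-k)) (-k) (wr (-x) t) := fun k x t h => by
    rw [ur h, kf, show -wr (-x) t - k = -(wr (-x) t - -k) by ring, abs_neg, Real.sign_neg, neg_neg, neg_mul]
    exact ⟨rfl, rfl⟩
  refine ⟨⟨u, um, ⟨_, ub⟩, lm, lp, hlm, hlp, fun φ ca c2 cb => ?_, fun k φ ca c2 cb cg => ?_, fun k φ ca c2 cb cg => ?_, fun φ ca c2 cb cg => ?_, fun r td tq => ?_, ?_⟩⟩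
  · have c := tf ca c2 cb
    have d := c.cd.differentiable one_ne_zero
    simp_rw [fun p => fd_x (φ := φ) (d p), fun p => fd_t (φ := φ) (d p)]
    obtain ⟨la, l2, lb⟩ := L.W _ c
    obtain ⟨xf, r2, r3⟩ := R.W _ c.rfl'
    rw [splitI l2 r2.neg (fun p hp => by rw [ul hp, dflux, if_pos hp, PQ]) (fun p hp => by
      rw [Pi.neg_apply, PQ_rfl, ur hp.le, dflux, if_neg (not_lt.2 hp.le)]; ring), lb]
    simp only [Pi.neg_apply, integral_neg]
    rw [r3, add_neg_eq_zero]
    refine setIntegral_congr_ae measurableSet_Ioi ?_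
    filter_upwards [hi] with t ht h
    rw [Function.comp_apply, rfl2_ap, (ht h).1]; simp
  · have c := tf ca c2 fun x t h => cg x t (Or.inr h)
    have d := c.cd.differentiable one_ne_zero
    simp_rw [fun p => fd_x (φ := φ) (d p), fun p => fd_t (φ := φ) (d p)]
    obtain ⟨la, l2, lb⟩ := L.K k _ c fun p => cb _ _
    rw [splitI l2 (integrable_zero _ _ _) (fun p hp => by rw [ul hp, PQ, kf]) (fun p hp => by
      rw [fd_min (fun p => cb _ _) (cg _ _ (Or.inl hp.le))]; simp)]
    simp only [cg 0 _ (Or.inl le_rfl), mul_zero, integral_zero, Pi.zero_apply] at lb ⊢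
    linarith
  · have c := tf ca c2 fun x t h => cg x t (Or.inr h)
    have d := c.cd.differentiable one_ne_zero
    simp_rw [fun p => fd_x (φ := φ) (d p), fun p => fd_t (φ := φ) (d p)]
    obtain ⟨la, l2, lb⟩ := R.K (-k) _ c.rfl' fun p => cb _ _
    rw [splitI (integrable_zero _ _ _) l2 (fun p hp => by
      rw [fd_min (fun p => cb _ _) (cg _ _ (Or.inl hp.le))]; simp) (fun p hp => by
      rw [PQ_rfl, (er k hp.le).1, (er k hp.le).2]; ring)]
    simp only [Function.comp_apply, rfl2_ap, neg_zero, cg 0 _ (Or.inl le_rfl), mul_zero, integral_zero, Pi.zero_apply] at lb ⊢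
    linarith
  · have c := tf ca c2 cg
    have d := c.cd.differentiable one_ne_zero
    simp_rw [fun p => fd_x (φ := φ) (d p), fun p => fd_t (φ := φ) (d p)]
    obtain ⟨la, l2, lb⟩ := L.K A _ c fun p => cb _ _
    obtain ⟨xf, r2, r3⟩ := R.K (-B) _ c.rfl' fun p => cb _ _
    rw [splitI l2 r2 (fun p hp => by rw [ul hp, cAB, if_pos hp.le, dflux, dflux, if_pos hp, if_pos hp, PQ, kf]) (fun p hp => by
      rw [PQ_rfl, cAB, if_neg (not_le.2 hp), dflux, dflux, if_neg (not_lt.2 hp.le), if_neg (not_lt.2 hp.le), (er B hp.le).1, (er B hp.le).2]; ring)]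
    refine le_trans ?_ (add_le_add lb r3)
    rw [← integral_add la xf]
    refine setIntegral_nonneg_of_ae_restrict ((ae_restrict_iff' measurableSet_Ioi).2 ?_)
    filter_upwards [hi] with t ht h
    obtain ⟨eb, ea, ed⟩ := ht h
    simp only [Function.comp_apply, rfl2_ap, neg_zero, ← add_mul, Pi.zero_apply]
    refine Pn ?_ (cb _ _)
    rw [kf, kf, ← eb, hc.fA, neg_neg, hc.fB, ← add_mul, sub_neg_eq_add]
    rcases ea.eq_or_lt with e | e
    · rw [← e]; simp
    have s1 := (abs_le.1 (sgn_abs (κl t - A))).1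
    have s2 := (abs_le.1 (sgn_abs (κr t + B))).1
    refine Pn ?_ ln
    rcases ed with ed | ed | ed
    · linarith
    · have : A < κl t := lt_of_le_of_ne (hc.hA.trans ed) fun sk => by rw [← sk, hc.fA] at e; exact lt_irrefl _ e
      rw [Real.sign_of_pos (sub_pos.2 this)]; linarith
    · have : -κr t < B := lt_of_le_of_ne (by linarith [hc.hB]) fun sk => by rw [eb, sk, hc.fB] at e; exact lt_irrefl _ e
      rw [Real.sign_of_pos (r := κr t + B) ln]; linarith
  · have hx : ∀ᵐ x : ℝ, Tendsto (fun t => u x t) (nhdsWithin td (Ici 0)) (nhds (u x td)) := by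
      filter_upwards [L.tc td tq, (Measure.measurePreserving_neg (volume : Measure ℝ)).quasiMeasurePreserving.ae (R.tc td tq), ae_ne0] with x aa ab ac
      rcases lt_or_gt_of_ne ac with h | h
      · simpa only [ul h] using aa h
      · simpa only [ur h.le] using (ab (neg_lt_zero.2 h)).neg
    have : Tendsto (fun t => ∫ x in Icc (-r) r, |u x t - u x td|) (nhdsWithin td (Ici 0)) (nhds (∫ x in Icc (-r) r, sf)) := by
      refine tendsto_integral_filter_of_dominated_convergence (fun _ => 2 * max md me) (Ef fun t =>
        ((um.of_uncurry_right.sub um.of_uncurry_right).abs).aestronglyMeasurable) (Ef fun t => Ef fun x => ?_) (integrable_const _) (ae_restrict_of_ae ?_)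
      · rw [Ra, abs_abs]; linarith [abs_sub (u x t) (u x td), ub x t, ub x td]
      · filter_upwards [hx] with x hx
        simpa using (hx.sub_const (u x td)).abs
    simpa using this
  · filter_upwards [il, ir] with x aa ab
    rcases lt_or_ge x 0 with h | h
    · rw [ul h, aa h]
    · rw [ur h, ab h]
lemma hex {a A B γ θl θr : ℝ} {fl fr : ℝ → ℝ} (hc : Conn a fl fr A B γ θl θr) (u : ℝ → ℝ) (hu : IsLinf u) : Nonempty (ABSol fl fr A B u) := by
  obtain ⟨K, hK⟩ := hu.lip
  obtain ⟨M, hM⟩ := hu.2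
  set R := (K:ℝ) + |θl| + |θr| + 1 with hR
  have R0 : 0 < R := by positivity
  have kd : sf ≤ K := K.2
  have KR : (K:ℝ) < R := by linarith [abs_nonneg θl, abs_nonneg θr]
  have kR : |(K:ℝ)| ≤ R := by rw [Ai kd]; exact KR.le
  obtain ⟨eg, hE1⟩ := adm_ex hc.ha hc.Cl hc.l2 R0
  obtain ⟨eh, hE2⟩ := adm_ex hc.ha hc.Cr hc.r2 R0
  set ec := max (max eg eh) γ with hE'
  have ga : eg ≤ ec := (Mxl).trans Mxl
  have g2 : eh ≤ ec := (Mxr).trans Mxl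
  have g3 : γ ≤ ec := Mxr
  have al := hE1 (ec + 1) ln
  have ar := (hE2 (ec + 1) ln).neg
  have hb : ∀ y sn, |intP u y - intP u sn| ≤ K * |y - sn| := fun y sn => by
    simpa [Real.dist_eq] using hK.dist_le_mul y sn
  have hb' : ∀ y sn, |intP u (-y) - intP u (-sn)| ≤ K * |y - sn| := fun y sn => by
    have := hb (-y) (-sn)
    rwa [show -y - -sn = -(y - sn) by ring, abs_neg] at this
  obtain ⟨nl, Dl, Nl, l0, la, l2⟩ := arrival (ec := ec) al kd KR ((hE1 ec ga).hE _ kR) ln hb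
  obtain ⟨nr, Dr, Nr, st, xf, r2⟩ := arrival (ec := ec) (ba := fun y => intP u (-y)) ar kd KR ((hE2 ec g2).neg.hE _ kR) ln hb'
  obtain ⟨m, m0, ma, mb, m3, m4, m5⟩ := build (Nl.min Nr) g3
  have e0 : nl 0 = nr 0 := by rw [l0, st, neg_zero]
  have dr : deriv (fun k => fr (-k)) (-θr) = 0 := by
    rw [deriv_comp_neg, neg_neg, hc.hr, neg_zero]
  have ql : QP a fl (ec + 1) R θl K ec (intP u) m := ⟨al, hc.hl, by linarith [abs_nonneg θr], KR, by linarith, hb, by rw [m0, ← e0, min_self, l0],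
    fun τ y sa h2 => ((ma τ sa).trans Mnl).trans (la τ y h2), fun tb τ sa h2 => (mb tb τ sa h2).trans (by
      have := al.theta_le hc.hl A
      rw [hc.fA] at this
      nlinarith), m3, m4⟩
  have qr : QP a (fun k => fr (-k)) (ec + 1) R (-θr) K ec (fun y => intP u (-y)) m := ⟨ar, dr, by rw [abs_neg]; linarith [abs_nonneg θl], KR, by linarith, hb', by rw [m0, e0, min_self, st],
    fun τ y sa h2 => ((ma τ sa).trans Mnr).trans (xf τ y h2), fun tb τ sa h2 => (mb tb τ sa h2).trans (by
      have := ar.theta_le dr (-B)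
      simp only [neg_neg] at this ⊢
      rw [hc.fB] at this
      nlinarith), m3, m4⟩
  have M0 : 0 ≤ M := by
    obtain ⟨x, hx⟩ := hM.exists
    exact (An).trans hx
  set g : ℝ → ℝ := fun x => max (-M) (min (u x) M) with hg
  have gm : Measurable g := measurable_const.max (hu.1.min mci)
  have gM : ∀ x, |g x| ≤ M := fun x => abs_le.2 ⟨Mxl, max_le ln Mnr⟩
  have gu : ∀ᵐ x, g x = u x := by
    filter_upwards [hM] with x hx
    rw [hg]; simp only []
    rw [min_eq_left (abs_le.1 hx).2, max_eq_right (abs_le.1 hx).1]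
  have gd : ∀ᵐ x, HasDerivAt (intP u) (g x) x := by
    filter_upwards [gu, LocallyIntegrable.ae_hasDerivAt_integral hu.loc] with x sa h2
    rw [sa]; exact h2 0
  have qn := (Measure.measurePreserving_neg (volume : Measure ℝ)).quasiMeasurePreserving
  obtain ⟨κl, L, tl⟩ := ql.hs gm gM (gd.mono fun x h _ => h)
  obtain ⟨κr, R', tr⟩ := qr.hs (g := fun x => -g (-x)) (gm.comp measurable_neg).neg (fun x => by rw [abs_neg]; exact gM _) (by
    filter_upwards [qn.ae gd] with x h _
    simpa [Function.comp_def] using HasDerivAt.comp x (h : HasDerivAt (intP u) (g (-x)) (-x)) (hasDerivAt_neg x))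
  refine glue hc L R' (by
    filter_upwards [gu] with x h _
    rw [QP.wl, if_neg (lt_irrefl _), h]) (by
    filter_upwards [gu] with x h _
    rw [QP.wl, if_neg (lt_irrefl _), neg_neg, neg_neg, h]) ?_
  have ml : Lwz (Real.toNNReal (|ec| + |fl θl|)) (fun t => m (max t 0)) := LipschitzWith.of_dist_le_mul fun x y => by
    rw [Re, Re, Real.coe_toNNReal _ ps]
    exact (ql.lipM _ _ Mxr Mxr).trans (Mll (abs_max_sub_max_le_abs _ _ _) ps)
  filter_upwards [ml.ae_differentiableAt_real] with t h ht
  have hd : HasDerivAt m (deriv (fun t => m (max t 0)) t) t := h.hasDerivAt.congr_of_eventuallyEq (by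
    filter_upwards [Ioi_mem_nhds ht] with s hs
    rw [max_eq_left (le_of_lt hs)])
  obtain ⟨db, dc⟩ := m5 t _ ht hd
  obtain ⟨aa, ab⟩ := tl t ht
  obtain ⟨bb, bd⟩ := tr t ht
  have aa := aa _ hd
  have bb := bb _ hd
  refine ⟨aa.trans bb.symm, by linarith, ?_⟩
  rcases dc with dc | dc
  · left; linarith
  right
  rcases min_choice (nl t) (nr t) with e | e
  · left; rw [e] at dc; obtain ⟨y, hy, e⟩ := l2 t; exact ab ⟨y, hy, dc.trans e⟩
  · right; rw [e] at dc; obtain ⟨y, hy, e⟩ := r2 t; exact bd ⟨y, hy, dc.trans e⟩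

/-- the backward-forward datum `u_0^*` is the unique extremal point
of `I_T^{[AB]}(ω^T)` (part of Theorem 3.3 (ii) of the paper). -/
theorem vertex_is_unique_extremal_point
    {T a θl θr A B : ℝ} {fl fr : ℝ → ℝ}
    (hT : 0 < T)
    (hflC : ContDiff ℝ 2 fl) (hfrC : ContDiff ℝ 2 fr)
    (ha : 0 < a)
    (hfl2 : ∀ w : ℝ, a ≤ deriv (deriv fl) w)
    (hfr2 : ∀ w : ℝ, a ≤ deriv (deriv fr) w)
    (hf0 : fl 0 = fr 0) (hf1 : fl 1 = fr 1)
    (hθl : deriv fl θl = 0) (hθr : deriv fr θr = 0)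
    (hθl0 : 0 ≤ θl) (hθr1 : θr ≤ 1)
    (hAB : fl A = fr B) (hA' : deriv fl A ≤ 0) (hB' : 0 ≤ deriv fr B)
    {Bb Aa : ℝ} {ω : ℝ → ℝ}
    (hBb : Bb ≤ θr) (hBbf : fr Bb = fr B)
    (hAa : θl ≤ Aa) (hAaf : fl Aa = fl A)
    (hω : Attainable T fl fr A B ω)
    (v : ABSol fr fl Bb Aa (fun x => ω (-x)))
    (ustar : ABSol fl fr A B (fun x => v.u (-x) T))
    :
    IsExtremalPt (InitialSet T fl fr A B ω) (fun x => v.u (-x) T) ∧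
    (∀ w : ℝ → ℝ, IsExtremalPt (InitialSet T fl fr A B ω) w →
      ∀ᵐ x : ℝ ∂volume, w x = v.u (-x) T) := by
  have hc : Conn a fl fr A B (fl A) θl θr := ⟨ha, hflC, hfrC, hfl2, hfr2, hθl, hθr, rfl, hAB.symm, by
    by_contra! h; nlinarith [deriv_growth hflC hfl2 h.le], by
    by_contra! h; nlinarith [deriv_growth hfrC hfr2 h.le]⟩
  exact core hc ⟨ha, hfrC, hflC, hfr2, hfl2, hθr, hθl, hBbf.trans hAB.symm, hAaf, hBb, hAa⟩ hT hω (hex hc) v ustar
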